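/- Let (F,*) be a field with positive definite involution and let Q be a continuous *-factor over F with unique rank function N_Q, and assume there exists a *-subalgebra Q_0 of Q of countable F-dimension which is dense for the N_Q-metric. Then the following are equivalent: (i) Q is *-isomorphic to M_F; (ii) Q is *-isomorphic to the completion of some standard ultramatricial *-algebra B with respect to the metric induced by some extremal pseudo-rank function on B; (iii) for every eps > 0, all x_1, ..., x_n in Q, and all projections p_1, p_2 in Q, there exist a *-subalgebra A of Q which is *-isomorphic to a standard matricial *-algebra, elements y_1, ..., y_n in A, and hereditarily quasi-standard projections q_1, q_2 in A such that N_Q(p_j - q_j) < eps for j = 1, 2 and N_Q(x_i - y_i) < eps for i = 1, ..., n. -/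

import Mathlib

open scoped TensorProduct Kronecker

noncomputable section

namespace AraClaramunt

/-! ### Pseudo-rank functions and rank metric notions -/

/-- A pseudo-rank function on a unital ring. -/
structure IsPseudoRankFunction {R : Type*} [Ring R] (N : R → ℝ) : Prop where
  nonneg : ∀ x : R, 0 ≤ N x
  le_one : ∀ x : R, N x ≤ 1
  map_one : N 1 = 1
  subadditive : ∀ a b : R, N (a + b) ≤ N a + N b
  mul_le_left : ∀ a b : R, N (a * b) ≤ N a
  mul_le_right : ∀ a b : R, N (a * b) ≤ N b
  add_of_orthogonal : ∀ e f : R, IsIdempotentElem e → IsIdempotentElem f →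
    e * f = 0 → f * e = 0 → N (e + f) = N e + N f

/-- A rank function is a faithful pseudo-rank function. -/
def IsRankFunction {R : Type*} [Ring R] (N : R → ℝ) : Prop :=
  IsPseudoRankFunction N ∧ ∀ x : R, N x = 0 → x = 0

/-- Cauchy sequence for the pseudo-metric `d(x,y) = N (x - y)`. -/
def RankCauchy {R : Type*} [Ring R] (N : R → ℝ) (u : ℕ → R) : Prop :=
  ∀ ε : ℝ, 0 < ε → ∃ n₀ : ℕ, ∀ m n : ℕ, n₀ ≤ m → n₀ ≤ n → N (u m - u n) < ε

/-- Convergence for the pseudo-metric `d(x,y) = N (x - y)`. -/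
def RankTendsto {R : Type*} [Ring R] (N : R → ℝ) (u : ℕ → R) (x : R) : Prop :=
  ∀ ε : ℝ, 0 < ε → ∃ n₀ : ℕ, ∀ n : ℕ, n₀ ≤ n → N (u n - x) < ε

/-- Completeness with respect to the pseudo-metric `d(x,y) = N (x - y)`. -/
def RankComplete {R : Type*} [Ring R] (N : R → ℝ) : Prop :=
  ∀ u : ℕ → R, RankCauchy N u → ∃ x : R, RankTendsto N u x

/-- Density of a subset with respect to the pseudo-metric `d(x,y) = N (x - y)`. -/
def RankDense {R : Type*} [Ring R] (N : R → ℝ) (S : Set R) : Prop :=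
  ∀ x : R, ∀ ε : ℝ, 0 < ε → ∃ y ∈ S, N (x - y) < ε

/-- von Neumann regularity. -/
def VNRegular (R : Type*) [Ring R] : Prop :=
  ∀ x : R, ∃ y : R, x = x * y * x

/-- A continuous factor: a simple, von Neumann regular, right and left self-injective ring
admitting a rank function whose image is all of `[0,1]`. -/
def IsContinuousFactor (R : Type*) [Ring R] : Prop :=
  IsSimpleRing R ∧ VNRegular R ∧ Module.Injective R R ∧ Module.Injective Rᵐᵒᵖ Rᵐᵒᵖ ∧
    ∃ N : R → ℝ, IsRankFunction N ∧ Set.range N = Set.Icc (0 : ℝ) 1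

/-- An extremal pseudo-rank function: an extreme point of the convex set of all
pseudo-rank functions. -/
def IsExtremalPseudoRankFunction {R : Type*} [Ring R] (N : R → ℝ) : Prop :=
  N ∈ Set.extremePoints ℝ {S : R → ℝ | IsPseudoRankFunction S}

/-! ### Matricial and ultramatricial algebras -/

/-- A matricial `K`-algebra. -/
def IsMatricialAlgebra (K : Type*) [Field K] (A : Type*) [Ring A] [Algebra K A] : Prop :=
  ∃ (k : ℕ) (n : Fin (k + 1) → ℕ), (∀ i, 0 < n i) ∧
    Nonempty (A ≃ₐ[K] ((i : Fin (k + 1)) → Matrix (Fin (n i)) (Fin (n i)) K))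

/-- An ultramatricial `K`-algebra: the increasing union of matricial subalgebras. -/
def IsUltramatricialAlgebra (K : Type*) [Field K] (B : Type*) [Ring B] [Algebra K B] : Prop :=
  ∃ C : ℕ → Subalgebra K B, (∀ n, C n ≤ C (n + 1)) ∧
    (∀ n, IsMatricialAlgebra K (C n)) ∧ (∀ b : B, ∃ n, b ∈ C n)

/-- `Q`, with rank function `N`, is the rank-metric completion of a direct limit of the matrix
algebras `M_{p n}(K)`: it is complete and carries a dense increasing tower of unital subalgebras
isomorphic to `M_{p n}(K)`. -/
def IsMatrixTowerCompletion (K : Type*) [Field K] (Q : Type*) [Ring Q] [Algebra K Q]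
    (N : Q → ℝ) (p : ℕ → ℕ) : Prop :=
  IsRankFunction N ∧ RankComplete N ∧
    ∃ A : ℕ → Subalgebra K Q, (∀ n, A n ≤ A (n + 1)) ∧
      (∀ n, Nonempty ((A n) ≃ₐ[K] Matrix (Fin (p n)) (Fin (p n)) K)) ∧
      RankDense N (⋃ n, (A n : Set Q))

/-- `Q` is (a copy of) von Neumann's continuous factor `M_K`, the completion of
`lim_n M_{2^n}(K)` with respect to its unique rank function. -/
def IsMK (K : Type*) [Field K] (Q : Type*) [Ring Q] [Algebra K Q] (N : Q → ℝ) : Prop :=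
  IsMatrixTowerCompletion K Q N (fun n => 2 ^ n)

/-- The canonical block-diagonal unital embedding `M_a(K) → M_b(K)`, `z ↦ z ⊗ 1_g`,
where `b = a * g`. -/
def blockEmbedFun (K : Type*) [Semiring K] {a : ℕ} (g b : ℕ) (h : a * g = b)
    (z : Matrix (Fin a) (Fin a) K) : Matrix (Fin b) (Fin b) K :=
  Matrix.reindex (finProdFinEquiv.trans (finCongr h)) (finProdFinEquiv.trans (finCongr h))
    (z ⊗ₖ (1 : Matrix (Fin g) (Fin g) K))

end AraClaramunt
namespace AraClaramunt

/-! ### Star notions -/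

/-- Properness of an involution: `x* x = 0` implies `x = 0`. -/
def ProperStar (R : Type*) [NonUnitalNonAssocRing R] [Star R] : Prop :=
  ∀ x : R, star x * x = 0 → x = 0

/-- A projection: a self-adjoint idempotent. -/
def IsProjection {R : Type*} [Mul R] [Star R] (p : R) : Prop :=
  star p = p ∧ p * p = p

/-- The order on projections: `q ≤ p` iff `p q = q p = q`. -/
def ProjLE {R : Type*} [Mul R] (q p : R) : Prop :=
  p * q = q ∧ q * p = q

/-- `*`-equivalence of projections: `e = w w*` and `f = w* w` for some `w`. -/
def StarEquivProj {R : Type*} [Mul R] [Star R] (e f : R) : Prop :=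
  ∃ w : R, e = w * star w ∧ f = star w * w

/-- Equivalence of projections: `e = x y`, `f = y x` with `x ∈ eRf`, `y ∈ fRe`. -/
def EquivProj {R : Type*} [Mul R] (e f : R) : Prop :=
  ∃ x y : R, x = e * x * f ∧ y = f * y * e ∧ e = x * y ∧ f = y * x

/-- `y` is the relative inverse of `x` in a `*`-regular ring. -/
def IsRelativeInverse {R : Type*} [Mul R] [Star R] (x y : R) : Prop :=
  x * y * x = x ∧ y * x * y = y ∧ star (x * y) = x * y ∧ star (y * x) = y * x

/-- `e = LP(x)`: `e` is a projection with `x R = e R`. -/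
def IsLeftProjOf {R : Type*} [Mul R] [Star R] (x e : R) : Prop :=
  IsProjection e ∧ e * x = x ∧ ∃ y : R, e = x * y

/-- `f = RP(x)`: `f` is a projection with `R x = R f`. -/
def IsRightProjOf {R : Type*} [Mul R] [Star R] (x f : R) : Prop :=
  IsProjection f ∧ x * f = x ∧ ∃ y : R, f = y * x

/-- Positive definiteness of the involution of a field. -/
def PosDefStar (F : Type*) [Field F] [StarRing F] : Prop :=
  ∀ (n : ℕ) (x : Fin n → F), (∑ i, star (x i) * x i) = 0 → ∀ i, x i = 0

/-- `*`-Pythagorean field. -/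
def StarPythagorean (F : Type*) [Field F] [StarRing F] : Prop :=
  ∀ x y : F, ∃ z : F, x * star x + y * star y = z * star z

/-- A standard matricial `*`-algebra over `(F, *)`: a `*`-algebra `*`-isomorphic to a finite
product of matrix algebras `M_{n i}(F)` with the `*`-transpose involution. -/
def IsStandardMatricialStarAlgebra (F : Type*) [Field F] [StarRing F]
    (A : Type*) [Ring A] [Algebra F A] [StarRing A] [StarModule F A] : Prop :=
  ∃ (k : ℕ) (n : Fin (k + 1) → ℕ), (∀ i, 0 < n i) ∧
    Nonempty (A ≃⋆ₐ[F] ((i : Fin (k + 1)) → Matrix (Fin (n i)) (Fin (n i)) F))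

/-- A map `M_a(F) → M_b(F)` is standard (up to a permutation of the index set) if it is
`z ↦ diag(z, …, z)` (multiplicity `t`), suitably reindexed. -/
def IsStandardMatrixMap (F : Type*) [Field F] {a b : ℕ}
    (Φ : Matrix (Fin a) (Fin a) F → Matrix (Fin b) (Fin b) F) : Prop :=
  ∃ (t : ℕ) (E : Fin a × Fin t ≃ Fin b),
    ∀ z, Φ z = Matrix.reindex E E (Matrix.blockDiagonal fun _ : Fin t => z)

/-- A map between finite products of matrix algebras over `F` is standard (block diagonal,
up to a permutation of the index sets): it is determined by multiplicities `t j i`, the `j`-th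
component being the block-diagonal sum of `t j i` copies of the `i`-th component of the input. -/
def IsStandardBlockMap (F : Type*) [Field F] {k l : ℕ} (n : Fin (k + 1) → ℕ)
    (m : Fin (l + 1) → ℕ)
    (Φ : ((i : Fin (k + 1)) → Matrix (Fin (n i)) (Fin (n i)) F) →
      ((j : Fin (l + 1)) → Matrix (Fin (m j)) (Fin (m j)) F)) : Prop :=
  ∃ t : Fin (l + 1) → Fin (k + 1) → ℕ,
    ∃ E : (j : Fin (l + 1)) →
      ((Σ c : (Σ i : Fin (k + 1), Fin (t j i)), Fin (n c.1)) ≃ Fin (m j)),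
      ∀ z j, Φ z j =
        Matrix.reindex (E j) (E j)
          (Matrix.blockDiagonal' fun c : (Σ i : Fin (k + 1), Fin (t j i)) => z c.1)

end AraClaramunt
namespace AraClaramunt

/-- `Q`, with rank function `N`, is (a copy of) the `*`-algebra `M_F`: the completion of the
standard direct limit `lim_n M_{2^n}(F)` (block-diagonal standard `*`-embeddings) with respect
to its unique rank function, with the involution induced by the `*`-transpose involutions. -/
def IsMFStarCompletion (F : Type*) [Field F] [StarRing F]
    (Q : Type*) [Ring Q] [Algebra F Q] [StarRing Q] [StarModule F Q] (N : Q → ℝ) : Prop :=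
  IsRankFunction N ∧ (∀ x : Q, N (star x) = N x) ∧ RankComplete N ∧
    ∃ A : ℕ → StarSubalgebra F Q,
      ∃ hA : ∀ n, A n ≤ A (n + 1),
        ∃ γ : (n : ℕ) → ((A n) ≃⋆ₐ[F] Matrix (Fin (2 ^ n)) (Fin (2 ^ n)) F),
          RankDense N (⋃ n, (A n : Set Q)) ∧
            ∀ n, IsStandardMatrixMap F
              (fun z => γ (n + 1) (StarSubalgebra.inclusion (hA n) ((γ n).symm z)))

/-- A standard ultramatricial `*`-algebra: an increasing union of `*`-subalgebras,
`*`-isomorphic to standard matricial `*`-algebras, with standard (block diagonal)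
connecting maps. -/
def IsStandardUltramatricialStarAlgebra (F : Type*) [Field F] [StarRing F]
    (B : Type*) [Ring B] [Algebra F B] [StarRing B] [StarModule F B] : Prop :=
  ∃ C : ℕ → StarSubalgebra F B,
    ∃ hC : ∀ n, C n ≤ C (n + 1),
      (∀ b : B, ∃ n, b ∈ C n) ∧
        ∃ (k : ℕ → ℕ) (m : (n : ℕ) → Fin (k n + 1) → ℕ),
          (∀ n i, 0 < m n i) ∧
            ∃ γ : (n : ℕ) →
              ((C n) ≃⋆ₐ[F] ((i : Fin (k n + 1)) → Matrix (Fin (m n i)) (Fin (m n i)) F)),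
              ∀ n, IsStandardBlockMap F (m n) (m (n + 1))
                (fun z => γ (n + 1) (StarSubalgebra.inclusion (hC n) ((γ n).symm z)))

/-- An ultramatricial `*`-algebra: an increasing union of `*`-subalgebras which are
`*`-isomorphic to standard matricial `*`-algebras. -/
def IsUltramatricialStarAlgebra (F : Type*) [Field F] [StarRing F]
    (B : Type*) [Ring B] [Algebra F B] [StarRing B] [StarModule F B] : Prop :=
  ∃ C : ℕ → StarSubalgebra F B, (∀ n, C n ≤ C (n + 1)) ∧
    (∀ n, IsStandardMatricialStarAlgebra F (C n)) ∧ (∀ b : B, ∃ n, b ∈ C n)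

/-- `p` is `*`-equivalent (in `A`) to a standard projection of `A`, i.e. to a projection all of
whose components under some `*`-isomorphism of `A` with a standard matricial `*`-algebra are
diagonal matrices. -/
def IsQuasiStandardProjection (F : Type*) [Field F] [StarRing F]
    (A : Type*) [Ring A] [Algebra F A] [StarRing A] [StarModule F A] (p : A) : Prop :=
  ∃ (k : ℕ) (n : Fin (k + 1) → ℕ), (∀ i, 0 < n i) ∧
    ∃ (γ : A ≃⋆ₐ[F] ((i : Fin (k + 1)) → Matrix (Fin (n i)) (Fin (n i)) F)) (e : A),
      IsProjection e ∧ (∀ i, (γ e i).IsDiag) ∧ StarEquivProj p e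

/-- Hereditarily quasi-standard projection (Definition 4.4 of the paper). -/
def IsHereditarilyQuasiStandard (F : Type*) [Field F] [StarRing F]
    {R : Type*} [Ring R] [Algebra F R] [StarRing R] [StarModule F R]
    (N : R → ℝ) (A : StarSubalgebra F R) (p : R) : Prop :=
  ∃ hp : p ∈ A,
    IsQuasiStandardProjection F A ⟨p, hp⟩ ∧
      ∀ p' : R, p' ∈ A → IsProjection p' → ProjLE p' p → ∀ ε : ℝ, 0 < ε →
        ∃ A' : StarSubalgebra F R, A ≤ A' ∧ IsStandardMatricialStarAlgebra F A' ∧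
          ∃ p'' : R, ∃ hp'' : p'' ∈ A', IsProjection p'' ∧ ProjLE p'' p' ∧
            N (p' - p'') < ε ∧ IsQuasiStandardProjection F A' ⟨p'', hp''⟩

end AraClaramunt
namespace AraClaramunt

/-- Witness that `Q` (with rank function `NQ`) is `*`-isomorphic to the completion of a standard
ultramatricial `*`-algebra `B` with respect to the metric induced by an extremal pseudo-rank
function `NB` on `B`. -/
structure StdUltramatricialStarCompletionData (F : Type) [Field F] [StarRing F]
    (Q : Type) [Ring Q] [Algebra F Q] [StarRing Q] [StarModule F Q]
    (NQ : Q → ℝ) : Type 1 where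
  B : Type
  [ringB : Ring B]
  [algB : Algebra F B]
  [starB : StarRing B]
  [starModB : StarModule F B]
  NB : B → ℝ
  pseudoRank : IsPseudoRankFunction NB
  extremal : IsExtremalPseudoRankFunction NB
  stdUltramatricial : IsStandardUltramatricialStarAlgebra F B
  φ : B →⋆ₐ[F] Q
  rank_eq : ∀ b : B, NQ (φ b) = NB b
  dense : RankDense NQ (Set.range φ)
  complete : RankComplete NQ

section P1
/-! ### Part 1: rank basics -/
section P1
variable {Q : Type*} [Ring Q] {N : Q → ℝ}

lemma prf_zero (h : IsPseudoRankFunction N) : N 0 = 0 := by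
  have := h.add_of_orthogonal 0 0 (by simp [IsIdempotentElem]) (by simp [IsIdempotentElem])
    (by simp) (by simp)
  simp at this
  exact this

lemma prf_neg (h : IsPseudoRankFunction N) (x : Q) : N (-x) = N x := by
  apply le_antisymm
  · have := h.mul_le_right (-1) x
    simpa using this
  · have := h.mul_le_right (-1) (-x)
    simpa using this

lemma prf_sub_comm (h : IsPseudoRankFunction N) (x y : Q) : N (x - y) = N (y - x) := by
  rw [← prf_neg h, neg_sub]

lemma prf_sub_le (h : IsPseudoRankFunction N) (x y : Q) : N (x - y) ≤ N x + N y := by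
  rw [sub_eq_add_neg, ← prf_neg h y]
  exact h.subadditive _ _

lemma prf_tri (h : IsPseudoRankFunction N) (x y z : Q) : N (x - z) ≤ N (x - y) + N (y - z) := by
  have := h.subadditive (x - y) (y - z)
  simpa using this

lemma prf_le_add (h : IsPseudoRankFunction N) (x y : Q) : N x ≤ N y + N (x - y) := by
  have := h.subadditive y (x - y)
  simpa using this

lemma prf_sum_le (h : IsPseudoRankFunction N) {ι : Type*} (s : Finset ι) (f : ι → Q) :
    N (∑ i ∈ s, f i) ≤ ∑ i ∈ s, N (f i) := by
  classical
  induction s using Finset.induction_on with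
  | empty => simp [prf_zero h]
  | insert a s ha ih =>
    rw [Finset.sum_insert ha, Finset.sum_insert ha]
    exact (h.subadditive _ _).trans (by linarith)

lemma prf_mul_mul_le (h : IsPseudoRankFunction N) (a x b : Q) : N (a * x * b) ≤ N x :=
  (h.mul_le_left _ _).trans (h.mul_le_right _ _)

/-- additivity for finite orthogonal families of idempotents -/
lemma prf_sum_orth (h : IsPseudoRankFunction N) {ι : Type*} (s : Finset ι) (e : ι → Q)
    (hi : ∀ i ∈ s, e i * e i = e i) (ho : ∀ i ∈ s, ∀ j ∈ s, i ≠ j → e i * e j = 0) :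
    N (∑ i ∈ s, e i) = ∑ i ∈ s, N (e i) := by
  classical
  induction s using Finset.induction_on with
  | empty => simp [prf_zero h]
  | insert a s ha ih =>
    rw [Finset.sum_insert ha, Finset.sum_insert ha, h.add_of_orthogonal, ih]
    · intro i hi'; exact hi i (Finset.mem_insert_of_mem hi')
    · intro i hi' j hj'; exact ho i (Finset.mem_insert_of_mem hi') j (Finset.mem_insert_of_mem hj')
    · exact hi a (Finset.mem_insert_self _ _)
    · show (∑ i ∈ s, e i) * (∑ i ∈ s, e i) = _
      rw [Finset.sum_mul]
      refine Finset.sum_congr rfl fun i his => ?_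
      rw [Finset.mul_sum, Finset.sum_eq_single i]
      · exact hi i (Finset.mem_insert_of_mem his)
      · intro j hj hji
        exact ho i (Finset.mem_insert_of_mem his) j (Finset.mem_insert_of_mem hj) (Ne.symm hji)
      · intro hh; exact absurd his hh
    · rw [Finset.mul_sum]
      refine Finset.sum_eq_zero fun i his => ?_
      exact ho _ (Finset.mem_insert_self _ _) _ (Finset.mem_insert_of_mem his)
        (fun hh => ha (hh ▸ his))
    · rw [Finset.sum_mul]
      refine Finset.sum_eq_zero fun i his => ?_
      exact ho _ (Finset.mem_insert_of_mem his) _ (Finset.mem_insert_self _ _)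
        (fun hh => ha (hh ▸ his))

/-- `N (p - q) = N p - N q` for idempotents `q ≤ p`. -/
lemma prf_sub_of_le (h : IsPseudoRankFunction N) {p q : Q} (hp : p * p = p) (hq : q * q = q)
    (h1 : p * q = q) (h2 : q * p = q) : N (p - q) = N p - N q := by
  have := h.add_of_orthogonal (p - q) q (by
      show (p - q) * (p - q) = p - q
      simp [sub_mul, mul_sub, hp, hq, h1, h2]) hq (by simp [sub_mul, h1, hq])
      (by simp [mul_sub, h2, hq])
  simp at this
  linarith

end P1

section simple
variable {Q : Type*} [Ring Q]

lemma simple_span (hs : IsSimpleRing Q) (z : Q) (hz : z ≠ 0) :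
    ∃ (M : ℕ) (a b : Fin M → Q), (1 : Q) = ∑ i, a i * z * b i := by
  have h1 : (1 : Q) ∈ TwoSidedIdeal.span {z} := by
    have : TwoSidedIdeal.span {z} = ⊤ := by
      rcases hs.simple.eq_bot_or_eq_top (TwoSidedIdeal.span {z}) with h | h
      · exfalso
        have : z ∈ TwoSidedIdeal.span {z} := TwoSidedIdeal.subset_span rfl
        rw [h] at this
        exact hz (by simpa using this)
      · exact h
    rw [this]; trivial
  rw [TwoSidedIdeal.mem_span_iff_mem_addSubgroup_closure] at h1
  refine AddSubgroup.closure_induction (p := fun x _ => ∃ (M : ℕ) (a b : Fin M → Q),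
    x = ∑ i, a i * z * b i) ?_ ?_ ?_ ?_ h1
  · intro x hx
    obtain ⟨y, ⟨r, -, w, hw, rfl⟩, s, -, rfl⟩ := hx
    rw [Set.mem_singleton_iff] at hw
    subst hw
    exact ⟨1, fun _ => r, fun _ => s, by simp⟩
  · exact ⟨0, Fin.elim0, Fin.elim0, by simp⟩
  · intro x y _ _ hx hy
    obtain ⟨M, a, b, hx⟩ := hx
    obtain ⟨M', a', b', hy⟩ := hy
    exact ⟨M + M', Fin.append a a', Fin.append b b', by simp [Fin.sum_univ_add, ← hx, ← hy]⟩
  · intro x _ hx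
    obtain ⟨M, a, b, hx⟩ := hx
    exact ⟨M, fun i => - a i, b, by simp [hx]⟩

lemma simple_prime (hs : IsSimpleRing Q) (a b : Q) (h : ∀ r, a * r * b = 0) : a = 0 ∨ b = 0 := by
  by_cases hb : b = 0
  · exact Or.inr hb
  · left
    obtain ⟨M, u, v, h1⟩ := simple_span hs b hb
    rw [← mul_one a, h1, Finset.mul_sum]
    refine Finset.sum_eq_zero fun i _ => ?_
    rw [← mul_assoc, ← mul_assoc, h, zero_mul]

/-- algebraic subequivalence of idempotents -/
def SubEq (e f : Q) : Prop := ∃ x y : Q, e * x = x ∧ x * f = x ∧ f * y = y ∧ y * e = y ∧ x * y = e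

lemma comparability (hs : IsSimpleRing Q) (hr : VNRegular Q) (hinj : Module.Injective Q Q)
    (e f : Q) (he : e * e = e) (hf : f * f = f) : SubEq e f ∨ SubEq f e := by
  let S : Set (Submodule Q (Q × Q)) := {G | ∀ p ∈ G, p.1 * e = p.1 ∧ p.2 * f = p.2 ∧
    (p.1 = 0 ↔ p.2 = 0)}
  obtain ⟨G, hG⟩ : ∃ G, Maximal (· ∈ S) G := by
    apply zorn_le₀
    intro c hcS hc
    rcases c.eq_empty_or_nonempty with rfl | hne
    · refine ⟨⊥, ?_, by simp⟩
      intro p hp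
      simp only [Submodule.mem_bot] at hp
      subst hp; simp
    · refine ⟨sSup c, ?_, fun z hz => le_sSup hz⟩
      intro p hp
      rw [Submodule.mem_sSup_of_directed hne hc.directedOn] at hp
      obtain ⟨G, hGc, hpG⟩ := hp
      exact hcS hGc p hpG
  obtain ⟨hGS, hmax⟩ := hG
  have ex1 : ∃ x : Q, ∀ p ∈ G, p.2 = p.1 * x := by
    obtain ⟨h, hh⟩ := hinj.out ((LinearMap.fst Q Q Q).comp G.subtype) (by
      rw [← LinearMap.ker_eq_bot, LinearMap.ker_eq_bot']
      rintro ⟨p, hp⟩ h0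
      simp at h0
      have := (hGS p hp).2.2.1 h0
      ext <;> simp [h0, this]) ((LinearMap.snd Q Q Q).comp G.subtype)
    refine ⟨h 1, fun p hp => ?_⟩
    have := hh ⟨p, hp⟩
    simp at this
    rw [← this, ← smul_eq_mul, ← map_smul, smul_eq_mul, mul_one]
  have ex2 : ∃ y : Q, ∀ p ∈ G, p.1 = p.2 * y := by
    obtain ⟨h, hh⟩ := hinj.out ((LinearMap.snd Q Q Q).comp G.subtype) (by
      rw [← LinearMap.ker_eq_bot, LinearMap.ker_eq_bot']
      rintro ⟨p, hp⟩ h0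
      simp at h0
      have := (hGS p hp).2.2.2 h0
      ext <;> simp [h0, this]) ((LinearMap.fst Q Q Q).comp G.subtype)
    refine ⟨h 1, fun p hp => ?_⟩
    have := hh ⟨p, hp⟩
    simp at this
    rw [← this, ← smul_eq_mul, ← map_smul, smul_eq_mul, mul_one]
  obtain ⟨x0, hx0⟩ := ex1
  obtain ⟨y0, hy0⟩ := ex2
  -- corner versions
  obtain ⟨x, hxdef⟩ : ∃ x, x = e * x0 * f := ⟨_, rfl⟩
  obtain ⟨y, hydef⟩ : ∃ y, y = f * y0 * e := ⟨_, rfl⟩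
  have hex : e * x = x := by rw [hxdef]; simp only [← mul_assoc, he]
  have hxf : x * f = x := by rw [hxdef]; simp only [mul_assoc, hf]
  have hfy : f * y = y := by rw [hydef]; simp only [← mul_assoc, hf]
  have hye : y * e = y := by rw [hydef]; simp only [mul_assoc, he]
  have hx : ∀ p ∈ G, p.2 = p.1 * x := fun p hp => by
    obtain ⟨h1, h2, _⟩ := hGS p hp
    rw [hxdef, ← mul_assoc, ← mul_assoc, h1, ← hx0 p hp, h2]
  have hy : ∀ p ∈ G, p.1 = p.2 * y := fun p hp => by
    obtain ⟨h1, h2, _⟩ := hGS p hp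
    rw [hydef, ← mul_assoc, ← mul_assoc, h2, ← hy0 p hp, h1]
  obtain ⟨w0, hw0⟩ := hr x
  obtain ⟨v0, hv0⟩ := hr y
  obtain ⟨w, hwdef⟩ : ∃ w, w = f * w0 * e := ⟨_, rfl⟩
  obtain ⟨v, hvdef⟩ : ∃ v, v = e * v0 * f := ⟨_, rfl⟩
  have hxwx : x * w * x = x := by
    rw [hwdef]
    calc x * (f * w0 * e) * x = (x * f) * w0 * (e * x) := by simp only [mul_assoc]
      _ = x := by rw [hxf, hex]; exact hw0.symm
  have hyvy : y * v * y = y := by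
    rw [hvdef]
    calc y * (e * v0 * f) * y = (y * e) * v0 * (f * y) := by simp only [mul_assoc]
      _ = y := by rw [hye, hfy]; exact hv0.symm
  have hwe : w * e = w := by rw [hwdef]; simp only [mul_assoc, he]
  have hfw : f * w = w := by rw [hwdef]; simp only [← mul_assoc, hf]
  have hvf : v * f = v := by rw [hvdef]; simp only [mul_assoc, hf]
  have hev : e * v = v := by rw [hvdef]; simp only [← mul_assoc, he]
  have key : ∀ r, (e - x * w) * r * (f - y * v) = 0 := by
    intro r
    by_contra hz
    obtain ⟨z, hzdef⟩ : ∃ z, z = (e - x * w) * r * (f - y * v) := ⟨_, rfl⟩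
    rw [← hzdef] at hz
    have he'x : (e - x * w) * x = 0 := by rw [sub_mul, hex, hxwx, sub_self]
    have hf'y : (f - y * v) * y = 0 := by rw [sub_mul, hfy, hyvy, sub_self]
    have hee2 : (e - x * w) * (e - x * w) = e - x * w := by
      rw [mul_sub, ← mul_assoc, he'x, zero_mul, sub_zero, sub_mul, he, mul_assoc, hwe]
    have hff2 : (f - y * v) * (f - y * v) = f - y * v := by
      rw [mul_sub, ← mul_assoc, hf'y, zero_mul, sub_zero, sub_mul, hf, mul_assoc, hvf]
    obtain ⟨u0, hu0⟩ := hr z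
    obtain ⟨u, hudef⟩ : ∃ u, u = (f - y * v) * u0 * (e - x * w) := ⟨_, rfl⟩
    have he'z : (e - x * w) * z = z := by rw [hzdef]; simp only [← mul_assoc, hee2]
    have hzf' : z * (f - y * v) = z := by rw [hzdef]; simp only [mul_assoc, hff2]
    have hzuz : z * u * z = z := by
      rw [hudef]
      calc z * ((f - y * v) * u0 * (e - x * w)) * z
          = (z * (f - y * v)) * u0 * ((e - x * w) * z) := by simp only [mul_assoc]
        _ = z := by rw [he'z, hzf']; exact hu0.symm
    have hux : u * x = 0 := by rw [hudef, mul_assoc, he'x, mul_zero]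
    have hzy : z * y = 0 := by rw [← hzf', mul_assoc, hf'y, mul_zero]
    have hue : u * e = u := by
      rw [hudef, mul_assoc, sub_mul e (x * w) e, he, mul_assoc x, hwe]
    have hzf : z * f = z := by
      rw [hzdef, mul_assoc, sub_mul f (y * v) f, hf, mul_assoc y, hvf]
    have hmem : G ⊔ Submodule.span Q {((z * u, z) : Q × Q)} ∈ S := by
      intro p hp
      rw [Submodule.mem_sup] at hp
      obtain ⟨p0, hp0, q, hq, rfl⟩ := hp
      rw [Submodule.mem_span_singleton] at hq
      obtain ⟨t, rfl⟩ := hq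
      obtain ⟨h1, h2, h3⟩ := hGS p0 hp0
      have a1 := hx p0 hp0
      have a2 := hy p0 hp0
      simp only [Prod.fst_add, Prod.snd_add, Prod.smul_fst, Prod.smul_snd, smul_eq_mul]
      refine ⟨?_, ?_, ?_, ?_⟩
      · rw [add_mul, h1, mul_assoc, mul_assoc z, hue]
      · rw [add_mul, h2, mul_assoc, hzf]
      · intro h0
        have e1 : p0.1 * x = 0 := by
          have := congrArg (· * x) h0
          simp only [add_mul, mul_assoc, hux, mul_zero, add_zero, zero_mul] at this
          exact this
        have e2 : p0.2 = 0 := by rw [a1, e1]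
        have e3 : p0.1 = 0 := h3.2 e2
        rw [e3, zero_add] at h0
        have e4 : t * z = 0 := by rw [← hzuz, ← mul_assoc, h0, zero_mul]
        rw [e2, e4, add_zero]
      · intro h0
        have e1 : p0.2 * y = 0 := by
          have := congrArg (· * y) h0
          simp only [add_mul, mul_assoc, hzy, mul_zero, add_zero, zero_mul] at this
          exact this
        have e2 : p0.1 = 0 := by rw [a2, e1]
        have e3 : p0.2 = 0 := h3.1 e2
        rw [e3, zero_add] at h0
        rw [e2, ← mul_assoc, h0, zero_mul, zero_add]
    have hle := hmax hmem le_sup_left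
    have hin : ((z * u, z) : Q × Q) ∈ G :=
      hle (Submodule.mem_sup_right (Submodule.mem_span_singleton_self _))
    have := hx _ hin
    simp only [mul_assoc, hux, mul_zero] at this
    exact hz this
  rcases simple_prime hs _ _ key with h | h
  · left
    exact ⟨x, w, hex, hxf, hfw, hwe, (sub_eq_zero.1 h).symm⟩
  · right
    exact ⟨y, v, hfy, hye, hev, hvf, (sub_eq_zero.1 h).symm⟩

end simple
end P1

section P2
variable {Q : Type*} [Ring Q] {N : Q → ℝ}

lemma SubEq.le (h : IsPseudoRankFunction N) {e f : Q} (hs : SubEq e f) : N e ≤ N f := by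
  obtain ⟨x, y, h1, h2, h3, h4, h5⟩ := hs
  have : e = x * f * y := by rw [h2, h5]
  rw [this]
  exact prf_mul_mul_le h _ _ _

lemma subEq_of_le (hN : IsRankFunction N)
    (hc : ∀ e f : Q, e * e = e → f * f = f → SubEq e f ∨ SubEq f e)
    (e f : Q) (he : e * e = e) (hf : f * f = f) (hle : N e ≤ N f) : SubEq e f := by
  rcases hc e f he hf with h | ⟨x, y, h1, h2, h3, h4, h5⟩
  · exact h
  · have hg : (y * x) * (y * x) = y * x := by
      rw [mul_assoc, ← mul_assoc x, h5, h1]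
    have heg : e * (y * x) = y * x := by rw [← mul_assoc, h3]
    have hge : (y * x) * e = y * x := by rw [mul_assoc, h2]
    have h6 : N f ≤ N (y * x) := by
      have : f = x * (y * x) * y := by
        rw [← mul_assoc, h5, mul_assoc, h5, hf]
      conv_lhs => rw [this]
      exact prf_mul_mul_le hN.1 _ _ _
    have h7 := prf_sub_of_le hN.1 he hg heg hge
    have h8 := hN.1.nonneg (e - y * x)
    have h9 : N (e - y * x) = 0 := by linarith
    have h10 := hN.2 _ h9
    exact ⟨y, x, h3, h4, h1, h2, (sub_eq_zero.1 h10).symm⟩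

lemma idem_of_rank (hN : IsRankFunction N) (hr : VNRegular Q)
    (hfull : ∀ t : ℝ, 0 ≤ t → t ≤ 1 → ∃ x, N x = t) (t : ℝ) (h0 : 0 ≤ t) (h1 : t ≤ 1) :
    ∃ e : Q, e * e = e ∧ N e = t := by
  obtain ⟨x, hx⟩ := hfull t h0 h1
  obtain ⟨y, hy⟩ := hr x
  refine ⟨x * y, ?_, ?_⟩
  · rw [← mul_assoc, ← hy]
  · apply le_antisymm
    · rw [← hx]; exact hN.1.mul_le_left _ _
    · rw [← hx]; conv_lhs => rw [hy]
      exact hN.1.mul_le_left _ _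

lemma subidem_of_rank (hN : IsRankFunction N) (hr : VNRegular Q)
    (hfull : ∀ t : ℝ, 0 ≤ t → t ≤ 1 → ∃ x, N x = t)
    (hsub : ∀ e f : Q, e * e = e → f * f = f → N e ≤ N f → SubEq e f)
    (f : Q) (hf : f * f = f) (t : ℝ) (h0 : 0 ≤ t) (h1 : t ≤ N f) :
    ∃ e : Q, e * e = e ∧ f * e = e ∧ e * f = e ∧ N e = t := by
  obtain ⟨e, he, het⟩ := idem_of_rank hN hr hfull t h0 (h1.trans (hN.1.le_one f))
  obtain ⟨x, y, a1, a2, a3, a4, a5⟩ := hsub e f he hf (by rw [het]; exact h1)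
  refine ⟨y * x, ?_, ?_, ?_, ?_⟩
  · rw [mul_assoc, ← mul_assoc x, a5, a1]
  · rw [← mul_assoc, a3]
  · rw [mul_assoc, a2]
  · apply le_antisymm
    · have : y * x = y * e * x := by rw [a4]
      rw [this, ← het]; exact prf_mul_mul_le hN.1 _ _ _
    · have : e = x * (y * x) * y := by
        rw [← mul_assoc, a5, mul_assoc, a5, he]
      rw [← het]
      conv_lhs => rw [this]
      exact prf_mul_mul_le hN.1 _ _ _

/-- uniqueness of the rank function -/
lemma rank_unique {N M : Q → ℝ} (hN : IsRankFunction N) (hM : IsRankFunction M) (hr : VNRegular Q)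
    (hfull : ∀ t : ℝ, 0 ≤ t → t ≤ 1 → ∃ x, N x = t)
    (hsub : ∀ e f : Q, e * e = e → f * f = f → N e ≤ N f → SubEq e f) : M = N := by
  have eqv : ∀ e f : Q, e * e = e → f * f = f → N e ≤ N f → M e ≤ M f := fun e f he hf h =>
    (hsub e f he hf h).le hM.1
  -- chains
  have chain : ∀ n : ℕ, 0 < n → ∃ e : ℕ → Q, (∀ j, e j * e j = e j) ∧
      ∀ j, j ≤ n → N (e j) = j / n ∧ M (e j) = j / n := by
    intro n hn
    have hn' : (0 : ℝ) < n := by exact_mod_cast hn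
    obtain ⟨u, hu, hNu⟩ := idem_of_rank hN hr hfull (1 / n) (by positivity)
      (by rw [div_le_one hn']; exact_mod_cast hn)
    have ex : ∀ j, ∃ e : Q, e * e = e ∧ (j ≤ n → N e = j / n ∧ M e = j * M u) := by
      intro j
      induction j with
      | zero => exact ⟨0, by simp, fun _ => by simp [prf_zero hN.1, prf_zero hM.1]⟩
      | succ j ih =>
        obtain ⟨e, he, hj⟩ := ih
        by_cases hjn : j + 1 ≤ n
        · obtain ⟨h1, h2⟩ := hj (by omega)
          have hid : (1 - e) * (1 - e) = 1 - e := by simp [mul_sub, sub_mul, he]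
          have hNe : N (1 - e) = 1 - j / n := by
            rw [prf_sub_of_le hN.1 (by simp) he (by simp) (by simp), h1, hN.1.map_one]
          obtain ⟨v, hv, b1, b2, b3⟩ := subidem_of_rank hN hr hfull hsub (1 - e) hid (1 / n)
            (by positivity) (by
              rw [hNe, le_sub_iff_add_le, ← add_div, div_le_one hn']
              have : ((j + 1 : ℕ) : ℝ) ≤ n := by exact_mod_cast hjn
              push_cast at this; linarith)
          have hev : e * v = 0 := by rw [← b1, ← mul_assoc]; simp [mul_sub, he]
          have hve : v * e = 0 := by rw [← b2, mul_assoc]; simp [sub_mul, he]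
          refine ⟨e + v, by simp [add_mul, mul_add, he, hv, hev, hve], fun _ => ⟨?_, ?_⟩⟩
          · rw [hN.1.add_of_orthogonal e v he hv hev hve, h1, b3]; push_cast; ring
          · rw [hM.1.add_of_orthogonal e v he hv hev hve, h2]
            have : M v = M u := le_antisymm (eqv v u hv hu (by rw [b3, hNu]))
              (eqv u v hu hv (by rw [b3, hNu]))
            rw [this]; push_cast; ring
        · exact ⟨e, he, fun h => absurd h hjn⟩
    choose e he1 he2 using ex
    have hMu : M u = 1 / n := by
      have h1 := he2 n le_rfl
      have h2 : N (e n) = 1 := by rw [h1.1]; field_simp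
      have h3 : e n = 1 := by
        have h5 := prf_sub_of_le hN.1 (p := 1) (by simp) (he1 n) (by simp) (by simp)
        rw [h2, hN.1.map_one, sub_self] at h5
        exact (sub_eq_zero.1 (hN.2 _ h5)).symm
      have h4 := h1.2
      rw [h3, hM.1.map_one] at h4
      field_simp
      linarith
    refine ⟨e, he1, fun j hj => ⟨(he2 j hj).1, ?_⟩⟩
    rw [(he2 j hj).2, hMu]; ring
  have idem : ∀ e : Q, e * e = e → M e = N e := by
    intro e he
    have bound : ∀ n : ℕ, 0 < n → |M e - N e| ≤ 1 / n := by
      intro n hn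
      have hn' : (0 : ℝ) < n := by exact_mod_cast hn
      obtain ⟨c, hc, hcj⟩ := chain n hn
      have hNn := hN.1.nonneg e
      have hN1 := hN.1.le_one e
      have f1 : (⌊N e * n⌋₊ : ℝ) ≤ N e * n := Nat.floor_le (by positivity)
      have f2 : N e * n < ⌊N e * n⌋₊ + 1 := Nat.lt_floor_add_one _
      have f3 : ⌊N e * n⌋₊ ≤ n := by
        have : (⌊N e * n⌋₊ : ℝ) ≤ n := f1.trans (by nlinarith)
        exact_mod_cast this
      have g1 := hcj _ f3
      have l1 : M (c ⌊N e * n⌋₊) ≤ M e := eqv _ _ (hc _) he (by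
        rw [g1.1, div_le_iff₀ hn']; exact f1)
      rw [g1.2, div_le_iff₀ hn'] at l1
      have l2 : M e * n ≤ ⌊N e * n⌋₊ + 1 := by
        by_cases hlt : ⌊N e * n⌋₊ + 1 ≤ n
        · have g2 := hcj _ hlt
          have l2 : M e ≤ M (c (⌊N e * n⌋₊ + 1)) := eqv _ _ he (hc _) (by
            rw [g2.1, le_div_iff₀ hn']; push_cast; exact f2.le)
          rw [g2.2, le_div_iff₀ hn'] at l2
          push_cast at l2; exact l2
        · have : (n : ℝ) ≤ ⌊N e * n⌋₊ + 1 := by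
            have : n ≤ ⌊N e * n⌋₊ + 1 := by omega
            exact_mod_cast this
          have := hM.1.le_one e
          nlinarith
      rw [abs_le]
      constructor
      · rw [neg_le, neg_sub, le_div_iff₀ hn']; nlinarith
      · rw [le_div_iff₀ hn']; nlinarith
    by_contra hne
    have hpos : 0 < |M e - N e| := abs_pos.2 (sub_ne_zero.2 hne)
    obtain ⟨n, hn⟩ := exists_nat_one_div_lt hpos
    have := bound (n + 1) (by omega)
    push_cast at this
    linarith
  funext x
  obtain ⟨y, hy⟩ := hr x
  have hi : (x * y) * (x * y) = x * y := by rw [← mul_assoc, ← hy]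
  have key : ∀ L : Q → ℝ, IsRankFunction L → L x = L (x * y) := fun L hL => by
    apply le_antisymm
    · conv_lhs => rw [hy]
      exact hL.1.mul_le_left _ _
    · exact hL.1.mul_le_left _ _
  rw [key M hM, key N hN, idem _ hi]

/-- glueing along an increasing chain of left ideals -/
lemma glue (hinj : Module.Injective Q Q) (L : ℕ → Submodule Q Q) (hL : Monotone L)
    (c : ℕ → Q) (hc : ∀ n m, n ≤ m → ∀ t ∈ L n, t * c m = t * c n) :
    ∃ x : Q, ∀ n, ∀ t ∈ L n, t * x = t * c n := by
  have uniq : ∀ n m t, t ∈ L n → t ∈ L m → t * c n = t * c m := by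
    intro n m t h1 h2
    rcases le_total n m with h | h
    · exact (hc n m h t h1).symm
    · exact hc m n h t h2
  let G : Submodule Q (Q × Q) :=
    { carrier := {p | ∃ n, p.1 ∈ L n ∧ p.2 = p.1 * c n}
      zero_mem' := ⟨0, by simp, by simp⟩
      add_mem' := by
        rintro a b ⟨n, h1, h2⟩ ⟨m, h3, h4⟩
        refine ⟨max n m, add_mem (hL (le_max_left _ _) h1) (hL (le_max_right _ _) h3), ?_⟩
        simp only [Prod.snd_add, Prod.fst_add, add_mul]
        rw [h2, h4, hc n _ (le_max_left n m) _ h1, hc m _ (le_max_right n m) _ h3]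
      smul_mem' := by
        rintro r a ⟨n, h1, h2⟩
        refine ⟨n, Submodule.smul_mem _ _ h1, ?_⟩
        simp [h2, mul_assoc] }
  obtain ⟨h, hh⟩ := hinj.out ((LinearMap.fst Q Q Q).comp G.subtype) (by
    rw [← LinearMap.ker_eq_bot, LinearMap.ker_eq_bot']
    rintro ⟨p, n, hp1, hp2⟩ h0
    simp at h0
    have : p.2 = 0 := by rw [hp2, h0, zero_mul]
    ext <;> simp [h0, this]) ((LinearMap.snd Q Q Q).comp G.subtype)
  refine ⟨h 1, fun n t ht => ?_⟩
  have := hh ⟨(t, t * c n), n, ht, rfl⟩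
  simp at this
  rw [← this, ← smul_eq_mul t, ← map_smul, smul_eq_mul, mul_one]

end P2

section LP
variable {Q : Type*} [Ring Q] [StarRing Q] {N : Q → ℝ}

lemma lp_exists (hr : VNRegular Q) (hp : ProperStar Q) (x : Q) : ∃ e, IsLeftProjOf x e := by
  obtain ⟨t, ht⟩ := hr (star x * x)
  have hx : x * t * star x * x = x := by
    have h0 : x - x * t * star x * x = 0 := by
      apply hp
      have : star x * (x - x * t * star x * x) = 0 := by
        rw [mul_sub, sub_eq_zero]
        conv_lhs => rw [ht]
        simp only [mul_assoc]
      rw [star_sub, sub_mul, this]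
      have h2 : star (x * t * star x * x) * (x - x * t * star x * x)
          = star (x * t) * 0 + 0 := by
        rw [star_mul, star_mul, star_star, ]
        have : star x * (x * star (x * t)) * (x - x * t * star x * x) =
          star x * x * (star t * (star x * (x - x * t * star x * x))) := by
            rw [star_mul]; simp only [mul_assoc]
        rw [this, ‹star x * (x - x * t * star x * x) = 0›]; simp
      rw [h2]; simp
    exact (sub_eq_zero.1 h0).symm
  have h1 : (x * t * star x) * star (x * t * star x) = star (x * t * star x) := by
    have : star (x * t * star x) = x * (star t * star x) := by simp [star_mul, mul_assoc]
    rw [this, ← mul_assoc, hx]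
  have h2 : star (x * t * star x) = x * t * star x := by
    have := congrArg star h1
    rw [star_mul, star_star, h1] at this
    exact this
  refine ⟨x * t * star x, ⟨h2, ?_⟩, hx, t * star x, by rw [mul_assoc]⟩
  rw [h2] at h1; exact h1

lemma rp_exists (hr : VNRegular Q) (hp : ProperStar Q) (x : Q) : ∃ e, IsRightProjOf x e := by
  obtain ⟨e, he, h1, y, h2⟩ := lp_exists hr hp (star x)
  refine ⟨e, he, ?_, star y, ?_⟩
  · have := congrArg star h1
    simpa [star_mul, he.1] using this
  · have := congrArg star h2
    simpa [star_mul, he.1] using this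

lemma lp_rank (h : IsPseudoRankFunction N) {x e : Q} (he : IsLeftProjOf x e) : N e = N x := by
  obtain ⟨_, h1, y, h2⟩ := he
  apply le_antisymm
  · rw [h2]; exact h.mul_le_left _ _
  · rw [← h1]; exact h.mul_le_left _ _

lemma rp_rank (h : IsPseudoRankFunction N) {x e : Q} (he : IsRightProjOf x e) : N e = N x := by
  obtain ⟨_, h1, y, h2⟩ := he
  apply le_antisymm
  · rw [h2]; exact h.mul_le_right _ _
  · rw [← h1]; exact h.mul_le_right _ _

lemma lp_star {x e : Q} (he : IsLeftProjOf x e) : IsRightProjOf (star x) e := by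
  obtain ⟨he, h1, y, h2⟩ := he
  refine ⟨he, ?_, star y, ?_⟩
  · have := congrArg star h1
    simpa [star_mul, he.1] using this
  · have := congrArg star h2
    simpa [star_mul, he.1] using this

lemma rank_star (h : IsPseudoRankFunction N) (hr : VNRegular Q) (hp : ProperStar Q) (x : Q) :
    N (star x) = N x := by
  obtain ⟨e, he⟩ := lp_exists hr hp x
  rw [← lp_rank h he, rp_rank h (lp_star he)]

end LP

section complete
variable {Q : Type*} [Ring Q] [StarRing Q] {N : Q → ℝ}

lemma fast_limit (hN : IsRankFunction N) (hr : VNRegular Q) (hp : ProperStar Q)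
    (hinj : Module.Injective Q Q)
    (hfull : ∀ t : ℝ, 0 ≤ t → t ≤ 1 → ∃ x, N x = t)
    (hsub : ∀ e f : Q, e * e = e → f * f = f → N e ≤ N f → SubEq e f)
    (d : ℕ → Q) (η : ℝ) (hη : 0 ≤ η) (hη1 : 2 * η ≤ 1)
    (hd : ∀ k, N (d k) ≤ η * (1 / 2) ^ k) (z : Q)
    (hz : ∀ t : Q, (∀ k, t * d k = 0) → t * z = 0) : N z ≤ 2 * η := by
  choose lp hlp using lp_exists hr hp
  let R : ℕ → Q := fun m => Nat.rec 0 (fun m R => R + lp ((1 - R) * d m)) m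
  let g : ℕ → Q := fun m => lp ((1 - R m) * d m)
  have hR0 : R 0 = 0 := rfl
  have hRs : ∀ m, R (m + 1) = R m + g m := fun m => rfl
  have hgid : ∀ m, g m * g m = g m := fun m => (hlp _).1.2
  have hgst : ∀ m, star (g m) = g m := fun m => (hlp _).1.1
  have hgd : ∀ m, g m * ((1 - R m) * d m) = (1 - R m) * d m := fun m => (hlp _).2.1
  have hgy : ∀ m, ∃ y, g m = (1 - R m) * d m * y := fun m => (hlp _).2.2
  clear_value g R
  have hRproj : ∀ m, star (R m) = R m ∧ R m * R m = R m ∧ R m * g m = 0 ∧ g m * R m = 0 := by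
    have aux : ∀ m, star (R m) = R m → R m * R m = R m → R m * g m = 0 ∧ g m * R m = 0 := by
      intro m h1 h2
      have : R m * g m = 0 := by
        obtain ⟨y, hy⟩ := hgy m
        rw [hy, mul_assoc, ← mul_assoc, mul_sub, mul_one, h2, sub_self, zero_mul]
      refine ⟨this, ?_⟩
      have := congrArg star this
      simpa [star_mul, h1, hgst] using this
    intro m
    induction m with
    | zero => exact ⟨by simp [hR0], by simp [hR0], by simp [hR0], by simp [hR0]⟩
    | succ m ih =>
      obtain ⟨h1, h2, h3, h4⟩ := ih
      have a1 : star (R (m + 1)) = R (m + 1) := by rw [hRs, star_add, h1, hgst]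
      have a2 : R (m + 1) * R (m + 1) = R (m + 1) := by
        rw [hRs]; simp [add_mul, mul_add, h2, h3, h4, hgid]
      exact ⟨a1, a2, aux _ a1 a2⟩
  have hRg : ∀ m k, m ≤ k → R m * g k = 0 ∧ g k * R m = 0 ∧ R k * R m = R m ∧ R m * R k = R m := by
    intro m k hmk
    have hle : R k * R m = R m ∧ R m * R k = R m := by
      induction k, hmk using Nat.le_induction with
      | base => exact ⟨(hRproj m).2.1, (hRproj m).2.1⟩
      | succ k hk ih =>
        obtain ⟨_, _, h3, h4⟩ := hRproj k
        constructor
        · rw [hRs, add_mul, ih.1, ← ih.1, ← mul_assoc, h4, zero_mul, add_zero]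
        · rw [hRs, mul_add, ih.2, ← ih.2, mul_assoc, h3, mul_zero, add_zero]
    refine ⟨?_, ?_, hle⟩
    · rw [← hle.2, mul_assoc, (hRproj k).2.2.1, mul_zero]
    · rw [← hle.1, ← mul_assoc, (hRproj k).2.2.2, zero_mul]
  have hRd : ∀ m, R (m + 1) * d m = d m := by
    intro m
    have h1 : g m * d m = d m - R m * d m := by
      have := hgd m
      rw [sub_mul, one_mul, mul_sub, ← mul_assoc, (hRproj m).2.2.2, zero_mul, sub_zero] at this
      exact this
    rw [hRs, add_mul, h1]; abel
  have hNg : ∀ m, N (g m) ≤ η * (1 / 2) ^ m := fun m => by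
    obtain ⟨y, hy⟩ := hgy m
    rw [hy, mul_assoc]
    exact (hN.1.mul_le_right _ _).trans ((hN.1.mul_le_left _ _).trans (hd m))
  obtain ⟨h, hh, hNh⟩ := idem_of_rank hN hr hfull (2 * η) (by linarith) hη1
  have step : ∀ j r, r * r = r → N (g j) ≤ N r → SubEq (g j) r := fun j r h1 h2 =>
    hsub _ _ (hgid j) h1 h2
  choose! X Y a1 a2 a3 a4 a5 using step
  let r : ℕ → Q := fun m => Nat.rec h (fun j r => r - Y j r * X j r) m
  have hr0 : r 0 = h := rfl
  let x : ℕ → Q := fun j => X j (r j)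
  let y : ℕ → Q := fun j => Y j (r j)
  let k : ℕ → Q := fun j => y j * x j
  have hrs : ∀ j, r (j + 1) = r j - k j := fun j => rfl
  have hpow : ∀ j, 0 ≤ η * (1 / 2) ^ j := fun j => by positivity
  have inv : ∀ j, r j * r j = r j ∧ 2 * η * (1 / 2) ^ j ≤ N (r j) := by
    intro j
    induction j with
    | zero => exact ⟨hh, by rw [hr0, hNh]; simp⟩
    | succ j ih =>
      obtain ⟨h1, h2⟩ := ih
      have hle : N (g j) ≤ N (r j) := (hNg j).trans (by linarith [hpow j])
      have b1 := a1 j _ h1 hle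
      have b2 := a2 j _ h1 hle
      have b3 := a3 j _ h1 hle
      have b4 := a4 j _ h1 hle
      have b5 := a5 j _ h1 hle
      have c1 : k j * k j = k j := by
        show Y j (r j) * X j (r j) * (Y j (r j) * X j (r j)) = Y j (r j) * X j (r j)
        rw [mul_assoc, ← mul_assoc (X j (r j)), b5, b1]
      have c2 : r j * k j = k j := by
        show r j * (Y j (r j) * X j (r j)) = Y j (r j) * X j (r j)
        rw [← mul_assoc, b3]
      have c3 : k j * r j = k j := by
        show Y j (r j) * X j (r j) * r j = Y j (r j) * X j (r j)
        rw [mul_assoc, b2]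
      have c4 : N (k j) ≤ N (g j) := by
        have : k j = Y j (r j) * g j * X j (r j) := by
          rw [b4]
        rw [this]; exact prf_mul_mul_le hN.1 _ _ _
      refine ⟨?_, ?_⟩
      · rw [hrs]; simp [sub_mul, mul_sub, h1, c1, c2, c3]
      · rw [hrs, prf_sub_of_le hN.1 h1 c1 c2 c3]
        have := hNg j
        rw [pow_succ]
        linarith
  have hle : ∀ j, N (g j) ≤ N (r j) := fun j => (hNg j).trans (by
    have := (inv j).2; linarith [hpow j])
  have gx : ∀ j, g j * x j = x j := fun j => a1 j _ (inv j).1 (hle j)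
  have xr : ∀ j, x j * r j = x j := fun j => a2 j _ (inv j).1 (hle j)
  have ry : ∀ j, r j * y j = y j := fun j => a3 j _ (inv j).1 (hle j)
  have yg : ∀ j, y j * g j = y j := fun j => a4 j _ (inv j).1 (hle j)
  have xy : ∀ j, x j * y j = g j := fun j => a5 j _ (inv j).1 (hle j)
  have hk : ∀ j, k j = y j * x j := fun j => rfl
  clear_value k y x r
  have kk : ∀ j, k j * k j = k j := fun j => by
    rw [hk]
    show y j * x j * (y j * x j) = y j * x j
    rw [mul_assoc, ← mul_assoc (x j), xy, gx]
  have rk : ∀ j, r j * k j = k j := fun j => by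
    rw [hk]
    rw [← mul_assoc, ry]
  have kr : ∀ j, k j * r j = k j := fun j => by
    rw [hk]
    rw [mul_assoc, xr]
  have rle : ∀ i j, i ≤ j → r i * r j = r j ∧ r j * r i = r j := by
    intro i j hij
    induction j, hij using Nat.le_induction with
    | base => exact ⟨(inv i).1, (inv i).1⟩
    | succ j hj ih =>
      rw [hrs]
      constructor
      · rw [mul_sub, ih.1, ← rk j, ← mul_assoc, ih.1]
      · rw [sub_mul, ih.2, ← kr j, mul_assoc, ih.2]
  have korth : ∀ i j, i ≠ j → k i * k j = 0 := by
    have e1 : ∀ j, k j * r (j + 1) = 0 := fun j => by rw [hrs, mul_sub, kr, kk, sub_self]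
    have e2 : ∀ j, r (j + 1) * k j = 0 := fun j => by rw [hrs, sub_mul, rk, kk, sub_self]
    intro i j hij
    rcases lt_or_gt_of_ne hij with h | h
    · rw [← rk j, ← (rle (i + 1) j h).1, ← mul_assoc, ← mul_assoc, e1, zero_mul, zero_mul]
    · rw [← kr i, ← (rle (j + 1) i h).2, mul_assoc, mul_assoc, e2, mul_zero, mul_zero]
  have xk : ∀ j, x j * k j = x j := fun j => by
    rw [hk]
    rw [← mul_assoc, xy, gx]
  have ky : ∀ j, k j * y j = y j := fun j => by
    rw [hk]
    rw [mul_assoc, xy, yg]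
  have xyo : ∀ i j, i ≠ j → x i * y j = 0 := fun i j hij => by
    rw [← xk i, ← ky j, mul_assoc, ← mul_assoc (k i), korth i j hij, zero_mul, mul_zero]
  have xh : ∀ j, x j * h = x j := fun j => by
    rw [← xr j, mul_assoc, ← hr0, (rle 0 j (Nat.zero_le _)).2]
  -- glue X
  obtain ⟨XX, hXX⟩ := glue hinj (fun m => Submodule.span Q {R m}) (by
      apply monotone_nat_of_le_succ
      intro m
      rw [Submodule.span_singleton_le_iff_mem, Submodule.mem_span_singleton]
      exact ⟨R m, (hRg m (m + 1) (Nat.le_succ m)).2.2.2⟩)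
    (fun m => ∑ j ∈ Finset.range m, x j) (by
      intro n m hnm t ht
      rw [Submodule.mem_span_singleton] at ht
      obtain ⟨s, rfl⟩ := ht
      rw [← Finset.sum_range_add_sum_Ico _ hnm, mul_add, add_eq_left, Finset.mul_sum]
      refine Finset.sum_eq_zero fun j hj => ?_
      rw [smul_eq_mul, mul_assoc, ← gx j, ← mul_assoc (R n), (hRg n j (Finset.mem_Ico.1 hj).1).1,
        zero_mul, mul_zero])
  -- glue Y
  let H : ℕ → Q := fun m => ∑ j ∈ Finset.range m, k j
  have HH : ∀ m, H m * H (m + 1) = H m := by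
    intro m
    show (∑ i ∈ Finset.range m, k i) * (∑ j ∈ Finset.range (m + 1), k j) = _
    rw [Finset.sum_mul]
    refine Finset.sum_congr rfl fun i hi => ?_
    rw [Finset.mul_sum, Finset.sum_eq_single i]
    · exact kk i
    · intro j _ hji; exact korth i j (Ne.symm hji)
    · intro h; exact absurd (Finset.mem_range.2 ((Finset.mem_range.1 hi).trans (Nat.lt_succ_self m))) h
  obtain ⟨YY, hYY⟩ := glue hinj (fun m => Submodule.span Q {H m}) (by
      apply monotone_nat_of_le_succ
      intro m
      rw [Submodule.span_singleton_le_iff_mem, Submodule.mem_span_singleton]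
      exact ⟨H m, HH m⟩)
    (fun m => ∑ j ∈ Finset.range m, y j) (by
      intro n m hnm t ht
      rw [Submodule.mem_span_singleton] at ht
      obtain ⟨s, rfl⟩ := ht
      rw [← Finset.sum_range_add_sum_Ico _ hnm, mul_add, add_eq_left, Finset.mul_sum]
      refine Finset.sum_eq_zero fun j hj => ?_
      rw [smul_eq_mul, mul_assoc]
      have : H n * y j = 0 := by
        show (∑ i ∈ Finset.range n, k i) * y j = 0
        rw [Finset.sum_mul]
        refine Finset.sum_eq_zero fun i hi => ?_
        have := Finset.mem_range.1 hi
        have := (Finset.mem_Ico.1 hj).1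
        rw [← ky j, ← mul_assoc, korth i j (by omega), zero_mul]
      rw [this, mul_zero])
  have key : ∀ m, R m * (XX * h * YY) = R m := by
    intro m
    have e1 : R m * XX = ∑ j ∈ Finset.range m, x j := by
      rw [hXX m (R m) (Submodule.mem_span_singleton_self _), Finset.mul_sum]
      refine Finset.sum_congr rfl fun j hj => ?_
      have : R m * g j = g j := by
        have h2 := (hRg (j + 1) m (Finset.mem_range.1 hj)).2.2.1
        have h3 : R (j + 1) * g j = g j := by
          rw [hRs, add_mul, (hRproj j).2.2.1, hgid, zero_add]
        rw [← h3, ← mul_assoc, h2]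
      rw [← gx j, ← mul_assoc, this]
    have e2 : (∑ j ∈ Finset.range m, x j) * h = ∑ j ∈ Finset.range m, x j := by
      rw [Finset.sum_mul]; exact Finset.sum_congr rfl fun j _ => xh j
    have e3 : (∑ j ∈ Finset.range m, x j) * H m = ∑ j ∈ Finset.range m, x j := by
      rw [Finset.sum_mul]
      refine Finset.sum_congr rfl fun i hi => ?_
      show x i * (∑ j ∈ Finset.range m, k j) = x i
      rw [Finset.mul_sum, Finset.sum_eq_single i]
      · exact xk i
      · intro j _ hji
        rw [← xk i, mul_assoc, korth i j (Ne.symm hji), mul_zero]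
      · intro h; exact absurd hi h
    have e4 : (∑ j ∈ Finset.range m, x j) * (∑ j ∈ Finset.range m, y j) =
        ∑ j ∈ Finset.range m, g j := by
      rw [Finset.sum_mul]
      refine Finset.sum_congr rfl fun i hi => ?_
      rw [Finset.mul_sum, Finset.sum_eq_single i]
      · exact xy i
      · intro j _ hji; exact xyo i j (Ne.symm hji)
      · intro h; exact absurd hi h
    have e5 : ∑ j ∈ Finset.range m, g j = R m := by
      induction m with
      | zero => simp [hR0]
      | succ m ih =>
        rw [Finset.sum_range_succ, hRs]
        congr 1
        clear ih e1 e2 e3 e4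
        induction m with
        | zero => simp [hR0]
        | succ m ih => rw [Finset.sum_range_succ, hRs, ih]
    calc R m * (XX * h * YY) = (R m * XX) * h * YY := by simp only [mul_assoc]
      _ = (∑ j ∈ Finset.range m, x j) * H m * YY := by rw [e1, e2, e3]
      _ = (∑ j ∈ Finset.range m, x j) * (H m * YY) := by rw [mul_assoc]
      _ = (∑ j ∈ Finset.range m, x j) * (H m * ∑ j ∈ Finset.range m, y j) := by
          rw [hYY m (H m) (Submodule.mem_span_singleton_self _)]
      _ = R m := by rw [← mul_assoc, e3, e4, e5]
  have hzz : star (1 - XX * h * YY) * z = 0 := by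
    apply hz
    intro j
    have : star (d j) * (1 - XX * h * YY) = 0 := by
      rw [← hRd j, star_mul, (hRproj (j + 1)).1, mul_assoc, mul_sub, key, mul_one, sub_self, mul_zero]
    have := congrArg star this
    simpa [star_mul] using this
  rw [star_sub, star_one, sub_mul, one_mul, sub_eq_zero] at hzz
  rw [hzz]
  calc N (star (XX * h * YY) * z) ≤ N (star (XX * h * YY)) := hN.1.mul_le_left _ _
    _ = N (XX * h * YY) := rank_star hN.1 hr hp _
    _ ≤ N h := prf_mul_mul_le hN.1 _ _ _
    _ = 2 * η := hNh

lemma rank_complete (hN : IsRankFunction N) (hr : VNRegular Q) (hp : ProperStar Q)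
    (hinj : Module.Injective Q Q)
    (hfull : ∀ t : ℝ, 0 ≤ t → t ≤ 1 → ∃ x, N x = t)
    (hsub : ∀ e f : Q, e * e = e → f * f = f → N e ≤ N f → SubEq e f) : RankComplete N := by
  intro u hu
  have hu' : ∀ k : ℕ, ∃ n₀ : ℕ, ∀ m n : ℕ, n₀ ≤ m → n₀ ≤ n → N (u m - u n) < (1 / 2) ^ k :=
    fun k => hu _ (by positivity)
  choose n₀ hn₀ using hu'
  let s : ℕ → ℕ := fun k => Nat.rec (n₀ 0) (fun k s => max s (n₀ (k + 1))) k
  have hs : ∀ k, n₀ k ≤ s k := by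
    intro k; cases k with
    | zero => exact le_rfl
    | succ k => exact le_max_right _ _
  have hsm : ∀ k, s k ≤ s (k + 1) := fun k => le_max_left _ _
  let x : ℕ → Q := fun k => u (s k)
  have hx : ∀ k, N (x (k + 1) - x k) ≤ (1 / 2) ^ k := fun k =>
    (hn₀ k _ _ ((hs k).trans (hsm k)) (hs k)).le
  let L : ℕ → Submodule Q Q := fun n =>
    { carrier := {t | ∀ k, n ≤ k → t * (x (k + 1) - x k) = 0}
      zero_mem' := fun k _ => by simp
      add_mem' := fun {a b} ha hb k hk => by rw [add_mul, ha k hk, hb k hk, add_zero]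
      smul_mem' := fun c a ha k hk => by rw [smul_eq_mul, mul_assoc, ha k hk, mul_zero] }
  have hLm : ∀ n t, t ∈ L n ↔ ∀ k, n ≤ k → t * (x (k + 1) - x k) = 0 := fun n t => Iff.rfl
  obtain ⟨z, hz⟩ := glue hinj L (by
    intro n m hnm t ht k hk
    exact ht k (hnm.trans hk)) x (by
    intro n m hnm t ht
    rw [hLm] at ht
    induction m, hnm using Nat.le_induction with
    | base => rfl
    | succ m hm ih =>
      have := ht m hm
      rw [mul_sub, sub_eq_zero] at this
      rw [this, ih])
  have bound : ∀ n, 1 ≤ n → N (z - x n) ≤ 2 * (1 / 2) ^ n := by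
    intro n hn
    apply fast_limit hN hr hp hinj hfull hsub (fun k => x (n + k + 1) - x (n + k)) ((1 / 2) ^ n)
      (by positivity)
    · have : (1 / 2 : ℝ) ^ n ≤ (1 / 2) ^ 1 := pow_le_pow_of_le_one (by norm_num) (by norm_num) hn
      linarith
    · intro k; rw [← pow_add]; exact hx _
    · intro t ht
      rw [mul_sub, hz n t ?_, sub_self]
      rw [hLm]
      intro k hk
      obtain ⟨j, rfl⟩ := Nat.exists_eq_add_of_le hk
      exact ht j
  refine ⟨z, fun ε hε => ?_⟩
  obtain ⟨n, hn⟩ := exists_pow_lt_of_lt_one (show 0 < ε / 3 by linarith) (show (1 / 2 : ℝ) < 1 by norm_num)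
  have hn1 : (1 / 2 : ℝ) ^ (n + 1) ≤ (1 / 2) ^ n :=
    pow_le_pow_of_le_one (by norm_num) (by norm_num) (Nat.le_succ n)
  refine ⟨s (n + 1), fun m hm => ?_⟩
  have h1 := hn₀ (n + 1) m (s (n + 1)) ((hs _).trans hm) (hs _)
  have h2 := bound (n + 1) (by omega)
  have h3 := prf_tri hN.1 (u m) (x (n + 1)) z
  rw [prf_sub_comm hN.1 (x (n + 1))] at h3
  have h4 : N (u m - x (n + 1)) < (1 / 2) ^ (n + 1) := h1
  linarith

end complete

/-- the bundle of facts on `Q` that we use -/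
structure Good (Q : Type*) [Ring Q] [StarRing Q] (N : Q → ℝ) : Prop where
  rk : IsRankFunction N
  reg : VNRegular Q
  proper : ProperStar Q
  simple : IsSimpleRing Q
  star_inv : ∀ x, N (star x) = N x
  complete : RankComplete N
  full : ∀ t : ℝ, 0 ≤ t → t ≤ 1 → ∃ x, N x = t
  sub : ∀ e f : Q, e * e = e → f * f = f → N e ≤ N f → SubEq e f

lemma good_of {Q : Type*} [Ring Q] [StarRing Q] {N : Q → ℝ} (hQ : IsContinuousFactor Q)
    (hp : ProperStar Q) (hN : IsRankFunction N) : Good Q N := by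
  obtain ⟨hs, hr, hinj, -, M, hM, hMr⟩ := hQ
  have hc := comparability hs hr hinj
  have hfull : ∀ t : ℝ, 0 ≤ t → t ≤ 1 → ∃ x, M x = t := fun t h0 h1 => by
    have : t ∈ Set.range M := by rw [hMr]; exact ⟨h0, h1⟩
    exact this
  have hsub := subEq_of_le hM hc
  have : N = M := rank_unique hM hN hr hfull hsub
  subst this
  exact ⟨hN, hr, hp, hs, rank_star hN.1 hr hp, rank_complete hN hr hp hinj hfull hsub, hfull, hsub⟩

section P3
variable {Q : Type*} [Ring Q] [StarRing Q] {N : Q → ℝ}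

lemma lp_close (hG : Good Q N) {z y e e' : Q} (h : IsLeftProjOf z e) (h' : IsLeftProjOf y e') :
    N (e - e') ≤ 2 * N (z - y) := by
  have key : ∀ {z y e e' : Q}, IsLeftProjOf z e → IsLeftProjOf y e' →
      N ((1 - e') * e) ≤ N (z - y) := by
    intro z y e e' h h'
    obtain ⟨he, h1, t, h2⟩ := h
    obtain ⟨he', h1', t', h2'⟩ := h'
    have : (1 - e') * e = (1 - e') * (z - y) * t := by
      rw [mul_sub (1 - e') z y, sub_mul 1 e' y, h1', one_mul, sub_self, sub_zero, mul_assoc, ← h2]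
    rw [this]; exact prf_mul_mul_le hG.rk.1 _ _ _
  have h3 := key h h'
  have h4 := key h' h
  have h5 : N (e' * (1 - e)) = N ((1 - e) * e') := by
    rw [← hG.star_inv (e' * (1 - e))]
    simp [star_mul, h.1.1, h'.1.1]
  have h6 : e - e' = (1 - e') * e - e' * (1 - e) := by noncomm_ring
  rw [h6]
  have := prf_sub_le hG.rk.1 ((1 - e') * e) (e' * (1 - e))
  rw [prf_sub_comm hG.rk.1 y z] at h4
  linarith

lemma rp_to_lp {x e : Q} (he : IsRightProjOf x e) : IsLeftProjOf (star x) e := by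
  obtain ⟨he, h1, y, h2⟩ := he
  refine ⟨he, ?_, star y, ?_⟩
  · have := congrArg star h1
    simpa [star_mul, he.1] using this
  · have := congrArg star h2
    simpa [star_mul, he.1] using this

lemma rp_close (hG : Good Q N) {z y e e' : Q} (h : IsRightProjOf z e) (h' : IsRightProjOf y e') :
    N (e - e') ≤ 2 * N (z - y) := by
  have := lp_close hG (rp_to_lp h) (rp_to_lp h')
  rwa [← star_sub, hG.star_inv] at this

lemma proj_sub {p q : Q} (hp : IsProjection p) (hq : IsProjection q) (h : ProjLE q p) :
    IsProjection (p - q) ∧ ProjLE (p - q) p ∧ q * (p - q) = 0 ∧ (p - q) * q = 0 := by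
  refine ⟨⟨by rw [star_sub, hp.1, hq.1], ?_⟩, ⟨?_, ?_⟩, ?_, ?_⟩ <;>
    simp [sub_mul, mul_sub, hp.2, hq.2, h.1, h.2]

lemma projLE_of_left {p q : Q} (hp : IsProjection p) (hq : IsProjection q) (h : p * q = q) :
    ProjLE q p := by
  refine ⟨h, ?_⟩
  have := congrArg star h
  simpa [star_mul, hp.1, hq.1] using this

lemma projLE_of_right {p q : Q} (hp : IsProjection p) (hq : IsProjection q) (h : q * p = q) :
    ProjLE q p := by
  refine ⟨?_, h⟩
  have := congrArg star h
  simpa [star_mul, hp.1, hq.1] using this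

lemma projLE_trans {p q r : Q} (h : ProjLE p q) (h' : ProjLE q r) : ProjLE p r :=
  ⟨by rw [← h.1, ← mul_assoc, h'.1], by rw [← h.2, mul_assoc, h'.2]⟩

lemma projLE_refl {p : Q} (hp : IsProjection p) : ProjLE p p := ⟨hp.2, hp.2⟩

lemma proj_add {p q : Q} (hp : IsProjection p) (hq : IsProjection q) (h : p * q = 0) :
    IsProjection (p + q) ∧ q * p = 0 := by
  have h' : q * p = 0 := by
    have := congrArg star h
    simpa [star_mul, hp.1, hq.1] using this
  exact ⟨⟨by rw [star_add, hp.1, hq.1], by simp [add_mul, mul_add, hp.2, hq.2, h, h']⟩, h'⟩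

lemma proj_rank_sub (hG : Good Q N) {p q : Q} (hp : IsProjection p) (hq : IsProjection q)
    (h : ProjLE q p) : N (p - q) = N p - N q :=
  prf_sub_of_le hG.rk.1 hp.2 hq.2 h.1 h.2

lemma proj_eq_of_rank (hG : Good Q N) {p q : Q} (hp : IsProjection p) (hq : IsProjection q)
    (h : ProjLE q p) (hr : N p ≤ N q) : p = q := by
  have h1 := proj_rank_sub hG hp hq h
  have h2 := hG.rk.1.nonneg (p - q)
  exact sub_eq_zero.1 (hG.rk.2 _ (by linarith))

lemma proj_rank_le (hG : Good Q N) {p q : Q} (h : ProjLE q p) : N q ≤ N p := by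
  rw [← h.1]; exact hG.rk.1.mul_le_left _ _

/-- simultaneous approximate annihilator -/
lemma annihil (hG : Good Q N) {ι : Type*} (s : Finset ι) (x : ι → Q) (h : Q) (hh : IsProjection h) :
    ∃ k, IsProjection k ∧ ProjLE k h ∧ (∀ l ∈ s, x l * k = 0) ∧
      N (h - k) ≤ ∑ l ∈ s, N (x l * h) := by
  classical
  induction s using Finset.induction_on with
  | empty => exact ⟨h, hh, projLE_refl hh, by simp, by simp [prf_zero hG.rk.1]⟩
  | insert a s ha ih =>
    obtain ⟨k, hk, hkh, hx, hNk⟩ := ih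
    obtain ⟨f, hf⟩ := rp_exists hG.reg hG.proper (x a * k)
    have hfr := rp_rank hG.rk.1 hf
    obtain ⟨hfp, h1, y, h2⟩ := hf
    have hfk : ProjLE f k := projLE_of_right hk hfp (by rw [h2, mul_assoc, mul_assoc, hk.2])
    obtain ⟨p1, p2, p3, p4⟩ := proj_sub hk hfp hfk
    refine ⟨k - f, p1, projLE_trans p2 hkh, ?_, ?_⟩
    · intro l hl
      rcases Finset.mem_insert.1 hl with rfl | hl
      · have : x l * f = x l * k := by rw [← h1, mul_assoc, hfk.1]
        rw [mul_sub, this, sub_self]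
      · rw [← p2.1, ← mul_assoc, hx l hl, zero_mul]
    · rw [Finset.sum_insert ha]
      have e1 : h - (k - f) = (h - k) + f := by abel
      have e2 : N f ≤ N (x a * h) := by
        rw [hfr, ← hkh.1, ← mul_assoc]; exact hG.rk.1.mul_le_left _ _
      rw [e1]
      have := hG.rk.1.subadditive (h - k) f
      linarith

/-- subprojections of prescribed rank -/
lemma subproj_of_rank (hG : Good Q N) {f : Q} (hf : IsProjection f) (t : ℝ) (h0 : 0 ≤ t)
    (h1 : t ≤ N f) : ∃ g, IsProjection g ∧ ProjLE g f ∧ N g = t := by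
  obtain ⟨e, he, h2, h3, h4⟩ := subidem_of_rank hG.rk hG.reg hG.full hG.sub f hf.2 t h0 h1
  obtain ⟨g, hg⟩ := lp_exists hG.reg hG.proper e
  refine ⟨g, hg.1, ?_, by rw [lp_rank hG.rk.1 hg, h4]⟩
  obtain ⟨y, hy⟩ := hg.2.2
  exact projLE_of_left hf hg.1 (by rw [hy, ← mul_assoc, h2])

lemma exists_half_sup (S : Set ℝ) (hne : S.Nonempty) (hb : ∀ a ∈ S, 0 ≤ a ∧ a ≤ 1) :
    ∃ a ∈ S, ∀ b ∈ S, b ≤ 2 * a := by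
  have hbdd : BddAbove S := ⟨1, fun a ha => (hb a ha).2⟩
  obtain ⟨a0, ha0⟩ := hne
  by_cases h : sSup S ≤ 0
  · refine ⟨a0, ha0, fun b hb' => ?_⟩
    have := le_csSup hbdd hb'
    have := (hb a0 ha0).1
    linarith
  · push Not at h
    obtain ⟨a, ha, hlt⟩ := exists_lt_of_lt_csSup ⟨a0, ha0⟩ (show sSup S / 2 < sSup S by linarith)
    refine ⟨a, ha, fun b hb' => ?_⟩
    have := le_csSup hbdd hb'
    linarith

lemma pi_proj {v : Q} (hv : v * star v * v = v) :
    IsProjection (v * star v) ∧ IsProjection (star v * v) := by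
  refine ⟨⟨by simp, ?_⟩, ⟨by simp, ?_⟩⟩
  · rw [← mul_assoc, hv]
  · rw [mul_assoc, ← mul_assoc v, hv]

lemma pi_of_proj (hp : ProperStar Q) {v : Q} (h : IsProjection (v * star v)) :
    v * star v * v = v := by
  have h0 : star (v * star v * v - v) = 0 := by
    apply hp
    rw [star_star, star_sub, star_mul, h.1]
    have e1 : (v * star v * v - v) * (star v * (v * star v) - star v) =
      (v * star v) * (v * star v) * (v * star v) - (v * star v) * (v * star v)
        - (v * star v) * (v * star v) + v * star v := by noncomm_ring
    rw [e1, h.2, h.2]; abel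
  have := star_eq_zero.1 h0
  exact sub_eq_zero.1 this

lemma pi_rank (hG : Good Q N) {v : Q} (hv : v * star v * v = v) :
    N (v * star v) = N v ∧ N (star v * v) = N v := by
  refine ⟨le_antisymm (hG.rk.1.mul_le_left _ _) ?_, le_antisymm (hG.rk.1.mul_le_right _ _) ?_⟩
  · conv_lhs => rw [← hv]
    exact hG.rk.1.mul_le_left _ _
  · conv_lhs => rw [← hv, mul_assoc]
    exact hG.rk.1.mul_le_right _ _

/-- comparison of projections by *-equivalence, given the one-step property -/
lemma star_cmp (hG : Good Q N)
    (h1 : ∀ p₁ p₂ : Q, IsProjection p₁ → IsProjection p₂ → p₁ ≠ 0 → p₂ ≠ 0 →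
      ∃ v, v ≠ 0 ∧ p₁ * v = v ∧ v * p₂ = v ∧ v * star v * v = v)
    (e f : Q) (he : IsProjection e) (hf : IsProjection f) (hle : N e ≤ N f) :
    ∃ w, w * star w = e ∧ w * f = w := by
  -- state
  let St : Q → Prop := fun w => e * w = w ∧ w * f = w ∧ w * star w * w = w
  let Ex : Q → Q → Prop := fun w v =>
    (e - w * star w) * v = v ∧ v * (f - star w * w) = v ∧ v * star v * v = v
  have orth : ∀ w v, St w → Ex w v → star w * v = 0 ∧ v * star w = 0 := by
    rintro w v ⟨a1, a2, a3⟩ ⟨b1, b2, b3⟩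
    have c1 : star w * e = star w := by
      have := congrArg star a1
      simpa [star_mul, he.1] using this
    have c2 : f * star w = star w := by
      have := congrArg star a2
      simpa [star_mul, hf.1] using this
    have c3 : star w * w * star w = star w := by
      have := congrArg star a3
      simpa [star_mul, mul_assoc] using this
    constructor
    · rw [← b1, ← mul_assoc, mul_sub, c1, ← mul_assoc, c3, sub_self, zero_mul]
    · rw [← b2, mul_assoc, sub_mul, c2, c3, sub_self, mul_zero]
  have stepSt : ∀ w v, St w → Ex w v → St (w + v) := by
    intro w v hw hv
    obtain ⟨o1, o2⟩ := orth w v hw hv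
    have o3 : star v * w = 0 := by
      have := congrArg star o1
      simpa [star_mul] using this
    have o4 : w * star v = 0 := by
      have := congrArg star o2
      simpa [star_mul] using this
    obtain ⟨a1, a2, a3⟩ := hw
    obtain ⟨b1, b2, b3⟩ := hv
    refine ⟨?_, ?_, ?_⟩
    · have : e * v = v := by
        rw [← b1, ← mul_assoc, mul_sub, he.2, ← mul_assoc, a1]
      rw [mul_add, a1, this]
    · have : v * f = v := by
        rw [← b2, mul_assoc, sub_mul, hf.2, mul_assoc (star w), a2]
      rw [add_mul, a2, this]
    · have e1 : (w + v) * star (w + v) = w * star w + v * star v := by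
        rw [star_add, add_mul, mul_add, mul_add, o2, o4]; abel
      rw [e1, add_mul, mul_add, mul_add, a3, b3, mul_assoc w, o1, mul_assoc v, o3]; simp
  have ex : ∀ w, St w → ∃ v, Ex w v ∧ ∀ v', Ex w v' → N v' ≤ 2 * N v := by
    intro w _
    obtain ⟨a, ⟨v, hv, rfl⟩, hb⟩ := exists_half_sup (N '' {v | Ex w v})
      ⟨N 0, 0, by simp [Ex], rfl⟩ (by
        rintro _ ⟨v, _, rfl⟩; exact ⟨hG.rk.1.nonneg _, hG.rk.1.le_one _⟩)
    exact ⟨v, hv, fun v' hv' => hb _ ⟨v', hv', rfl⟩⟩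
  choose! V hV hVmax using ex
  let w : ℕ → Q := fun n => Nat.rec 0 (fun _ w => w + V w) n
  have hw0 : w 0 = 0 := rfl
  have hws : ∀ n, w (n + 1) = w n + V (w n) := fun n => rfl
  clear_value w
  have hSt : ∀ n, St (w n) := by
    intro n
    induction n with
    | zero => rw [hw0]; simp [St]
    | succ n ih => rw [hws]; exact stepSt _ _ ih (hV _ ih)
  -- extension relations
  have hext : ∀ n m, n ≤ m → w m * star (w n) = w n * star (w n) ∧
      star (w n) * w m = star (w n) * w n := by
    have one : ∀ n m, n ≤ m → V (w m) * star (w n) = 0 ∧ star (w n) * V (w m) = 0 := by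
      intro n m hnm
      obtain ⟨o1, o2⟩ := orth _ _ (hSt m) (hV _ (hSt m))
      -- w n = w m * (star (w n) * w n) needs induction
      induction n using Nat.strong_induction_on with
      | _ n ih =>
        have hn : ∀ j, j ≤ m → star (w j) * V (w m) = 0 ∧ V (w m) * star (w j) = 0 := by
          have h2 : ∀ d j, j + d = m → star (w j) * V (w m) = 0 ∧ V (w m) * star (w j) = 0 := by
            intro d
            have h3 : ∀ d j, j + d = m → star (w j) * w m = star (w j) * w j ∧
                w m * star (w j) = w j * star (w j) := by
              intro d j hj
              have h4 : ∀ k, (∀ i, j ≤ i → i < j + k → star (w j) * V (w i) = 0 ∧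
                  V (w i) * star (w j) = 0) → star (w j) * w (j + k) = star (w j) * w j ∧
                w (j + k) * star (w j) = w j * star (w j) := by
                intro k hk
                induction k with
                | zero => simp
                | succ k ihk =>
                  obtain ⟨q1, q2⟩ := ihk (fun i hi hi' => hk i hi (by omega))
                  obtain ⟨q3, q4⟩ := hk (j + k) (by omega) (by omega)
                  rw [← add_assoc, hws, mul_add, add_mul, q1, q2, q3, q4]; simp
              have h5 : ∀ k i, i = j + k → star (w j) * V (w i) = 0 ∧ V (w i) * star (w j) = 0 := by
                intro k
                induction k using Nat.strong_induction_on with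
                | _ k ihk =>
                  rintro i rfl
                  obtain ⟨q1, q2⟩ := h4 k (fun i hi hi' => ihk (i - j) (by omega) i (by omega))
                  obtain ⟨r1, r2⟩ := orth _ _ (hSt (j + k)) (hV _ (hSt (j + k)))
                  have c3 : star (w j) * w j * star (w j) = star (w j) := by
                    have := congrArg star (hSt j).2.2
                    simpa [star_mul, mul_assoc] using this
                  have q1' : star (w (j + k)) * w j = star (w j) * w j := by
                    have := congrArg star q1
                    simpa [star_mul] using this
                  have q2' : w j * star (w (j + k)) = w j * star (w j) := by
                    have := congrArg star q2
                    simpa [star_mul] using this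
                  constructor
                  · rw [← c3, mul_assoc (star (w j)), ← q2', mul_assoc, mul_assoc, r1]; simp
                  · rw [← c3, ← q1', ← mul_assoc, ← mul_assoc, r2]; simp
              have := h4 d (fun i hi _ => h5 (i - j) i (by omega))
              rwa [hj] at this
            intro j hj
            obtain ⟨q1, q2⟩ := h3 d j hj
            have c3 : star (w j) * w j * star (w j) = star (w j) := by
              have := congrArg star (hSt j).2.2
              simpa [star_mul, mul_assoc] using this
            have q1' : star (w m) * w j = star (w j) * w j := by
              have := congrArg star q1
              simpa [star_mul] using this
            have q2' : w j * star (w m) = w j * star (w j) := by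
              have := congrArg star q2
              simpa [star_mul] using this
            constructor
            · rw [← c3, mul_assoc (star (w j)), ← q2', mul_assoc, mul_assoc, o1]; simp
            · rw [← c3, ← q1', ← mul_assoc, ← mul_assoc, o2]; simp
          intro j hj
          exact h2 (m - j) j (by omega)
        exact ⟨(hn n hnm).2, (hn n hnm).1⟩
    intro n m hnm
    induction m, hnm using Nat.le_induction with
    | base => exact ⟨rfl, rfl⟩
    | succ m hm ih =>
      obtain ⟨q1, q2⟩ := one n m hm
      rw [hws, add_mul, mul_add, ih.1, ih.2, q1, q2]; simp
  -- ranks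
  have hrank : ∀ n m, n ≤ m → N (w m - w n) ≤ N (w m) - N (w n) := by
    intro n m hnm
    obtain ⟨q1, q2⟩ := hext n m hnm
    obtain ⟨pm, -⟩ := pi_proj (hSt m).2.2
    obtain ⟨pn, -⟩ := pi_proj (hSt n).2.2
    have hle' : ProjLE (w n * star (w n)) (w m * star (w m)) := by
      apply projLE_of_left pm pn
      have q2' : star (w m) * w n = star (w n) * w n := by
        have := congrArg star q2
        simpa [star_mul] using this
      rw [mul_assoc, ← mul_assoc (star (w m)), q2', ← mul_assoc, ← mul_assoc, q1, (hSt n).2.2]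
    have h2 := proj_rank_sub hG pm pn hle'
    rw [(pi_rank hG (hSt m).2.2).1, (pi_rank hG (hSt n).2.2).1] at h2
    rw [← h2]
    have : w m - w n = (w m * star (w m) - w n * star (w n)) * w m := by
      rw [sub_mul, (hSt m).2.2, mul_assoc (w n), q2, ← mul_assoc, (hSt n).2.2]
    rw [this]; exact hG.rk.1.mul_le_left _ _
  have hmono : Monotone (fun n => N (w n)) := by
    intro n m hnm
    have := hrank n m hnm
    have := hG.rk.1.nonneg (w m - w n)
    simp only
    linarith
  have hbd : BddAbove (Set.range fun n => N (w n)) := ⟨1, by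
    rintro _ ⟨n, rfl⟩; exact hG.rk.1.le_one _⟩
  have hconv := tendsto_atTop_ciSup hmono hbd
  have hcau : RankCauchy N w := by
    intro ε hε
    obtain ⟨n₀, hn₀⟩ := (Metric.cauchySeq_iff.1 hconv.cauchySeq) ε hε
    refine ⟨n₀, fun m n hm hn => ?_⟩
    have h2 := hn₀ m hm n hn
    rw [Real.dist_eq] at h2
    rcases le_total n m with h | h
    · exact (hrank n m h).trans_lt ((le_abs_self _).trans_lt h2)
    · rw [prf_sub_comm hG.rk.1]
      refine (hrank m n h).trans_lt ?_
      rw [abs_sub_comm] at h2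
      exact (le_abs_self _).trans_lt h2
  obtain ⟨W, hW⟩ := hG.complete w hcau
  have zero_of : ∀ x : Q, (∀ ε : ℝ, 0 < ε → N x < ε) → x = 0 := by
    intro x hx
    apply hG.rk.2
    by_contra h
    have := lt_of_le_of_ne (hG.rk.1.nonneg x) (Ne.symm h)
    exact lt_irrefl _ (hx _ this)
  have hWext : ∀ n, W * star (w n) = w n * star (w n) ∧ star (w n) * W = star (w n) * w n := by
    intro n
    constructor
    · rw [← sub_eq_zero]
      apply zero_of
      intro ε hε
      obtain ⟨m0, hm0⟩ := hW ε hε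
      have h2 := hm0 (max m0 n) (le_max_left _ _)
      have : W * star (w n) - w n * star (w n) = -((w (max m0 n) - W) * star (w n)) := by
        rw [← (hext n _ (le_max_right m0 n)).1]; noncomm_ring
      rw [this, prf_neg hG.rk.1]
      exact (hG.rk.1.mul_le_left _ _).trans_lt h2
    · rw [← sub_eq_zero]
      apply zero_of
      intro ε hε
      obtain ⟨m0, hm0⟩ := hW ε hε
      have h2 := hm0 (max m0 n) (le_max_left _ _)
      have : star (w n) * W - star (w n) * w n = -(star (w n) * (w (max m0 n) - W)) := by
        rw [← (hext n _ (le_max_right m0 n)).2]; noncomm_ring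
      rw [this, prf_neg hG.rk.1]
      exact (hG.rk.1.mul_le_right _ _).trans_lt h2
  have hWSt : St W := by
    refine ⟨?_, ?_, ?_⟩
    · rw [← sub_eq_zero]
      apply zero_of
      intro ε hε
      obtain ⟨m0, hm0⟩ := hW ε hε
      have : e * W - W = (1 - e) * (w m0 - W) := by
        rw [mul_sub, sub_mul 1 e (w m0), (hSt m0).1]; noncomm_ring
      rw [this]
      exact (hG.rk.1.mul_le_right _ _).trans_lt (hm0 m0 le_rfl)
    · rw [← sub_eq_zero]
      apply zero_of
      intro ε hε
      obtain ⟨m0, hm0⟩ := hW ε hε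
      have : W * f - W = (w m0 - W) * (1 - f) := by
        rw [sub_mul, mul_sub (w m0) 1 f, (hSt m0).2.1]; noncomm_ring
      rw [this]
      exact (hG.rk.1.mul_le_left _ _).trans_lt (hm0 m0 le_rfl)
    · rw [← sub_eq_zero]
      apply zero_of
      intro ε hε
      obtain ⟨m0, hm0⟩ := hW (ε / 2) (by linarith)
      have h2 := hm0 m0 le_rfl
      have : W * star W * W - W = (w m0 - W) - W * star (w m0 - W) * W := by
        rw [star_sub, mul_sub, sub_mul, (hWext m0).1, mul_assoc (w m0), (hWext m0).2, ← mul_assoc,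
          (hSt m0).2.2]; abel
      rw [this]
      have h3 := prf_sub_le hG.rk.1 (w m0 - W) (W * star (w m0 - W) * W)
      have h4 := prf_mul_mul_le hG.rk.1 W (star (w m0 - W)) W
      rw [hG.star_inv] at h4
      linarith
  obtain ⟨P1, P2⟩ := pi_proj hWSt.2.2
  have le1 : ProjLE (W * star W) e := projLE_of_left he P1 (by rw [← mul_assoc, hWSt.1])
  have le2 : ProjLE (star W * W) f := projLE_of_right hf P2 (by rw [mul_assoc, hWSt.2.1])
  refine ⟨W, ?_, hWSt.2.1⟩
  by_contra hne
  have hp1 : e - W * star W ≠ 0 := fun h => hne (sub_eq_zero.1 h).symm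
  have hp2 : f - star W * W ≠ 0 := by
    intro h
    apply hne
    symm
    apply proj_eq_of_rank hG he P1 le1
    rw [(pi_rank hG hWSt.2.2).1, ← (pi_rank hG hWSt.2.2).2, ← sub_eq_zero.1 h]
    exact hle
  obtain ⟨v, hv0, hv1, hv2, hv3⟩ := h1 _ _ (proj_sub he P1 le1).1 (proj_sub hf P2 le2).1 hp1 hp2
  have hvEx : ∀ n, Ex (w n) v := by
    intro n
    obtain ⟨q1, q2⟩ := hWext n
    obtain ⟨a1, a2, a3⟩ := hSt n
    obtain ⟨o1, o2⟩ := orth W v hWSt ⟨hv1, hv2, hv3⟩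
    have q1' : w n * star W = w n * star (w n) := by
      have := congrArg star q1
      simpa [star_mul] using this
    have q2' : star W * w n = star (w n) * w n := by
      have := congrArg star q2
      simpa [star_mul] using this
    have ev : e * v = v := by
      rw [← hv1, ← mul_assoc, mul_sub, he.2, ← mul_assoc, hWSt.1]
    have vf : v * f = v := by
      rw [← hv2, mul_assoc, sub_mul, hf.2, mul_assoc (star W), hWSt.2.1]
    refine ⟨?_, ?_, hv3⟩
    · rw [sub_mul, ev, ← q1', mul_assoc, o1, mul_zero, sub_zero]
    · rw [mul_sub, vf, ← q2', ← mul_assoc, o2, zero_mul, sub_zero]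
  have hvpos : 0 < N v := lt_of_le_of_ne (hG.rk.1.nonneg v) (fun h => hv0 (hG.rk.2 _ h.symm))
  have hinc : ∀ n, N (w n) + N (V (w n)) ≤ N (w (n + 1)) := by
    intro n
    have := hrank n (n + 1) (Nat.le_succ n)
    rw [hws n] at this ⊢
    rw [add_sub_cancel_left] at this
    linarith
  have hgrow : ∀ n : ℕ, n * (N v / 2) ≤ N (w n) := by
    intro n
    induction n with
    | zero => simp [hw0, prf_zero hG.rk.1]
    | succ n ih =>
      have h2 := hVmax _ (hSt n) v (hvEx n)
      have h3 := hinc n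
      push_cast
      linarith
  obtain ⟨n, hn⟩ := exists_nat_gt (1 / (N v / 2))
  have h2 := hgrow n
  have h3 := hG.rk.1.le_one (w n)
  rw [div_lt_iff₀ (by linarith)] at hn
  linarith

end P3

section P4
set_option linter.unusedSectionVars false
set_option linter.unusedSimpArgs false
variable {F : Type*} [Field F] [StarRing F]

open Matrix

lemma posdef_fintype (hF : PosDefStar F) {n : Type*} [Fintype n] (x : n → F)
    (h : ∑ i, star (x i) * x i = 0) (i : n) : x i = 0 := by
  classical
  let e := Fintype.equivFin n
  have := hF (Fintype.card n) (fun j => x (e.symm j)) (by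
    rw [← h]
    exact Fintype.sum_equiv e.symm _ _ (fun j => rfl))
  simpa using this (e i)

lemma matrix_pivot {n : Type*} [Fintype n] [DecidableEq n] (M : Matrix n n F) :
    ∃ (L L' A A' : Matrix n n F) (D : n → F), M = L * diagonal D * L' ∧ A * L = 1 ∧ L * A = 1 ∧
      L' * A' = 1 ∧ A' * L' = 1 := by
  obtain ⟨l, l', D, h⟩ := Matrix.Pivot.exists_list_transvec_mul_diagonal_mul_list_transvec M
  have key : ∀ l : List (TransvectionStruct n F), ∃ A : Matrix n n F,
      A * (l.map TransvectionStruct.toMatrix).prod = 1 ∧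
      (l.map TransvectionStruct.toMatrix).prod * A = 1 := by
    intro l
    refine ⟨(l.reverse.map (TransvectionStruct.toMatrix ∘ TransvectionStruct.inv)).prod, ?_, ?_⟩
    · exact TransvectionStruct.reverse_inv_prod_mul_prod l
    · exact TransvectionStruct.prod_mul_reverse_inv_prod l
  obtain ⟨A, h1, h2⟩ := key l
  obtain ⟨A', h3, h4⟩ := key l'
  exact ⟨_, _, A, A', D, h, h1, h2, h4, h3⟩

lemma matrix_regular (n : Type*) [Fintype n] [DecidableEq n] : VNRegular (Matrix n n F) := by
  intro M
  obtain ⟨L, L', A, A', D, h, h1, h2, h3, h4⟩ := matrix_pivot M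
  refine ⟨A' * diagonal (fun i => (D i)⁻¹) * A, ?_⟩
  have e : diagonal D * diagonal (fun i => (D i)⁻¹) * diagonal D = diagonal D := by
    rw [diagonal_mul_diagonal, diagonal_mul_diagonal]
    congr 1; funext i
    by_cases hd : D i = 0
    · simp [hd]
    · field_simp
  calc M = L * diagonal D * L' := h
    _ = L * (diagonal D * diagonal (fun i => (D i)⁻¹) * diagonal D) * L' := by rw [e]
    _ = L * diagonal D * (L' * A') * diagonal (fun i => (D i)⁻¹) * (A * L) * diagonal D * L' := by
        rw [h1, h3]; simp only [mul_one, mul_assoc]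
    _ = M * (A' * diagonal (fun i => (D i)⁻¹) * A) * M := by
        rw [h]; simp only [mul_assoc]

lemma matrix_proper (hF : PosDefStar F) (n : Type*) [Fintype n] [DecidableEq n] :
    ProperStar (Matrix n n F) := by
  intro x hx
  ext i j
  have h := congrFun (congrFun hx j) j
  rw [Matrix.star_eq_conjTranspose, Matrix.mul_apply] at h
  simp only [conjTranspose_apply, Matrix.zero_apply] at h
  exact posdef_fintype hF (fun i => x i j) h i

lemma gram_schmidt (hF : PosDefStar F) {n : Type*} [Fintype n] [DecidableEq n] (s : Finset n) :
    ∀ P : Matrix n n F, Pᴴ = P → P * P = P → (∀ j, j ∉ s → ∀ i, P i j = 0) →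
    ∃ (r : ℕ) (V : Matrix n (Fin r) F) (c : Fin r → F), (∀ a, c a ≠ 0) ∧
      (∀ a, ∃ x : n → F, c a = ∑ i, star (x i) * x i) ∧
      Vᴴ * V = diagonal c ∧ V * diagonal (fun a => (c a)⁻¹) * Vᴴ = P := by
  classical
  induction s using Finset.induction_on with
  | empty =>
    intro P h1 h2 h3
    refine ⟨0, 0, 0, fun a => a.elim0, fun a => a.elim0, ?_, ?_⟩
    · ext a; exact a.elim0
    · ext i j
      have := h3 j (by simp) i
      simp [this]
  | insert j s hj ih =>
    intro P h1 h2 h3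
    by_cases hcol : ∀ i, P i j = 0
    · exact ih P h1 h2 (by
        intro k hk i
        by_cases hkj : k = j
        · rw [hkj]; exact hcol i
        · exact h3 k (by simp [hkj, hk]) i)
    · have hst : ∀ a b, star (P a b) = P b a := fun a b => by
        conv_rhs => rw [← h1]
        rfl
      have hPP : ∀ a b, ∑ k, P a k * P k b = P a b := fun a b => by
        conv_rhs => rw [← h2]
        rfl
      obtain ⟨c0, hc0⟩ : ∃ c0, c0 = P j j := ⟨_, rfl⟩
      have hc0s : c0 = ∑ i, star (P i j) * P i j := by
        rw [hc0, ← hPP j j]; simp [hst]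
      have hc0n : c0 ≠ 0 := fun h => hcol fun i => posdef_fintype hF _ (hc0s.symm.trans h) i
      have hc0st : star c0 = c0 := by rw [hc0, hst]
      obtain ⟨P', hP'⟩ : ∃ P' : Matrix n n F, ∀ a b, P' a b = P a b - P a j * c0⁻¹ * P j b :=
        ⟨Matrix.of fun a b => P a b - P a j * c0⁻¹ * P j b, fun _ _ => rfl⟩
      have hP'h : P'ᴴ = P' := by
        ext a b
        simp only [conjTranspose_apply, hP', star_sub, star_mul, star_inv₀, hst, hc0st]
        ring
      have hPP2 : P' * P' = P' := by
        ext a b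
        simp only [Matrix.mul_apply, hP']
        have e1 : ∀ k, (P a k - P a j * c0⁻¹ * P j k) * (P k b - P k j * c0⁻¹ * P j b) =
          P a k * P k b - (P a k * P k j) * (c0⁻¹ * P j b) - P a j * c0⁻¹ * (P j k * P k b)
            + P a j * c0⁻¹ * (P j k * P k j) * (c0⁻¹ * P j b) := fun k => by ring
        simp only [e1, Finset.sum_add_distrib, Finset.sum_sub_distrib, ← Finset.sum_mul,
          ← Finset.mul_sum, hPP]
        rw [← hc0]; field_simp; ring
      obtain ⟨r, V, c, a1, a2, a3, a4⟩ := ih P' hP'h hPP2 (by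
        intro k hk i
        by_cases hkj : k = j
        · rw [hP', hkj, ← hc0]; field_simp; ring
        · have h4 := fun i => h3 k (by simp [hkj, hk]) i
          simp [hP', h4])
      -- V' orthogonal to column j
      have hPV : P' * V = V := by
        rw [← a4, Matrix.mul_assoc, a3, Matrix.mul_assoc, diagonal_mul_diagonal]
        have : (diagonal fun i => (c i)⁻¹ * c i) = (1 : Matrix (Fin r) (Fin r) F) := by
          rw [← diagonal_one]; congr 1; funext i; exact inv_mul_cancel₀ (a1 i)
        rw [this, Matrix.mul_one]
      have hjP : ∀ b, ∑ k, P j k * P' k b = 0 := by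
        intro b
        simp only [hP', mul_sub, Finset.sum_sub_distrib, ← mul_assoc, ← Finset.sum_mul, hPP]
        rw [← hc0]; field_simp; ring
      have hjV : ∀ a, ∑ k, P j k * V k a = 0 := by
        intro a
        have : ∀ k, V k a = ∑ l, P' k l * V l a := fun k => by
          conv_lhs => rw [← hPV]
          rfl
        have h6 : ∑ k, P j k * V k a = ∑ k, ∑ l, P j k * P' k l * V l a :=
          Finset.sum_congr rfl fun k _ => by
            rw [this k, Finset.mul_sum]
            exact Finset.sum_congr rfl fun l _ => by ring
        rw [h6, Finset.sum_comm]
        refine Finset.sum_eq_zero fun l _ => ?_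
        rw [← Finset.sum_mul, hjP, zero_mul]
      obtain ⟨V2, hV0, hVs⟩ : ∃ V2 : Matrix n (Fin (r + 1)) F, (∀ i, V2 i 0 = P i j) ∧
          ∀ i a, V2 i a.succ = V i a :=
        ⟨Matrix.of fun i => Fin.cons (P i j) (V i), fun _ => rfl, fun _ _ => rfl⟩
      obtain ⟨c2, hd0, hds⟩ : ∃ c2 : Fin (r + 1) → F, c2 0 = c0 ∧ ∀ a, c2 a.succ = c a :=
        ⟨Fin.cons c0 c, rfl, fun _ => rfl⟩
      have b3 : V2ᴴ * V2 = diagonal c2 := by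
        ext o o'
        rw [Matrix.mul_apply]
        induction o using Fin.cases with
        | zero =>
          induction o' using Fin.cases with
          | zero => rw [diagonal_apply_eq, hd0, hc0s]; simp only [conjTranspose_apply, hV0]
          | succ a => simp [hV0, hVs, hst, hjV, diagonal_apply, Fin.succ_ne_zero, (Fin.succ_ne_zero _).symm]
        | succ a =>
          induction o' using Fin.cases with
          | zero =>
            have := congrArg star (hjV a)
            simp only [star_sum, star_mul, hst, star_zero] at this
            simpa [hV0, hVs, diagonal_apply, Fin.succ_ne_zero] using this
          | succ a' =>
            have := congrFun (congrFun a3 a) a'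
            rw [Matrix.mul_apply] at this
            simp only [conjTranspose_apply] at this
            simp [hVs, hds, this, diagonal_apply]
      have b4 : V2 * diagonal (fun a => (c2 a)⁻¹) * V2ᴴ = P := by
        ext a b
        rw [Matrix.mul_apply, Fin.sum_univ_succ]
        have h5 := congrFun (congrFun a4 a) b
        rw [Matrix.mul_apply] at h5
        simp only [Matrix.mul_diagonal, conjTranspose_apply] at h5 ⊢
        simp only [hV0, hVs, hd0, hds]
        rw [h5, hst]
        rw [hP']; ring
      refine ⟨r + 1, V2, c2, ?_, ?_, b3, b4⟩
      · intro a
        induction a using Fin.cases with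
        | zero => rw [hd0]; exact hc0n
        | succ b => rw [hds]; exact a1 b
      · intro a
        induction a using Fin.cases with
        | zero => rw [hd0]; exact ⟨_, hc0s⟩
        | succ b => rw [hds]; exact a2 b

lemma pfister (hF : PosDefStar F) {τ : Type*} [Fintype τ] [DecidableEq τ]
    (h : ∀ x : τ → F, ∃ M : Matrix τ τ F, M * Mᴴ = (∑ i, star (x i) * x i) • 1 ∧
      Mᴴ * M = (∑ i, star (x i) * x i) • 1) (x : τ ⊕ τ → F) :
    ∃ M : Matrix (τ ⊕ τ) (τ ⊕ τ) F, M * Mᴴ = (∑ i, star (x i) * x i) • 1 ∧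
      Mᴴ * M = (∑ i, star (x i) * x i) • 1 := by
  obtain ⟨A, hA1, hA2⟩ := h (fun i => x (Sum.inl i))
  obtain ⟨B, hB1, hB2⟩ := h (fun i => x (Sum.inr i))
  rw [Fintype.sum_sum_type]
  obtain ⟨a, ha⟩ : ∃ a, a = ∑ i, star (x (Sum.inl i)) * x (Sum.inl i) := ⟨_, rfl⟩
  obtain ⟨b, hb⟩ : ∃ b, b = ∑ i, star (x (Sum.inr i)) * x (Sum.inr i) := ⟨_, rfl⟩
  rw [← ha, ← hb]
  rw [← ha] at hA1 hA2
  rw [← hb] at hB1 hB2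
  have one : ∀ t : F, (t • 1 : Matrix (τ ⊕ τ) (τ ⊕ τ) F) =
      fromBlocks (t • 1) 0 0 (t • 1) := fun t => by
    rw [← fromBlocks_one, fromBlocks_smul]; simp
  by_cases h0 : a = 0
  · refine ⟨fromBlocks 0 B B 0, ?_, ?_⟩
    · rw [one, fromBlocks_conjTranspose, fromBlocks_multiply, h0]; simp [hB1]
    · rw [one, fromBlocks_conjTranspose, fromBlocks_multiply, h0]; simp [hB2]
  · have hsa : star a = a := by rw [ha]; simp [star_sum, mul_comm]
    have hab : a + b ≠ 0 := by
      intro hab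
      apply h0
      have := posdef_fintype hF x (by rw [Fintype.sum_sum_type, ← ha, ← hb, hab])
      rw [ha]; simp [this]
    let M : Matrix (τ ⊕ τ) (τ ⊕ τ) F := fromBlocks A B (-(a⁻¹ • (Aᴴ * Bᴴ * A))) Aᴴ
    have hM : M * Mᴴ = (a + b) • 1 := by
      rw [one, fromBlocks_conjTranspose, fromBlocks_multiply]
      have e0 : (-(a⁻¹ • (Aᴴ * Bᴴ * A)))ᴴ = -(a⁻¹ • (Aᴴ * B * A)) := by
        simp [conjTranspose_mul, Matrix.mul_assoc, hsa]
      have e1 : A * Aᴴ + B * Bᴴ = (a + b) • 1 := by rw [hA1, hB1, add_smul]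
      have e2 : A * -(a⁻¹ • (Aᴴ * B * A)) + B * Aᴴᴴ = 0 := by
        rw [Matrix.mul_neg, Matrix.mul_smul, Matrix.mul_assoc, ← Matrix.mul_assoc A, hA1]
        simp [smul_smul, h0]
      have e3 : -(a⁻¹ • (Aᴴ * Bᴴ * A)) * Aᴴ + Aᴴ * Bᴴ = 0 := by
        rw [Matrix.neg_mul, Matrix.smul_mul, Matrix.mul_assoc (Aᴴ * Bᴴ), hA1]
        simp [smul_smul, h0]
      have e4 : -(a⁻¹ • (Aᴴ * Bᴴ * A)) * -(a⁻¹ • (Aᴴ * B * A)) + Aᴴ * Aᴴᴴ = (a + b) • 1 := by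
        have : Aᴴ * Bᴴ * A * (Aᴴ * B * A) = (a * (b * a)) • 1 := by
          calc Aᴴ * Bᴴ * A * (Aᴴ * B * A) = Aᴴ * (Bᴴ * (A * Aᴴ) * B) * A := by
                simp only [Matrix.mul_assoc]
            _ = (a * (b * a)) • 1 := by
                rw [hA1]
                simp only [Matrix.mul_smul, Matrix.smul_mul, Matrix.mul_one, hB2, hA2, smul_smul, mul_assoc]
        rw [neg_mul_neg, Matrix.smul_mul, Matrix.mul_smul, this, conjTranspose_conjTranspose, hA2,
          smul_smul, smul_smul, ← add_smul]
        congr 1; field_simp; ring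
      rw [e0, e1, e2, e3, e4]
    refine ⟨M, hM, ?_⟩
    have h1 : M * ((a + b)⁻¹ • Mᴴ) = 1 := by
      rw [Matrix.mul_smul, hM, smul_smul, inv_mul_cancel₀ hab, one_smul]
    have h2 := mul_eq_one_comm.1 h1
    rw [Matrix.smul_mul] at h2
    rw [← h2, smul_smul, mul_inv_cancel₀ hab, one_smul]

lemma pfister_pow (hF : PosDefStar F) (k : ℕ) (x : Fin (2 ^ k) → F) :
    ∃ M : Matrix (Fin (2 ^ k)) (Fin (2 ^ k)) F, M * Mᴴ = (∑ i, star (x i) * x i) • 1 ∧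
      Mᴴ * M = (∑ i, star (x i) * x i) • 1 := by
  induction k with
  | zero =>
    refine ⟨diagonal x, ?_, ?_⟩
    · rw [diagonal_conjTranspose, diagonal_mul_diagonal]
      ext i j
      have hi : i = 0 := Subsingleton.elim (α := Fin 1) _ _
      have hj : j = 0 := Subsingleton.elim (α := Fin 1) _ _
      subst hi hj
      simp [mul_comm]
    · rw [diagonal_conjTranspose, diagonal_mul_diagonal]
      ext i j
      have hi : i = 0 := Subsingleton.elim (α := Fin 1) _ _
      have hj : j = 0 := Subsingleton.elim (α := Fin 1) _ _
      subst hi hj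
      simp
  | succ k ih =>
    let e : Fin (2 ^ k) ⊕ Fin (2 ^ k) ≃ Fin (2 ^ (k + 1)) :=
      finSumFinEquiv.trans (finCongr (by ring))
    obtain ⟨M, h1, h2⟩ := pfister hF ih (fun i => x (e i))
    have hs : ∑ i, star (x (e i)) * x (e i) = ∑ i, star (x i) * x i :=
      Fintype.sum_equiv e _ _ (fun j => rfl)
    rw [hs] at h1 h2
    refine ⟨M.submatrix e.symm e.symm, ?_, ?_⟩
    · rw [conjTranspose_submatrix, submatrix_mul_equiv, h1]
      ext i j; simp [Matrix.one_apply]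
    · rw [conjTranspose_submatrix, submatrix_mul_equiv, h2]
      ext i j; simp [Matrix.one_apply]

lemma pfister_pad (hF : PosDefStar F) (k : ℕ) {n : Type*} [Fintype n]
    (hn : Fintype.card n ≤ 2 ^ k) (x : n → F) :
    ∃ M : Matrix (Fin (2 ^ k)) (Fin (2 ^ k)) F, M * Mᴴ = (∑ i, star (x i) * x i) • 1 ∧
      Mᴴ * M = (∑ i, star (x i) * x i) • 1 := by
  classical
  obtain ⟨f⟩ : Nonempty (n ↪ Fin (2 ^ k)) :=
    Function.Embedding.nonempty_of_card_le (by simpa using hn)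
  have := pfister_pow hF k (Function.extend f x 0)
  have hs : ∑ i, star (Function.extend f x 0 i) * Function.extend f x 0 i
      = ∑ i, star (x i) * x i := by
    rw [← Finset.sum_subset (Finset.subset_univ (Finset.univ.map f))]
    · rw [Finset.sum_map]
      simp [f.injective.extend_apply]
    · intro j _ hj
      rw [Function.extend_apply']
      · simp
      · rintro ⟨a, rfl⟩; exact hj (by simp)
  rwa [hs] at this

/-- the key linear algebra lemma -/
lemma proj_split (hF : PosDefStar F) (k : ℕ) {n : Type*} [Fintype n] [DecidableEq n]
    (hn : Fintype.card n ≤ 2 ^ k) (P : Matrix n n F) (hP : IsProjection P) :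
    ∃ W : Matrix (n × Fin (2 ^ k)) (Fin P.rank × Fin (2 ^ k)) F,
      Wᴴ * W = 1 ∧ W * Wᴴ = P ⊗ₖ (1 : Matrix (Fin (2 ^ k)) (Fin (2 ^ k)) F) := by
  obtain ⟨r, V, c, h1, h2, h3, h4⟩ := gram_schmidt hF Finset.univ P hP.1 hP.2 (by simp)
  have hr : P.rank = r := by
    have hone : diagonal (fun a => (c a)⁻¹) * Vᴴ * V = 1 := by
      rw [Matrix.mul_assoc, h3, diagonal_mul_diagonal, ← diagonal_one]
      congr 1; funext i; exact inv_mul_cancel₀ (h1 i)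
    apply le_antisymm
    · rw [← h4, Matrix.mul_assoc]
      exact (Matrix.rank_mul_le_left _ _).trans ((Matrix.rank_le_card_width V).trans (by simp))
    · have e : diagonal (fun a => (c a)⁻¹) * Vᴴ * P * V = 1 := by
        rw [← h4]
        calc _ = (diagonal (fun a => (c a)⁻¹) * Vᴴ * V) * (diagonal (fun a => (c a)⁻¹) * Vᴴ * V) := by
              simp only [Matrix.mul_assoc]
          _ = 1 := by rw [hone, Matrix.mul_one]
      calc r = (1 : Matrix (Fin r) (Fin r) F).rank := by simp
        _ ≤ (diagonal (fun a => (c a)⁻¹) * Vᴴ * P).rank := by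
            rw [← e]; exact Matrix.rank_mul_le_left _ _
        _ ≤ P.rank := Matrix.rank_mul_le_right _ _
  rw [hr]
  have hM : ∀ a, ∃ M : Matrix (Fin (2 ^ k)) (Fin (2 ^ k)) F, M * Mᴴ = c a • 1 ∧ Mᴴ * M = c a • 1 := by
    intro a
    obtain ⟨x, hx⟩ := h2 a
    rw [hx]
    exact pfister_pad hF k hn x
  choose M hM1 hM2 using hM
  have hcs : ∀ a, star (c a) = c a := by
    intro a
    obtain ⟨x, hx⟩ := h2 a
    rw [hx]; simp [star_sum, mul_comm]
  refine ⟨Matrix.of fun b a => V b.1 a.1 * star (M a.1 a.2 b.2) * (c a.1)⁻¹, ?_, ?_⟩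
  · ext ⟨a, t⟩ ⟨a', t'⟩
    have e1 : ∑ b, star (V b a) * V b a' = diagonal c a a' := by
      rw [← h3]; rfl
    rw [Matrix.mul_apply, Fintype.sum_prod_type]
    simp only [conjTranspose_apply, Matrix.of_apply, star_mul, star_star, star_inv₀, hcs]
    have e2 : ∀ b s, (c a)⁻¹ * (M a t s * star (V b a)) * (V b a' * star (M a' t' s) * (c a')⁻¹)
      = (star (V b a) * V b a') * ((M a t s * star (M a' t' s)) * ((c a)⁻¹ * (c a')⁻¹)) :=
      fun b s => by ring
    simp only [e2]
    rw [← Finset.sum_mul_sum, e1, ← Finset.sum_mul]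
    by_cases haa : a = a'
    · subst haa
      have e3 : ∑ s, M a t s * star (M a t' s) = (c a • (1 : Matrix _ _ F)) t t' := by
        rw [← hM1 a]; rfl
      rw [e3]
      have := h1 a
      by_cases htt : t = t'
      · subst htt; simp; field_simp
      · simp [htt]
    · rw [diagonal_apply_ne _ haa, zero_mul, Matrix.one_apply_ne]
      simp [haa]
  · ext ⟨b, s⟩ ⟨b', s'⟩
    rw [Matrix.mul_apply, Fintype.sum_prod_type]
    simp only [conjTranspose_apply, Matrix.of_apply, star_mul, star_star, star_inv₀, hcs]
    have e2 : ∀ a t, V b a * star (M a t s) * (c a)⁻¹ * ((c a)⁻¹ * (M a t s' * star (V b' a)))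
      = (star (M a t s) * M a t s') * (V b a * (c a)⁻¹ * (c a)⁻¹ * star (V b' a)) :=
      fun b s => by ring
    simp only [e2, ← Finset.sum_mul]
    have e3 : ∀ a, ∑ t, star (M a t s) * M a t s' = (c a • (1 : Matrix _ _ F)) s s' := fun a => by
      rw [← hM2 a]; rfl
    simp only [e3]
    rw [kroneckerMap_apply, ← h4, Matrix.mul_apply, Finset.sum_mul]
    refine Finset.sum_congr rfl fun a _ => ?_
    have := h1 a
    simp only [mul_diagonal, conjTranspose_apply, Matrix.smul_apply, smul_eq_mul]
    field_simp

end P4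

section P5
set_option linter.unusedSectionVars false
set_option linter.unusedSimpArgs false
set_option linter.unusedVariables false
variable {F : Type} [Field F] [StarRing F]
variable {Q : Type} [Ring Q] [Algebra F Q] [StarRing Q] [StarModule F Q]

open Matrix

/-- a frame: orthogonal partial isometries with common initial projection -/
structure IsFrame {T : Type} [DecidableEq T] (u : T → Q) (h : Q) : Prop where
  proj : IsProjection h
  uu : ∀ a b, star (u a) * u b = if a = b then h else 0
  uh : ∀ a, u a * h = u a

/-- the map induced by a frame -/
def fm {T : Type} [Fintype T] (u : T → Q) (Z : Matrix T T F) : Q :=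
  ∑ a, ∑ b, Z a b • (u a * star (u b))

section single
variable {T : Type} [Fintype T] [DecidableEq T] {u : T → Q} {h : Q}

lemma IsFrame.self (hf : IsFrame u h) (a : T) : star (u a) * u a = h := by
  rw [hf.uu]; simp

lemma IsFrame.ne (hf : IsFrame u h) {a b : T} (hab : a ≠ b) : star (u a) * u b = 0 := by
  rw [hf.uu]; simp [hab]

lemma IsFrame.hu (hf : IsFrame u h) (a : T) : h * star (u a) = star (u a) := by
  have := congrArg star (hf.uh a)
  rwa [star_mul, hf.proj.1] at this

lemma fm_add (Z Z' : Matrix T T F) : fm u (Z + Z') = fm u Z + fm u Z' := by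
  simp only [fm, Matrix.add_apply, add_smul, Finset.sum_add_distrib]

lemma fm_smul (c : F) (Z : Matrix T T F) : fm u (c • Z) = c • fm u Z := by
  simp only [fm, Matrix.smul_apply, Finset.smul_sum, smul_smul, smul_eq_mul]

lemma fm_zero : fm u (0 : Matrix T T F) = 0 := by
  simp [fm]

lemma fm_star (Z : Matrix T T F) : star (fm u Z) = fm u (star Z) := by
  simp only [fm, star_sum, star_smul, star_mul, star_star]
  rw [Finset.sum_comm]
  rfl

lemma fm_single (a b : T) (c : F) : fm u (Matrix.single a b c) = c • (u a * star (u b)) := by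
  rw [fm, Finset.sum_eq_single a, Finset.sum_eq_single b]
  · simp
  · intro b' _ hb; rw [Matrix.single_apply_of_ne _ _ _ _ _ (by simp [hb.symm]), zero_smul]
  · simp
  · intro a' _ ha
    refine Finset.sum_eq_zero fun b' _ => ?_
    rw [Matrix.single_apply_of_ne _ _ _ _ _ (by simp [ha.symm]), zero_smul]
  · simp

lemma fm_one : fm u (1 : Matrix T T F) = ∑ a, u a * star (u a) := by
  rw [fm]
  refine Finset.sum_congr rfl fun a _ => ?_
  rw [Finset.sum_eq_single a]
  · simp
  · intro b _ hb; rw [Matrix.one_apply_ne hb.symm, zero_smul]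
  · simp

lemma fm_diagonal (d : T → F) : fm u (diagonal d) = ∑ a, d a • (u a * star (u a)) := by
  rw [fm]
  refine Finset.sum_congr rfl fun a _ => ?_
  rw [Finset.sum_eq_single a]
  · simp
  · intro b _ hb; rw [Matrix.diagonal_apply_ne _ hb.symm, zero_smul]
  · simp

lemma fm_mul_u (hf : IsFrame u h) (Z : Matrix T T F) (b : T) :
    fm u Z * u b = ∑ a, Z a b • u a := by
  rw [fm, Finset.sum_mul]
  refine Finset.sum_congr rfl fun a _ => ?_
  rw [Finset.sum_mul, Finset.sum_eq_single b]
  · rw [smul_mul_assoc, mul_assoc, hf.self, hf.uh]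
  · intro c _ hc
    rw [smul_mul_assoc, mul_assoc, hf.ne hc, mul_zero, smul_zero]
  · simp

lemma fm_mul (hf : IsFrame u h) (Z Z' : Matrix T T F) : fm u (Z * Z') = fm u Z * fm u Z' := by
  conv_rhs => rw [fm.eq_1 u Z']
  simp only [Finset.mul_sum, mul_smul_comm, ← mul_assoc, fm_mul_u hf, Finset.sum_mul,
    smul_mul_assoc, Finset.smul_sum, smul_smul]
  rw [Finset.sum_comm]
  simp only [fm, Matrix.mul_apply, Finset.sum_smul]
  rw [Finset.sum_comm]
  refine Finset.sum_congr rfl fun b _ => ?_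
  conv_rhs => rw [Finset.sum_comm]
  refine Finset.sum_congr rfl fun a _ => ?_
  refine Finset.sum_congr rfl fun c _ => ?_
  rw [mul_comm]

lemma fm_orth {T' : Type} [Fintype T'] {u' : T' → Q} (ho : ∀ a b, star (u a) * u' b = 0)
    (Z : Matrix T T F) (Z' : Matrix T' T' F) : fm u Z * fm u' Z' = 0 := by
  simp only [fm, Finset.sum_mul_sum, Finset.mul_sum, Finset.sum_mul]
  refine Finset.sum_eq_zero fun a _ => ?_
  refine Finset.sum_eq_zero fun a _ => ?_
  refine Finset.sum_eq_zero fun a _ => ?_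
  refine Finset.sum_eq_zero fun a _ => ?_
  rw [smul_mul_smul_comm]
  rw [mul_assoc, ← mul_assoc (star (u _)), ho]; simp

/-- left multiplication of a frame -/
lemma IsFrame.lmul (hf : IsFrame u h) {w q : Q} (hw : star w * w = q) (hq : ∀ a, q * u a = u a) :
    IsFrame (fun a => w * u a) h := by
  refine ⟨hf.proj, fun a b => ?_, fun a => by rw [mul_assoc, hf.uh]⟩
  rw [star_mul, mul_assoc, ← mul_assoc (star w), hw, hq, hf.uu]

lemma fm_lmul (w : Q) (Z : Matrix T T F) : fm (fun a => w * u a) Z = w * fm u Z * star w := by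
  simp only [fm, Finset.mul_sum, Finset.sum_mul, star_mul, mul_smul_comm, smul_mul_assoc, mul_assoc]

/-- composition of frames -/
lemma IsFrame.comp (hf : IsFrame u h) {S : Type} [DecidableEq S] {w : S → Q} {k : Q}
    (hw : IsFrame w k) (hh : ∀ s, h * w s = w s) :
    IsFrame (fun p : T × S => u p.1 * w p.2) k := by
  refine ⟨hw.proj, fun p q => ?_, fun p => by rw [mul_assoc, hw.uh]⟩
  rw [star_mul, mul_assoc, ← mul_assoc (star (u _)), hf.uu]
  by_cases h1 : p.1 = q.1
  · rw [if_pos h1, hh, hw.uu]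
    by_cases h2 : p.2 = q.2
    · rw [if_pos h2, if_pos (Prod.ext h1 h2)]
    · rw [if_neg h2, if_neg (fun h => h2 (by rw [h]))]
  · rw [if_neg h1, if_neg (fun h => h1 (by rw [h]))]; simp

lemma fm_comp {S : Type} [Fintype S] [DecidableEq S] (w : S → Q) (Z : Matrix T T F) (Y : Matrix S S F) :
    fm (fun p : T × S => u p.1 * w p.2) (Z ⊗ₖ Y) =
      ∑ a, ∑ b, Z a b • (u a * fm w Y * star (u b)) := by
  rw [fm, Fintype.sum_prod_type]
  refine Finset.sum_congr rfl fun a _ => ?_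
  rw [Finset.sum_comm, Fintype.sum_prod_type]
  refine Finset.sum_congr rfl fun b _ => ?_
  rw [Finset.sum_comm]
  simp only [fm, Finset.mul_sum, Finset.sum_mul, Finset.smul_sum, kroneckerMap_apply, star_mul,
    smul_mul_assoc, mul_smul_comm, smul_smul, mul_assoc]

lemma IsFrame.comp_one (hf : IsFrame u h) {S : Type} [Fintype S] [DecidableEq S] {w : S → Q} {k : Q}
    (hw : IsFrame w k) (hh : ∀ s, h * w s = w s) (Z : Matrix T T F) :
    fm (fun p : T × S => u p.1 * w p.2) (Z ⊗ₖ (1 : Matrix S S F)) =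
      fm u Z * fm (fun p : T × S => u p.1 * w p.2) (1 : Matrix (T × S) (T × S) F) := by
  rw [← Matrix.one_kronecker_one, fm_comp, fm_comp]
  simp only [Finset.mul_sum, mul_smul_comm, ← mul_assoc, fm_mul_u hf]
  rw [Finset.sum_comm' (t' := Finset.univ) (s' := fun _ => Finset.univ) (by simp)]
  refine Finset.sum_congr rfl fun b _ => ?_
  symm
  rw [Finset.sum_eq_single b]
  · simp only [Matrix.one_apply_eq, one_smul, Finset.sum_mul, smul_mul_assoc]
  · intro c _ hc
    rw [Matrix.one_apply_ne hc.symm, zero_smul]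
  · simp

lemma fm_sub (Z Z' : Matrix T T F) : fm u (Z - Z') = fm u Z - fm u Z' := by
  rw [sub_eq_add_neg, fm_add, ← neg_one_smul F Z', fm_smul, neg_one_smul, ← sub_eq_add_neg]

lemma fm_one_proj (hf : IsFrame u h) : IsProjection (fm u (1 : Matrix T T F)) := by
  refine ⟨by rw [fm_star, star_one], by rw [← fm_mul hf, mul_one]⟩

lemma fm_one_mul_u (hf : IsFrame u h) (b : T) : fm u (1 : Matrix T T F) * u b = u b := by
  rw [fm_mul_u hf, Finset.sum_eq_single b]
  · simp
  · intro a _ ha; rw [Matrix.one_apply_ne ha, zero_smul]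
  · simp

/-- linear change of a frame by an isometry -/
lemma IsFrame.change (hf : IsFrame u h) {S : Type} [Fintype S] [DecidableEq S] (W : Matrix T S F)
    (hW : Wᴴ * W = 1) : IsFrame (fun s => ∑ t, W t s • u t) h := by
  refine ⟨hf.proj, fun a b => ?_, fun a => ?_⟩
  · have : (Wᴴ * W) a b = if a = b then 1 else 0 := by rw [hW]; rfl
    rw [Matrix.mul_apply] at this
    simp only [star_sum, Finset.sum_mul_sum, star_smul, smul_mul_smul_comm]
    have e : ∀ t, ∑ t', (star (W t a) * W t' b) • (star (u t) * u t') = (star (W t a) * W t b) • h := by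
      intro t
      rw [Finset.sum_eq_single t]
      · rw [hf.self]
      · intro t' _ ht; rw [hf.ne ht.symm, smul_zero]
      · simp
    simp only [e, ← Finset.sum_smul]
    simp only [conjTranspose_apply] at this
    rw [this]; split_ifs <;> simp
  · simp only [Finset.sum_mul, smul_mul_assoc, hf.uh]

lemma fm_change {S : Type} [Fintype S] [DecidableEq S] (W : Matrix T S F) (Z : Matrix S S F) :
    fm (fun s => ∑ t, W t s • u t) Z = fm u (W * Z * Wᴴ) := by
  simp only [fm, star_sum, star_smul, Finset.sum_mul_sum, smul_mul_smul_comm, Finset.smul_sum,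
    smul_smul, Matrix.mul_apply, Finset.sum_mul, Finset.sum_smul, conjTranspose_apply]
  have L : ∀ f : S → S → T → T → Q, ∑ s, ∑ s', ∑ t, ∑ t', f s s' t t' =
      ∑ t, ∑ t', ∑ s', ∑ s, f s s' t t' := by
    intro f
    calc ∑ s, ∑ s', ∑ t, ∑ t', f s s' t t' = ∑ s, ∑ t, ∑ s', ∑ t', f s s' t t' :=
          Finset.sum_congr rfl fun s _ => Finset.sum_comm
      _ = ∑ t, ∑ s, ∑ s', ∑ t', f s s' t t' := Finset.sum_comm
      _ = _ := by
          refine Finset.sum_congr rfl fun t _ => ?_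
          calc ∑ s, ∑ s', ∑ t', f s s' t t' = ∑ s', ∑ s, ∑ t', f s s' t t' := Finset.sum_comm
            _ = ∑ s', ∑ t', ∑ s, f s s' t t' := Finset.sum_congr rfl fun s _ => Finset.sum_comm
            _ = _ := Finset.sum_comm
  simp only [Finset.mul_sum, Finset.smul_sum, smul_mul_smul_comm, smul_smul]
  rw [L]
  refine Finset.sum_congr rfl fun t _ => ?_
  refine Finset.sum_congr rfl fun t' _ => ?_
  refine Finset.sum_congr rfl fun s' _ => ?_
  refine Finset.sum_congr rfl fun s _ => ?_
  congr 1; ring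

lemma fm_reindex {S : Type} [Fintype S] (e : S ≃ T) (Z : Matrix T T F) :
    fm (fun s => u (e s)) (Z.submatrix e e) = fm u Z := by
  simp only [fm, Matrix.submatrix_apply]
  refine Fintype.sum_equiv e _ _ fun a => ?_
  exact Fintype.sum_equiv e _ _ fun b => rfl

lemma IsFrame.reindex (hf : IsFrame u h) {S : Type} [DecidableEq S] (e : S ↪ T) :
    IsFrame (fun s => u (e s)) h :=
  ⟨hf.proj, fun a b => by rw [hf.uu]; simp, fun a => hf.uh _⟩

end single

/-- multi-frames -/
structure IsMF {ι : Type} {T : ι → Type} [∀ i, DecidableEq (T i)] (u : ∀ i, T i → Q) (h : ι → Q) :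
    Prop where
  fr : ∀ i, IsFrame (u i) (h i)
  ho : ∀ i j, i ≠ j → ∀ a b, star (u i a) * u j b = 0

/-- the homomorphism given by a multi-frame -/
def mm {ι : Type} [Fintype ι] {T : ι → Type} [∀ i, Fintype (T i)] (u : ∀ i, T i → Q)
    (Z : ∀ i, Matrix (T i) (T i) F) : Q := ∑ i, fm (u i) (Z i)

/-- total projection -/
def tot {ι : Type} [Fintype ι] {T : ι → Type} [∀ i, Fintype (T i)] (u : ∀ i, T i → Q) : Q :=
  ∑ i, ∑ a, u i a * star (u i a)

section multi
variable {ι : Type} [Fintype ι] [DecidableEq ι] {T : ι → Type} [∀ i, Fintype (T i)]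
  [∀ i, DecidableEq (T i)] {u : ∀ i, T i → Q} {h : ι → Q}
variable {S : ι → Type} [∀ i, Fintype (S i)] [∀ i, DecidableEq (S i)]

lemma mm_one : mm u (1 : ∀ i, Matrix (T i) (T i) F) = tot u := by
  simp only [mm, tot, Pi.one_apply, fm_one]

lemma mm_add (Z Z' : ∀ i, Matrix (T i) (T i) F) : mm u (Z + Z') = mm u Z + mm u Z' := by
  simp only [mm, Pi.add_apply, fm_add, Finset.sum_add_distrib]

lemma mm_sub (Z Z' : ∀ i, Matrix (T i) (T i) F) : mm u (Z - Z') = mm u Z - mm u Z' := by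
  simp only [mm, Pi.sub_apply, fm_sub, Finset.sum_sub_distrib]

lemma mm_zero : mm u (0 : ∀ i, Matrix (T i) (T i) F) = 0 := by
  simp only [mm, Pi.zero_apply, fm_zero, Finset.sum_const_zero]

lemma mm_star (Z : ∀ i, Matrix (T i) (T i) F) : star (mm u Z) = mm u (star Z) := by
  simp only [mm, star_sum, fm_star, Pi.star_apply]

lemma IsMF.mul (hM : IsMF u h) (Z Z' : ∀ i, Matrix (T i) (T i) F) :
    mm u (Z * Z') = mm u Z * mm u Z' := by
  simp only [mm, Finset.sum_mul_sum]
  refine Finset.sum_congr rfl fun i _ => ?_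
  rw [Finset.sum_eq_single i]
  · rw [Pi.mul_apply, fm_mul (hM.fr i)]
  · intro j _ hj
    exact fm_orth (hM.ho i j hj.symm) _ _
  · simp

lemma IsMF.map_tot (hM : IsMF u h) (Z : ∀ i, Matrix (T i) (T i) F) : mm u Z * tot u = mm u Z := by
  rw [← mm_one (F := F), ← hM.mul, mul_one]

lemma IsMF.tot_map (hM : IsMF u h) (Z : ∀ i, Matrix (T i) (T i) F) : tot u * mm u Z = mm u Z := by
  rw [← mm_one (F := F), ← hM.mul, one_mul]

lemma IsMF.pow (hM : IsMF u h) (Z : ∀ i, Matrix (T i) (T i) F) (k : ℕ) :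
    mm u (Z ^ (k + 1)) = mm u Z ^ (k + 1) := by
  induction k with
  | zero => simp
  | succ k ih => rw [pow_succ, hM.mul, ih, ← pow_succ]

lemma IsMF.uu_mul (hM : IsMF u h) (i j : ι) (a : T i) (b : T j) (hab : (⟨i, a⟩ : Σ i, T i) ≠ ⟨j, b⟩) :
    (u i a * star (u i a)) * (u j b * star (u j b)) = 0 := by
  have : star (u i a) * u j b = 0 := by
    by_cases hij : i = j
    · subst hij
      exact (hM.fr i).ne (fun h => hab (by rw [h]))
    · exact hM.ho i j hij a b
  rw [mul_assoc, ← mul_assoc (star (u i a)), this, zero_mul, mul_zero]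

lemma IsMF.pi (hM : IsMF u h) (i : ι) (a : T i) : u i a * star (u i a) * u i a = u i a := by
  rw [mul_assoc, (hM.fr i).self, (hM.fr i).uh]

lemma IsMF.tot_u (hM : IsMF u h) (i : ι) (a : T i) : tot u * u i a = u i a := by
  rw [tot, Finset.sum_mul, Finset.sum_eq_single i]
  · rw [Finset.sum_mul, Finset.sum_eq_single a]
    · exact hM.pi i a
    · intro b _ hb; rw [mul_assoc, (hM.fr i).ne hb, mul_zero]
    · simp
  · intro j _ hj
    rw [Finset.sum_mul]
    refine Finset.sum_eq_zero fun b _ => ?_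
    rw [mul_assoc, hM.ho j i hj, mul_zero]
  · simp

lemma IsMF.tot_proj (hM : IsMF u h) : IsProjection (tot u) := by
  constructor
  · simp [tot, star_sum]
  · conv_lhs => enter [1]; rw [tot.eq_1 u]
    simp only [Finset.sum_mul]
    conv_rhs => rw [tot]
    refine Finset.sum_congr rfl fun i _ => Finset.sum_congr rfl fun a _ => ?_
    have := congrArg star (hM.tot_u i a)
    have hs : star (tot u) = tot u := by simp [tot, star_sum]
    rw [star_mul, hs] at this
    rw [mul_assoc, this]

/-- refinement -/
lemma IsMF.refine (hM : IsMF u h) {k : ι → Q}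
    {w : ∀ i, S i → Q} (hw : ∀ i, IsFrame (w i) (k i)) (hh : ∀ i s, h i * w i s = w i s) :
    IsMF (fun i (p : T i × S i) => u i p.1 * w i p.2) k where
  fr := fun i => (hM.fr i).comp (hw i) (hh i)
  ho := fun i j hij a b => by
    rw [star_mul, mul_assoc, ← mul_assoc (star (u _ _)), hM.ho i j hij]; simp

lemma IsMF.refine_map (hM : IsMF u h) {k : ι → Q}
    {w : ∀ i, S i → Q} (hw : ∀ i, IsFrame (w i) (k i)) (hh : ∀ i s, h i * w i s = w i s)
    (Z : ∀ i, Matrix (T i) (T i) F) :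
    mm (fun i (p : T i × S i) => u i p.1 * w i p.2) (fun i => Z i ⊗ₖ (1 : Matrix (S i) (S i) F)) =
      mm u Z * tot (fun i (p : T i × S i) => u i p.1 * w i p.2) := by
  rw [← mm_one (F := F)]
  simp only [mm, Finset.sum_mul_sum]
  refine Finset.sum_congr rfl fun i _ => ?_
  rw [Finset.sum_eq_single i]
  · exact (hM.fr i).comp_one (hw i) (hh i) _
  · intro j _ hj
    exact fm_orth (fun a b => by rw [← mul_assoc, hM.ho i j hj.symm, zero_mul]) _ _
  · simp

lemma IsMF.change (hM : IsMF u h) (W : ∀ i, Matrix (T i) (S i) F) (hW : ∀ i, (W i)ᴴ * W i = 1) :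
    IsMF (fun i s => ∑ t, W i t s • u i t) h where
  fr := fun i => (hM.fr i).change (W i) (hW i)
  ho := fun i j hij a b => by
    simp only [star_sum, Finset.sum_mul_sum, star_smul, smul_mul_smul_comm, hM.ho i j hij,
      smul_zero, Finset.sum_const_zero]

lemma mm_change (W : ∀ i, Matrix (T i) (S i) F) (Z : ∀ i, Matrix (S i) (S i) F) :
    mm (fun i s => ∑ t, W i t s • u i t) Z = mm u (fun i => W i * Z i * (W i)ᴴ) := by
  simp only [mm]
  exact Finset.sum_congr rfl fun i _ => fm_change _ _

lemma tot_change (W : ∀ i, Matrix (T i) (S i) F) :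
    tot (fun i s => ∑ t, W i t s • u i t) = mm u (fun i => W i * (W i)ᴴ) := by
  rw [← mm_one (F := F), mm_change]
  congr 1; funext i; simp

lemma IsMF.lmul (hM : IsMF u h) {w q : Q} (hw : star w * w = q) (hq : ∀ i a, q * u i a = u i a) :
    IsMF (fun i a => w * u i a) h where
  fr := fun i => (hM.fr i).lmul hw (hq i)
  ho := fun i j hij a b => by
    rw [star_mul, mul_assoc, ← mul_assoc (star w), hw, hq, hM.ho i j hij]

lemma mm_lmul (w : Q) (Z : ∀ i, Matrix (T i) (T i) F) :
    mm (fun i a => w * u i a) Z = w * mm u Z * star w := by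
  simp only [mm, Finset.mul_sum, Finset.sum_mul]
  exact Finset.sum_congr rfl fun i _ => fm_lmul _ _

lemma tot_lmul (w : Q) : tot (fun i a => w * u i a) = w * tot u * star w := by
  simp only [tot, Finset.mul_sum, Finset.sum_mul, star_mul, mul_assoc]

lemma IsFrame.rank {N : Q → ℝ} (hG : Good Q N) {T : Type} [Fintype T] [DecidableEq T] {u : T → Q} {h : Q}
    (hf : IsFrame u h) (a : T) : N (u a * star (u a)) = N h ∧ N (u a) = N h := by
  have := pi_rank hG (v := u a) (by rw [mul_assoc, hf.self, hf.uh])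
  rw [hf.self] at this
  exact ⟨this.1.trans this.2.symm, this.2.symm⟩

/-- rank of the total projection -/
lemma IsMF.tot_rank {N : Q → ℝ} (hG : Good Q N) (hM : IsMF u h) :
    N (tot u) = ∑ i, (Fintype.card (T i) : ℝ) * N (h i) := by
  have e : tot u = ∑ p : Σ i, T i, u p.1 p.2 * star (u p.1 p.2) := by
    rw [tot, Fintype.sum_sigma]
  rw [e, prf_sum_orth hG.rk.1]
  · rw [Fintype.sum_sigma]
    refine Finset.sum_congr rfl fun i _ => ?_
    rw [Finset.sum_congr rfl fun a _ => ((hM.fr i).rank hG a).1]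
    simp
  · intro p _
    rw [← mul_assoc, hM.pi]
  · intro p _ q _ hpq
    exact hM.uu_mul _ _ _ _ hpq

lemma IsFrame.toMF {T : Type} [DecidableEq T] {u : T → Q} {h : Q} (hf : IsFrame u h) :
    IsMF (ι := Unit) (T := fun _ => T) (fun _ => u) (fun _ => h) :=
  ⟨fun _ => hf, fun i j hij => absurd rfl hij⟩

lemma tot_unit {T : Type} [Fintype T] (u : T → Q) :
    tot (ι := Unit) (T := fun _ => T) (fun _ => u) = ∑ a, u a * star (u a) := by
  simp [tot]

/-- multi-frame from a homomorphism -/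
lemma mf_of_hom {k : ℕ} {n : Fin k → ℕ} (hn : ∀ i, 0 < n i)
    (Ψ : (∀ i, Matrix (Fin (n i)) (Fin (n i)) F) →⋆ₐ[F] Q) :
    IsMF (T := fun i => Fin (n i)) (fun i a => Ψ (Pi.single i (Matrix.single a ⟨0, hn i⟩ 1)))
      (fun i => Ψ (Pi.single i (Matrix.single ⟨0, hn i⟩ ⟨0, hn i⟩ 1))) ∧
    ∀ Z, mm (T := fun i => Fin (n i))
      (fun i a => Ψ (Pi.single i (Matrix.single a ⟨0, hn i⟩ 1))) Z = Ψ Z := by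
  have hst : ∀ i (a b : Fin (n i)), star (Ψ (Pi.single i (Matrix.single a b (1 : F)))) =
      Ψ (Pi.single i (Matrix.single b a 1)) := by
    intro i a b
    rw [← map_star]
    congr 1
    funext j
    by_cases hj : j = i
    · subst hj
      rw [Pi.star_apply, Pi.single_eq_same, Pi.single_eq_same, Matrix.star_eq_conjTranspose,
        Matrix.conjTranspose_single, star_one]
    · rw [Pi.star_apply, Pi.single_eq_of_ne hj, Pi.single_eq_of_ne hj, star_zero]
  refine ⟨⟨fun i => ⟨⟨hst _ _ _, ?_⟩, fun a b => ?_, fun a => ?_⟩, fun i j hij a b => ?_⟩, fun Z => ?_⟩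
  · rw [← map_mul, ← Pi.single_mul, Matrix.single_mul_single_same, mul_one]
  · rw [hst, ← map_mul, ← Pi.single_mul]
    split_ifs with hab
    · subst hab; rw [Matrix.single_mul_single_same, mul_one]
    · rw [Matrix.single_mul_single_of_ne _ _ _ _ hab, Pi.single_zero, map_zero]
  · rw [← map_mul, ← Pi.single_mul, Matrix.single_mul_single_same, mul_one]
  · rw [hst, ← map_mul]
    have : (Pi.single i (Matrix.single (⟨0, hn i⟩ : Fin (n i)) a (1 : F)) * Pi.single j
        (Matrix.single b ⟨0, hn j⟩ 1) : ∀ i, Matrix (Fin (n i)) (Fin (n i)) F) = 0 := by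
      funext l
      by_cases hl : l = i
      · have : l ≠ j := fun h => hij (hl.symm.trans h)
        rw [Pi.mul_apply, Pi.single_eq_of_ne this, mul_zero, Pi.zero_apply]
      · rw [Pi.mul_apply, Pi.single_eq_of_ne hl, zero_mul, Pi.zero_apply]
    rw [this, map_zero]
  · rw [mm]
    simp only [fm, hst, ← map_mul, ← Pi.single_mul, Matrix.single_mul_single_same, mul_one,
      ← map_smul, ← map_sum]
    congr 1
    funext l
    rw [Finset.sum_apply, Finset.sum_eq_single l]
    · simp only [Finset.sum_apply, Pi.smul_apply, Pi.single_eq_same]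
      conv_rhs => rw [Matrix.matrix_eq_sum_single (Z l)]
      simp
    · intro j _ hj
      simp [Finset.sum_apply, Pi.single_eq_of_ne hj.symm]
    · simp
end multi
end P5

section P6
set_option linter.unusedSectionVars false
set_option linter.unusedSimpArgs false
set_option linter.unusedVariables false
variable {F : Type} [Field F] [StarRing F]
variable {Q : Type} [Ring Q] [Algebra F Q] [StarRing Q] [StarModule F Q] {N : Q → ℝ}

open Matrix

/-- local approximation of a corner by multi-frames -/
def LA (F : Type) [Field F] [Algebra F Q] (N : Q → ℝ) (g : Q) : Prop :=
  ∀ δ : ℝ, 0 < δ → ∀ (m : ℕ) (x : Fin m → Q), (∀ j, g * x j = x j ∧ x j * g = x j) →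
    ∃ (ι : Type) (_ : Fintype ι) (_ : DecidableEq ι) (T : ι → Type) (_ : ∀ i, Fintype (T i))
      (_ : ∀ i, DecidableEq (T i)) (u : ∀ i, T i → Q) (h : ι → Q)
      (Y : Fin m → ∀ i, Matrix (T i) (T i) F),
      IsMF u h ∧ N (g - tot u) < δ ∧ ∀ j, N (x j - mm u (Y j)) < δ

/-- approximate divisibility -/
def AD (N : Q → ℝ) (g : Q) : Prop :=
  ∀ (K : ℕ) (ε : ℝ), 0 < K → 0 < ε → ∃ (u : Fin K → Q) (h : Q), IsFrame u h ∧
    (∀ s, g * u s = u s) ∧ N (g - ∑ s, u s * star (u s)) < ε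

lemma exists_nilp (hG : Good Q N) (K : ℕ) : ∀ g : Q, IsProjection g → g ≠ 0 →
    ∃ z, g * z = z ∧ z * g = z ∧ z ^ (K + 2) = 0 ∧ z ^ (K + 1) ≠ 0 := by
  have split : ∀ g : Q, IsProjection g → g ≠ 0 → ∃ a b, IsProjection a ∧ IsProjection b ∧
      a ≠ 0 ∧ b ≠ 0 ∧ ProjLE a g ∧ ProjLE b g ∧ a * b = 0 ∧ b * a = 0 := by
    intro g hg h0
    have hpos : 0 < N g := lt_of_le_of_ne (hG.rk.1.nonneg g) fun h => h0 (hG.rk.2 g h.symm)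
    obtain ⟨a, ha, h1, h2⟩ := subproj_of_rank hG hg (N g / 2) (by linarith) (by linarith)
    obtain ⟨h3, h4, h5, h6⟩ := proj_sub hg ha h1
    have h7 := proj_rank_sub hG hg ha h1
    refine ⟨a, g - a, ha, h3, ?_, ?_, h1, h4, h5, h6⟩
    · rintro rfl; rw [prf_zero hG.rk.1] at h2; linarith
    · intro h; rw [h, prf_zero hG.rk.1] at h7; linarith
  induction K with
  | zero =>
    intro g hg h0
    obtain ⟨a, b, ha, hb, a0, b0, hag, hbg, hab, hba⟩ := split g hg h0
    obtain ⟨r, hr⟩ : ∃ r, a * r * b ≠ 0 := by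
      by_contra hcon
      push Not at hcon
      rcases simple_prime hG.simple a b hcon with h | h
      · exact a0 h
      · exact b0 h
    refine ⟨a * r * b, by rw [← mul_assoc, ← mul_assoc, hag.1], by rw [mul_assoc, hbg.2], ?_, by simpa using hr⟩
    rw [zero_add, sq]
    calc a * r * b * (a * r * b) = a * r * (b * a) * (r * b) := by simp only [mul_assoc]
      _ = 0 := by rw [hba]; simp
  | succ K ih =>
    intro g hg h0
    obtain ⟨a, b, ha, hb, a0, b0, hag, hbg, hab, hba⟩ := split g hg h0
    obtain ⟨z, h1, h2, h3, h4⟩ := ih a ha a0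
    have h4' : z ^ (K + 1) * a = z ^ (K + 1) := by rw [pow_succ, mul_assoc, h2]
    obtain ⟨r, hr⟩ : ∃ r, z ^ (K + 1) * r * b ≠ 0 := by
      by_contra hcon
      push Not at hcon
      rcases simple_prime hG.simple _ b hcon with h | h
      · exact h4 h
      · exact b0 h
    -- replace r by a r b
    obtain ⟨r, hr⟩ : ∃ r, z ^ (K + 1) * (a * r * b) ≠ 0 := ⟨r, by
      rw [← mul_assoc, ← mul_assoc, h4']; exact hr⟩
    obtain ⟨v, hv⟩ : ∃ v, v = a * r * b := ⟨_, rfl⟩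
    have hav : a * v = v := by rw [hv, ← mul_assoc, ← mul_assoc, ha.2]
    have hvb : v * b = v := by rw [hv, mul_assoc, hb.2]
    have hvz : v * z = 0 := by rw [← hvb, ← h1, mul_assoc, ← mul_assoc b, hba]; simp
    have hvv : v * v = 0 := by
      calc v * v = v * (b * a) * v := by rw [← mul_assoc, hvb, mul_assoc, hav]
        _ = 0 := by rw [hba]; simp
    rw [← hv] at hr
    have hp : ∀ m, (z + v) ^ (m + 1) = z ^ (m + 1) + z ^ m * v := by
      intro m
      induction m with
      | zero => simp
      | succ m ihm =>
        rw [pow_succ, ihm, add_mul, mul_add, mul_add, ← pow_succ, mul_assoc _ v z, hvz,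
          mul_assoc _ v v, hvv]
        simp
    refine ⟨z + v, ?_, ?_, ?_, ?_⟩
    · rw [mul_add, ← h1, ← hav, ← mul_assoc, ← mul_assoc, hag.1]
    · rw [add_mul, ← h2, ← hvb, mul_assoc, mul_assoc, hag.2, hbg.2]
    · rw [hp, pow_succ, h3]; simp
    · rw [hp, h3, zero_add]; exact hr

lemma fitting {n : Type*} [Fintype n] [DecidableEq n] (X : Matrix n n F) (k : ℕ)
    (hk : Fintype.card n ≤ k) : ∃ S, X ^ k = X ^ (k + 1) * S := by
  have h1 := Matrix.aeval_self_charpoly X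
  have h0 : X.charpoly ≠ 0 := X.charpoly_monic.ne_zero
  obtain ⟨q, hq, hnd⟩ := Polynomial.exists_eq_pow_rootMultiplicity_mul_and_not_dvd X.charpoly h0 0
  obtain ⟨j, hj⟩ : ∃ j, j = X.charpoly.rootMultiplicity 0 := ⟨_, rfl⟩
  rw [← hj] at hq
  have hjk : j ≤ k := by
    rw [hj]
    refine le_trans ?_ hk
    rw [← X.charpoly_natDegree_eq_dim]
    have := Polynomial.natDegree_le_of_dvd (Polynomial.pow_rootMultiplicity_dvd X.charpoly 0) h0
    rwa [Polynomial.natDegree_pow, Polynomial.natDegree_X_sub_C, mul_one] at this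
  rw [Polynomial.C_0, sub_zero] at hq hnd
  have hc : q.coeff 0 ≠ 0 := fun h => hnd (Polynomial.X_dvd_iff.2 h)
  rw [hq, map_mul, map_pow, Polynomial.aeval_X, ← Polynomial.X_mul_divX_add q, map_add, map_mul,
    Polynomial.aeval_X, Polynomial.aeval_C, mul_add] at h1
  obtain ⟨c, hcc⟩ : ∃ c, c = q.coeff 0 := ⟨_, rfl⟩
  rw [← hcc] at h1 hc
  obtain ⟨R, hR⟩ : ∃ R, R = Polynomial.aeval X q.divX := ⟨_, rfl⟩
  rw [← hR, Algebra.algebraMap_eq_smul_one, mul_smul_comm, mul_one] at h1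
  refine ⟨-(c⁻¹ • R), ?_⟩
  have h2 : X ^ j = X ^ (j + 1) * (-(c⁻¹ • R)) := by
    have h3 : c • X ^ j = - (X ^ j * (X * R)) := by
      rw [← sub_eq_zero, sub_neg_eq_add, add_comm]; exact h1
    have h4 : X ^ j = c⁻¹ • (c • X ^ j) := by rw [smul_smul, inv_mul_cancel₀ hc, one_smul]
    rw [h4, h3, pow_succ]; simp [mul_assoc]
  obtain ⟨d, rfl⟩ := Nat.exists_eq_add_of_le' hjk
  rw [pow_add, add_assoc, pow_add X d, mul_assoc, ← h2]

lemma pow_close (h : IsPseudoRankFunction N) (x y : Q) (k : ℕ) :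
    N (x ^ k - y ^ k) ≤ k * N (x - y) := by
  induction k with
  | zero => simp [prf_zero h]
  | succ k ih =>
    have e : x ^ (k + 1) - y ^ (k + 1) = (x ^ k - y ^ k) * x + y ^ k * (x - y) := by
      rw [pow_succ, pow_succ]; noncomm_ring
    rw [e]
    have h1 := h.subadditive ((x ^ k - y ^ k) * x) (y ^ k * (x - y))
    have h2 := h.mul_le_left (x ^ k - y ^ k) x
    have h3 := h.mul_le_right (y ^ k) (x - y)
    push_cast; linarith

/-- large blocks -/
lemma large_blocks (hG : Good Q N) {g : Q} (hg : IsProjection g) (h0 : g ≠ 0) (hLA : LA F N g)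
    (L : ℕ) (ε : ℝ) (hε : 0 < ε) :
    ∃ (ι : Type) (_ : Fintype ι) (_ : DecidableEq ι) (T : ι → Type) (_ : ∀ i, Fintype (T i))
      (_ : ∀ i, DecidableEq (T i)) (u : ∀ i, T i → Q) (h : ι → Q),
      IsMF u h ∧ N (g - tot u) < ε ∧ ∀ i, L < Fintype.card (T i) := by
  classical
  obtain ⟨z, hz1, hz2, hz3, hz4⟩ := exists_nilp hG L g hg h0
  obtain ⟨M, a, b, hab⟩ := simple_span hG.simple _ hz4
  have hr := hG.rk.1
  have hzg : g * z ^ (L + 1) = z ^ (L + 1) := by rw [pow_succ', ← mul_assoc, hz1]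
  have hgz : z ^ (L + 1) * g = z ^ (L + 1) := by rw [pow_succ, mul_assoc, hz2]
  have hgs : g = ∑ l, (g * a l * g) * z ^ (L + 1) * b l * g := by
    calc g = g * 1 * g := by rw [mul_one, hg.2]
      _ = ∑ l, g * (a l * z ^ (L + 1) * b l) * g := by rw [hab, Finset.mul_sum, Finset.sum_mul]
      _ = _ := by
        refine Finset.sum_congr rfl fun l _ => ?_
        rw [mul_assoc (g * a l) g, hzg]; simp only [mul_assoc]
  obtain ⟨C, hC⟩ : ∃ C : ℝ, C = 3 + M * (2 * L + 5) := ⟨_, rfl⟩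
  have hCpos : 0 < C := by rw [hC]; positivity
  obtain ⟨δ, hδ⟩ : ∃ δ : ℝ, δ = ε / C := ⟨_, rfl⟩
  have hδ0 : 0 < δ := by rw [hδ]; positivity
  obtain ⟨ι, i1, i2, T, i3, i4, u, h, Y, hM, hN, hY⟩ := hLA δ hδ0 (M + 1)
    (Fin.cons z fun l => g * a l * g) (by
      intro j
      induction j using Fin.cases with
      | zero => exact ⟨hz1, hz2⟩
      | succ l =>
        simp only [Fin.cons_succ]
        exact ⟨by rw [← mul_assoc, ← mul_assoc, hg.2], by rw [mul_assoc, hg.2]⟩)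
  obtain ⟨E, hE⟩ : ∃ E : ∀ i, Matrix (T i) (T i) F,
      E = fun i => if Fintype.card (T i) ≤ L then 1 else 0 := ⟨_, rfl⟩
  have hEc : ∀ A : ∀ i, Matrix (T i) (T i) F, E * A = A * E := by
    intro A; funext i
    rw [Pi.mul_apply, Pi.mul_apply, hE]; dsimp only
    split_ifs <;> simp
  obtain ⟨X, hX⟩ : ∃ X, X = Y 0 := ⟨_, rfl⟩
  have hXz : N (z - mm u X) < δ := by rw [hX]; exact hY 0
  have hA : ∀ l : Fin M, N (g * a l * g - mm u (Y l.succ)) < δ := fun l => hY l.succ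
  have hfit : ∃ S : ∀ i, Matrix (T i) (T i) F, E * X ^ (L + 1) = E * (X ^ (L + 2) * S) := by
    have : ∀ i, ∃ S, E i * X i ^ (L + 1) = E i * (X i ^ (L + 2) * S) := by
      intro i
      rw [hE]; dsimp only
      split_ifs with hi
      · obtain ⟨S, hS⟩ := fitting (X i) (L + 1) (by omega)
        exact ⟨S, by rw [hS]⟩
      · exact ⟨0, by simp⟩
    choose S hS using this
    exact ⟨S, funext hS⟩
  obtain ⟨S, hS⟩ := hfit
  have h1 : N (mm u E * z ^ (L + 1)) ≤ (2 * L + 3) * δ := by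
    have e1 := prf_le_add hr (mm u E * z ^ (L + 1)) (mm u E * mm u X ^ (L + 1))
    rw [← mul_sub] at e1
    have e2 := (hr.mul_le_right (mm u E) (z ^ (L + 1) - mm u X ^ (L + 1))).trans
      (pow_close hr _ _ _)
    have e3 : N (mm u E * mm u X ^ (L + 1)) ≤ (L + 2) * δ := by
      rw [← hM.pow, ← hM.mul, hS, hM.mul, hM.mul, hM.pow]
      refine ((hr.mul_le_right _ _).trans (hr.mul_le_left _ _)).trans ?_
      have e4 := pow_close hr (mm u X) z (L + 2)
      rw [hz3, sub_zero, prf_sub_comm hr] at e4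
      push_cast at e4
      nlinarith
    push_cast at e2
    nlinarith
  have h2 : ∀ l, N (mm u E * ((g * a l * g) * z ^ (L + 1) * b l * g)) ≤ (2 * L + 4) * δ := by
    intro l
    have e0 : N (mm u E * ((g * a l * g) * z ^ (L + 1) * b l * g)) ≤
        N (mm u E * (g * a l * g) * z ^ (L + 1)) := by
      have : mm u E * ((g * a l * g) * z ^ (L + 1) * b l * g) =
        mm u E * (g * a l * g) * z ^ (L + 1) * (b l * g) := by simp only [mul_assoc]
      rw [this]; exact hr.mul_le_left _ _
    have e1 := prf_le_add hr (mm u E * (g * a l * g) * z ^ (L + 1))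
      (mm u E * mm u (Y l.succ) * z ^ (L + 1))
    rw [← sub_mul, ← mul_sub] at e1
    have e2 := prf_mul_mul_le hr (mm u E) (g * a l * g - mm u (Y l.succ)) (z ^ (L + 1))
    have e3 : N (mm u E * mm u (Y l.succ) * z ^ (L + 1)) ≤ N (mm u E * z ^ (L + 1)) := by
      rw [← hM.mul, hEc, hM.mul, mul_assoc]; exact hr.mul_le_right _ _
    have e4 := hA l
    nlinarith
  have h3 : N (mm u E) ≤ δ + M * ((2 * L + 4) * δ) := by
    have e1 := prf_le_add hr (mm u E) (mm u E * g)
    have e2 : mm u E - mm u E * g = mm u E * (tot u - g) := by rw [mul_sub, hM.map_tot]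
    rw [e2] at e1
    have e3 := hr.mul_le_right (mm u E) (tot u - g)
    rw [prf_sub_comm hr] at e3
    have e4 : N (mm u E * g) ≤ M * ((2 * L + 4) * δ) := by
      conv_lhs => rw [hgs, Finset.mul_sum]
      refine (prf_sum_le hr _ _).trans ((Finset.sum_le_sum fun l _ => h2 l).trans ?_)
      simp
    linarith
  have htot : tot u - mm u E = tot (ι := {i // ¬ Fintype.card (T i) ≤ L}) (fun i => u i.1) := by
    rw [tot, tot, mm, ← Finset.sum_sub_distrib]
    have : ∀ i, (∑ a, u i a * star (u i a)) - fm (u i) (E i) =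
        if ¬ Fintype.card (T i) ≤ L then ∑ a, u i a * star (u i a) else 0 := by
      intro i
      rw [hE]; dsimp only
      by_cases hi : Fintype.card (T i) ≤ L
      · rw [if_pos hi, if_neg (not_not.2 hi), fm_one, sub_self]
      · rw [if_neg hi, if_pos hi, fm_zero, sub_zero]
    rw [Finset.sum_congr rfl fun i _ => this i, ← Finset.sum_filter]
    exact Finset.sum_subtype _ (by simp) _
  refine ⟨{i // ¬ Fintype.card (T i) ≤ L}, inferInstance, inferInstance, fun i => T i.1,
    inferInstance, inferInstance, fun i => u i.1, fun i => h i.1,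
    ⟨fun i => hM.fr i.1, fun i j hij => hM.ho i.1 j.1 (fun h => hij (Subtype.ext h))⟩, ?_,
    fun i => not_le.1 i.2⟩
  rw [← htot]
  have e1 := hr.subadditive (g - tot u) (mm u E)
  have e2 : g - tot u + mm u E = g - (tot u - mm u E) := by abel
  rw [e2] at e1
  have e3 : C * δ = ε := by rw [hδ]; field_simp
  rw [hC] at e3
  have : (0:ℝ) ≤ M * δ := by positivity
  nlinarith

/-- merging of frames -/
lemma frame_merge {K : ℕ} {P : Type} [Fintype P] [DecidableEq P] (y : Fin K → P → Q) (b : P → Q)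
    (hb : ∀ s p, y s p * b p = y s p)
    (hy : ∀ s t p p', star (y s p) * y t p' = if s = t ∧ p = p' then b p else 0) (s0 : Fin K) :
    IsFrame (fun s => ∑ p, y s p * star (y s0 p)) (∑ p, y s0 p * star (y s0 p)) ∧
    ∑ s, (∑ p, y s p * star (y s0 p)) * star (∑ p, y s p * star (y s0 p)) =
      ∑ s, ∑ p, y s p * star (y s p) := by
  have hbs : ∀ s p, b p * star (y s p) = star (y s p) := by
    intro s p
    have e : star (y s p) * y s p = b p := by rw [hy]; simp
    have e2 : star (b p) = b p := by rw [← e]; simp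
    have := congrArg star (hb s p)
    rwa [star_mul, e2] at this
  have h1 : ∀ s t r r' : Fin K, (∑ p, y r p * star (y s p)) * (∑ p, y t p * star (y r' p)) =
      if s = t then ∑ p, y r p * star (y r' p) else 0 := by
    intro s t r r'
    rw [Finset.sum_mul_sum]
    have e : ∀ p, ∑ p', y r p * star (y s p) * (y t p' * star (y r' p')) =
        if s = t then y r p * star (y r' p) else 0 := by
      intro p
      rw [Finset.sum_eq_single p]
      · rw [mul_assoc, ← mul_assoc (star _), hy]
        split_ifs with h1 h2 h2
        · rw [← mul_assoc, hb]
        · exact absurd h1.1 h2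
        · exact absurd ⟨h2, rfl⟩ h1
        · simp
      · intro p' _ hp
        rw [mul_assoc, ← mul_assoc (star _), hy, if_neg (fun h => hp h.2.symm)]; simp
      · simp
    rw [Finset.sum_congr rfl fun p _ => e p]
    split_ifs <;> simp
  have hst : ∀ s r : Fin K, star (∑ p, y r p * star (y s p)) = ∑ p, y s p * star (y r p) := by
    intro s r; simp [star_sum]
  refine ⟨⟨⟨hst _ _, ?_⟩, fun s t => ?_, fun s => ?_⟩, ?_⟩
  · rw [h1, if_pos rfl]
  · rw [hst, h1]
  · rw [h1, if_pos rfl]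
  · refine Finset.sum_congr rfl fun s _ => ?_
    rw [hst, h1, if_pos rfl]

end P6

section P7
set_option linter.unusedSectionVars false
set_option linter.unusedSimpArgs false
set_option linter.unusedVariables false
variable {F : Type} [Field F] [StarRing F]
variable {Q : Type} [Ring Q] [Algebra F Q] [StarRing Q] [StarModule F Q] {N : Q → ℝ}

open Matrix

/-- cutting the base of a frame -/
lemma IsFrame.cut {T : Type} [Fintype T] [DecidableEq T] {u : T → Q} {h k : Q} (hf : IsFrame u h)
    (hk : IsProjection k) (hkh : ProjLE k h) : IsFrame (fun s => u s * k) k := by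
  refine ⟨hk, fun a b => ?_, fun a => by rw [mul_assoc, hk.2]⟩
  rw [star_mul, hk.1, mul_assoc, ← mul_assoc (star (u a)), hf.uu]
  split_ifs
  · rw [hkh.1, hk.2]
  · simp

lemma frame_cut (hG : Good Q N) {T : Type} [Fintype T] [DecidableEq T] {u : T → Q} {h : Q}
    (hf : IsFrame u h) (g : Q) (c : ℝ) (hc : ∀ s, N ((1 - g) * u s) ≤ c) :
    ∃ k, IsProjection k ∧ ProjLE k h ∧ IsFrame (fun s => u s * k) k ∧
      (∀ s, g * (u s * k) = u s * k) ∧ N (h - k) ≤ Fintype.card T * c ∧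
      N (∑ s, u s * star (u s) - ∑ s, (u s * k) * star (u s * k)) ≤
        Fintype.card T * (Fintype.card T * c) := by
  have hr := hG.rk.1
  obtain ⟨k, hk, hkh, h1, h2⟩ := annihil hG Finset.univ (fun s => (1 - g) * u s) h hf.proj
  have h3 : N (h - k) ≤ Fintype.card T * c := by
    refine h2.trans ?_
    calc _ ≤ ∑ s : T, c := Finset.sum_le_sum fun s _ => (hr.mul_le_left _ _).trans (hc s)
      _ = _ := by simp
  refine ⟨k, hk, hkh, hf.cut hk hkh, fun s => ?_, h3, ?_⟩
  · have := h1 s (Finset.mem_univ _)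
    rw [sub_mul, sub_mul, one_mul, sub_eq_zero, mul_assoc] at this
    exact this.symm
  · rw [← Finset.sum_sub_distrib]
    refine (prf_sum_le hr _ _).trans ?_
    calc _ ≤ ∑ s : T, (Fintype.card T * c : ℝ) := Finset.sum_le_sum fun s _ => ?_
      _ = _ := by simp
    have e : u s * star (u s) - u s * k * star (u s * k) = u s * (h - k) * star (u s) := by
      rw [star_mul, hk.1, mul_sub, sub_mul, hf.uh, ← mul_assoc, mul_assoc (u s) k k, hk.2]
    rw [e]
    exact (prf_mul_mul_le hr _ _ _).trans h3

lemma ad_of_la (hG : Good Q N) {g : Q} (hg : IsProjection g) (hLA : LA F N g) : AD N g := by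
  classical
  intro K ε hK hε
  have hr := hG.rk.1
  by_cases h0 : g = 0
  · subst h0
    exact ⟨fun _ => 0, 0, ⟨⟨by simp, by simp⟩, by simp, by simp⟩, by simp, by
      simpa [prf_zero hr] using hε⟩
  have hKr : (0:ℝ) < K := by exact_mod_cast hK
  obtain ⟨L, hL⟩ := exists_nat_gt (3 * K / ε)
  have hLpos : (0:ℝ) < L := lt_trans (by positivity) hL
  obtain ⟨ε₁, hε₁⟩ : ∃ x : ℝ, x = ε / (3 * (1 + K * K)) := ⟨_, rfl⟩
  have hε₁pos : 0 < ε₁ := by rw [hε₁]; positivity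
  have hε₁' : ε₁ * (1 + K * K) = ε / 3 := by rw [hε₁]; field_simp
  obtain ⟨ι, _, _, T, _, _, u, h, hM, h1, h2⟩ := large_blocks hG hg h0 hLA L ε₁ hε₁pos
  obtain ⟨d, hd⟩ : ∃ d : ι → ℕ, ∀ i, d i = Fintype.card (T i) / K := ⟨_, fun _ => rfl⟩
  have hf : ∀ i, Nonempty (Fin K × Fin (d i) ↪ T i) := fun i => by
    apply Function.Embedding.nonempty_of_card_le
    simp only [Fintype.card_prod, Fintype.card_fin, hd]
    exact Nat.mul_div_le _ _
  let f : ∀ i, Fin K × Fin (d i) ↪ T i := fun i => (hf i).some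
  have hMv : IsMF (T := fun i => Fin K × Fin (d i)) (fun i a => u i (f i a)) h :=
    ⟨fun i => (hM.fr i).reindex (f i), fun i j hij a b => hM.ho i j hij _ _⟩
  let y : Fin K → (Σ i, Fin (d i)) → Q := fun s p => u p.1 (f p.1 (s, p.2))
  have hyb : ∀ s p, y s p * h p.1 = y s p := fun s p => (hM.fr p.1).uh _
  have hyy : ∀ s t p p', star (y s p) * y t p' = if s = t ∧ p = p' then h p.1 else 0 := by
    rintro s t ⟨i, c⟩ ⟨j, c'⟩
    by_cases hij : i = j
    · subst hij
      refine ((hMv.fr i).uu (s, c) (t, c')).trans ?_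
      simp
    · rw [if_neg (by rintro ⟨-, h⟩; exact hij (congrArg Sigma.fst h))]
      exact hM.ho i j hij _ _
  obtain ⟨hfr, hsum⟩ := frame_merge y (fun p => h p.1) hyb hyy ⟨0, hK⟩
  obtain ⟨w, hw⟩ : ∃ w : Fin K → Q, w = fun s => ∑ p, y s p * star (y ⟨0, hK⟩ p) := ⟨_, rfl⟩
  obtain ⟨b, hb⟩ : ∃ b : Q, b = ∑ p, y ⟨0, hK⟩ p * star (y ⟨0, hK⟩ p) := ⟨_, rfl⟩
  rw [← hw, ← hb] at hfr
  have hsum' : ∑ s, w s * star (w s) = tot (T := fun i => Fin K × Fin (d i)) (fun i a => u i (f i a)) := by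
    rw [hw]; refine hsum.trans ?_
    rw [tot]
    simp only [Fintype.sum_sigma, Fintype.sum_prod_type]
    rw [Finset.sum_comm]
  -- error of the cut
  have hle : ProjLE (tot (T := fun i => Fin K × Fin (d i)) (fun i a => u i (f i a))) (tot u) := by
    refine projLE_of_left hM.tot_proj hMv.tot_proj ?_
    conv_lhs => rw [tot.eq_1 (fun i a => u i (f i a))]
    simp only [Finset.mul_sum, ← mul_assoc, hM.tot_u]
    rfl
  have hrk := proj_rank_sub hG hM.tot_proj hMv.tot_proj hle
  have hsmall : N (tot u - ∑ s, w s * star (w s)) ≤ K / L := by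
    rw [hsum', hrk, hM.tot_rank hG, hMv.tot_rank hG, ← Finset.sum_sub_distrib]
    have hle1 : (L:ℝ) * ∑ i, N (h i) ≤ 1 := by
      calc _ = ∑ i, (L:ℝ) * N (h i) := by rw [Finset.mul_sum]
        _ ≤ ∑ i, (Fintype.card (T i) : ℝ) * N (h i) := Finset.sum_le_sum fun i _ =>
            mul_le_mul_of_nonneg_right (by exact_mod_cast (h2 i).le) (hr.nonneg _)
        _ = N (tot u) := (hM.tot_rank hG).symm
        _ ≤ 1 := hr.le_one _
    calc _ ≤ ∑ i, (K:ℝ) * N (h i) := Finset.sum_le_sum fun i _ => ?_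
      _ = K * ∑ i, N (h i) := by rw [Finset.mul_sum]
      _ ≤ K / L := by
        rw [le_div_iff₀ hLpos, mul_assoc]
        calc (K:ℝ) * ((∑ i, N (h i)) * L) ≤ K * 1 := by
              apply mul_le_mul_of_nonneg_left _ hKr.le; linarith
          _ = K := mul_one _
    rw [← sub_mul]
    refine mul_le_mul_of_nonneg_right ?_ (hr.nonneg _)
    simp only [Fintype.card_prod, Fintype.card_fin, hd]
    have := Nat.lt_mul_div_succ (Fintype.card (T i)) hK
    have h' : (Fintype.card (T i) : ℝ) < K * (((Fintype.card (T i) / K : ℕ) : ℝ) + 1) := by exact_mod_cast this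
    push_cast
    linarith
  have htw : ∀ s, tot u * w s = w s := by
    intro s
    rw [hw]
    simp only [Finset.mul_sum, ← mul_assoc]
    exact Finset.sum_congr rfl fun p _ => by rw [hM.tot_u]
  obtain ⟨k, hk, hkh, hfk, h3, -, h4⟩ := frame_cut hG hfr g ε₁ (fun s => by
    have e : (1 - g) * w s = (tot u - g) * w s := by rw [sub_mul, sub_mul, htw, one_mul]
    rw [e]
    refine (hr.mul_le_left _ _).trans ?_
    rw [prf_sub_comm hr]; exact h1.le)
  refine ⟨_, k, hfk, h3, ?_⟩
  have t1 := prf_tri hr g (tot u) (∑ s, w s * star (w s))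
  have t2 := prf_tri hr g (∑ s, w s * star (w s)) (∑ s, w s * k * star (w s * k))
  have hKL : (K:ℝ) / L < ε / 3 := by
    rw [div_lt_iff₀ hε] at hL
    rw [div_lt_iff₀ hLpos]; linarith
  simp only [Fintype.card_fin] at h4
  nlinarith

end P7

section P8
set_option linter.unusedSectionVars false
set_option linter.unusedSimpArgs false
set_option linter.unusedVariables false
variable {F : Type} [Field F] [StarRing F]
variable {Q : Type} [Ring Q] [Algebra F Q] [StarRing Q] [StarModule F Q] {N : Q → ℝ}

open Matrix

lemma diag_split {n : Type} [Fintype n] [DecidableEq n] (P : Matrix n n F) (hd : P.IsDiag)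
    (hP : P * P = P) : ∃ (S : Type) (_ : Fintype S) (_ : DecidableEq S) (W : Matrix n S F),
      Wᴴ * W = 1 ∧ W * Wᴴ = P := by
  classical
  have hdd : ∀ a, P a a = 0 ∨ P a a = 1 := by
    intro a
    have := congrFun (congrFun hP a) a
    rw [Matrix.mul_apply, Finset.sum_eq_single a] at this
    · have h2 : P a a * (P a a - 1) = 0 := by rw [mul_sub, this]; ring
      rcases mul_eq_zero.1 h2 with h | h
      · exact Or.inl h
      · exact Or.inr (sub_eq_zero.1 h)
    · intro b _ hb; rw [hd hb.symm, zero_mul]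
    · simp
  refine ⟨{a : n // P a a = 1}, inferInstance, inferInstance,
    Matrix.of fun t s => if t = s.1 then 1 else 0, ?_, ?_⟩
  · ext a b
    rw [Matrix.mul_apply, Finset.sum_eq_single a.1]
    · simp [Matrix.one_apply, Subtype.ext_iff]
    · intro t _ ht; simp [ht]
    · simp
  · ext a b
    rw [Matrix.mul_apply]
    rcases hdd a with h | h
    · rw [Finset.sum_eq_zero]
      · by_cases hab : a = b
        · subst hab; exact h.symm
        · exact (hd hab).symm
      · rintro ⟨s, hs⟩ -
        have : a ≠ s := by rintro rfl; rw [h] at hs; exact zero_ne_one hs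
        simp [this]
    · rw [Finset.sum_eq_single ⟨a, h⟩]
      · by_cases hab : a = b
        · subst hab; simp [h]
        · have : b ≠ a := fun h => hab h.symm
          simp [this, hd hab]
      · rintro ⟨s, hs⟩ _ hne
        have : a ≠ s := by rintro rfl; exact hne rfl
        simp [this]
      · simp

/-- homomorphism-form of local approximation -/
def H1 (F : Type) [Field F] [StarRing F] [Algebra F Q] (N : Q → ℝ) (g : Q) : Prop :=
  ∀ δ : ℝ, 0 < δ → ∀ (m : ℕ) (x : Fin m → Q),
    ∃ (k : ℕ) (n : Fin k → ℕ) (_ : ∀ i, 0 < n i)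
      (Ψ : (∀ i, Matrix (Fin (n i)) (Fin (n i)) F) →⋆ₐ[F] Q)
      (Y : Fin m → ∀ i, Matrix (Fin (n i)) (Fin (n i)) F)
      (ω e : ∀ i, Matrix (Fin (n i)) (Fin (n i)) F),
      (∀ i, (e i).IsDiag) ∧ IsProjection e ∧ star ω * ω = e ∧
        N (g - Ψ (ω * star ω)) < δ ∧ ∀ j, N (x j - Ψ (Y j)) < δ

lemma la_of_h1 (hG : Good Q N) {g : Q} (h1 : H1 F N g) : LA F N g := by
  classical
  have hr := hG.rk.1
  intro δ hδ m x hx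
  obtain ⟨k, n, hn, Ψ, Y, ω, e, hd, he, hω, hg, hY⟩ := h1 (δ / 4) (by linarith) m x
  obtain ⟨hM, hmap⟩ := mf_of_hom hn Ψ
  obtain ⟨u, hu⟩ : ∃ u : ∀ i, Fin (n i) → Q, u = fun i a => Ψ (Pi.single i (Matrix.single a ⟨0, hn i⟩ 1)) :=
    ⟨_, rfl⟩
  rw [← hu] at hM hmap
  choose S i1 i2 W hW1 hW2 using fun i => diag_split (e i) (hd i) (congrFun he.2 i)
  have hM2 := hM.change W hW1
  obtain ⟨v, hv⟩ : ∃ v : ∀ i, S i → Q, v = fun i s => ∑ t, W i t s • u i t := ⟨_, rfl⟩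
  have htot : tot v = Ψ e := by
    rw [hv, tot_change, ← hmap]; congr 1; funext i; exact hW2 i
  have hmm : ∀ Z : ∀ i, Matrix (Fin (n i)) (Fin (n i)) F,
      mm v (fun i => (W i)ᴴ * Z i * W i) = Ψ (e * Z * e) := by
    intro Z
    rw [hv, mm_change, ← hmap]; congr 1; funext i
    rw [Pi.mul_apply, Pi.mul_apply, ← hW2 i]
    simp only [Matrix.mul_assoc]
  rw [← hv] at hM2
  have hvv : star (Ψ ω) * Ψ ω = Ψ e := by rw [← map_star, ← map_mul, hω]
  have hpi : Ψ ω * Ψ e = Ψ ω := by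
    have h0 : IsProjection (star (Ψ ω) * star (star (Ψ ω))) := by
      rw [star_star, hvv]; exact ⟨by rw [← map_star, he.1], by rw [← map_mul, he.2]⟩
    have h2 := congrArg star (pi_of_proj hG.proper h0)
    simp only [star_mul, star_star] at h2
    rwa [hvv] at h2
  have hM3 := hM2.lmul hvv (fun i a => by rw [← htot]; exact hM2.tot_u i a)
  obtain ⟨q, hq⟩ : ∃ q, q = Ψ (ω * star ω) := ⟨_, rfl⟩
  have hpi2 : Ψ e * star (Ψ ω) = star (Ψ ω) := by
    have := congrArg star hpi
    rwa [star_mul, ← map_star Ψ e, he.1] at this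
  refine ⟨Fin k, inferInstance, inferInstance, S, i1, i2, _, _,
    fun j i => (W i)ᴴ * (star ω * Y j * ω) i * W i, hM3, ?_, fun j => ?_⟩
  · rw [tot_lmul, htot, hpi, ← map_star, ← map_mul]; linarith
  · rw [mm_lmul, hmm]
    have e1 : Ψ ω * Ψ (e * (star ω * Y j * ω) * e) * star (Ψ ω) = q * Ψ (Y j) * q := by
      rw [hq]
      simp only [map_mul, map_star, ← mul_assoc]
      rw [hpi, mul_assoc _ (Ψ e), hpi2]
    rw [e1]
    rw [← hq] at hg
    have e2 : x j - q * Ψ (Y j) * q = (g - q) * x j + (q * (x j - Ψ (Y j)) * 1 * g + q * Ψ (Y j) * (g - q)) := by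
      have := hx j
      calc _ = g * x j * g - q * Ψ (Y j) * q := by rw [this.1, this.2]
        _ = (g - q) * (x j * g) + (q * (x j - Ψ (Y j)) * 1 * g + q * Ψ (Y j) * (g - q)) := by noncomm_ring
        _ = _ := by rw [this.2]
    rw [e2]
    have s1 := hr.subadditive ((g - q) * x j) (q * (x j - Ψ (Y j)) * 1 * g + q * Ψ (Y j) * (g - q))
    have s2 := hr.subadditive (q * (x j - Ψ (Y j)) * 1 * g) (q * Ψ (Y j) * (g - q))
    have s3 := hr.mul_le_left (g - q) (x j)
    have s4 := hr.mul_le_right (q * Ψ (Y j)) (g - q)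
    have s5 := prf_mul_mul_le hr q (x j - Ψ (Y j)) (1 * g)
    rw [← mul_assoc] at s5
    have := hY j
    linarith

/-- dyadic-divisible local approximation -/
def DL (F : Type) [Field F] [Algebra F Q] (N : Q → ℝ) : Prop :=
  ∀ δ : ℝ, 0 < δ → ∀ (m : ℕ) (x : Fin m → Q),
    ∃ (k κ : ℕ) (n : Fin k → ℕ) (u : ∀ i, Fin (n i) × Fin (2 ^ κ) → Q) (h : Fin k → Q)
      (Y : Fin m → ∀ i, Matrix (Fin (n i)) (Fin (n i)) F),
      IsMF u h ∧ (∀ i, n i ≤ 2 ^ κ) ∧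
        ∀ j, N (x j - mm u (fun i => Y j i ⊗ₖ (1 : Matrix (Fin (2 ^ κ)) (Fin (2 ^ κ)) F))) < δ

/-- existence of homomorphisms with approximately divisible diagonal matrix units -/
lemma dl_of_ad (hG : Good Q N)
    (hyp : ∀ δ : ℝ, 0 < δ → ∀ (m : ℕ) (x : Fin m → Q), ∃ (k : ℕ) (n : Fin k → ℕ) (hn : ∀ i, 0 < n i)
      (Ψ : (∀ i, Matrix (Fin (n i)) (Fin (n i)) F) →⋆ₐ[F] Q)
      (Y : Fin m → ∀ i, Matrix (Fin (n i)) (Fin (n i)) F),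
      (∀ j, N (x j - Ψ (Y j)) < δ) ∧
      ∀ i, AD N (Ψ (Pi.single i (Matrix.single ⟨0, hn i⟩ ⟨0, hn i⟩ 1)))) : DL F N := by
  classical
  have hr := hG.rk.1
  intro δ hδ m x
  obtain ⟨k, n, hn, Ψ, Y, hY, hAD⟩ := hyp (δ / 2) (by linarith) m x
  obtain ⟨hM, hmap⟩ := mf_of_hom hn Ψ
  obtain ⟨u, hu⟩ : ∃ u : ∀ i, Fin (n i) → Q, u = fun i a => Ψ (Pi.single i (Matrix.single a ⟨0, hn i⟩ 1)) :=
    ⟨_, rfl⟩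
  rw [← hu] at hM hmap
  obtain ⟨h, hh⟩ : ∃ h : Fin k → Q, h = fun i => Ψ (Pi.single i (Matrix.single ⟨0, hn i⟩ ⟨0, hn i⟩ 1)) :=
    ⟨_, rfl⟩
  rw [← hh] at hM
  have hAD' : ∀ i, AD N (h i) := fun i => by rw [hh]; exact hAD i
  obtain ⟨M, hMM⟩ : ∃ M : ℕ, M = ∑ i, n i := ⟨_, rfl⟩
  have hle : ∀ i, n i ≤ 2 ^ M := fun i =>
    ((Finset.single_le_sum (f := n) (fun _ _ => Nat.zero_le _) (Finset.mem_univ i)).trans hMM.ge).trans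
      Nat.lt_two_pow_self.le
  choose w b hw hhw hsm using fun i => hAD' i (2 ^ M) (δ / (2 * (M + 1))) (by positivity) (by positivity)
  refine ⟨k, M, n, _, _, Y, hM.refine hw hhw, hle, fun j => ?_⟩
  rw [hM.refine_map hw hhw]
  obtain ⟨q, hq⟩ : ∃ q, q = tot (fun i (p : Fin (n i) × Fin (2 ^ M)) => u i p.1 * w i p.2) := ⟨_, rfl⟩
  rw [← hq]
  have hsmall : N (tot u - q) ≤ δ / 2 := by
    have e : tot u - q = ∑ i, ∑ a, u i a * (h i - ∑ s, w i s * star (w i s)) * star (u i a) := by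
      rw [hq, tot, tot, ← Finset.sum_sub_distrib]
      refine Finset.sum_congr rfl fun i _ => ?_
      rw [Fintype.sum_prod_type, ← Finset.sum_sub_distrib]
      refine Finset.sum_congr rfl fun a _ => ?_
      rw [mul_sub, sub_mul, (hM.fr i).uh]
      congr 1
      simp only [Finset.mul_sum, Finset.sum_mul, star_mul, mul_assoc]
    rw [e]
    calc _ ≤ ∑ i, ∑ a : Fin (n i), δ / (2 * (M + 1)) := by
          refine (prf_sum_le hr _ _).trans (Finset.sum_le_sum fun i _ => ?_)
          refine (prf_sum_le hr _ _).trans (Finset.sum_le_sum fun a _ => ?_)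
          exact (prf_mul_mul_le hr _ _ _).trans (hsm i).le
      _ = M * (δ / (2 * (M + 1))) := by
          simp only [Finset.sum_const, Finset.card_univ, Fintype.card_fin, nsmul_eq_mul]
          rw [← Finset.sum_mul, hMM]; push_cast; rfl
      _ ≤ δ / 2 := by
          rw [← mul_div_assoc, div_le_div_iff₀ (by positivity) (by positivity)]
          nlinarith
  have e : x j - mm u (Y j) * q = (x j - Ψ (Y j)) + mm u (Y j) * (tot u - q) := by
    rw [mul_sub, hM.map_tot, hmap]; noncomm_ring
  rw [e]
  have s1 := hr.subadditive (x j - Ψ (Y j)) (mm u (Y j) * (tot u - q))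
  have s2 := hr.mul_le_right (mm u (Y j)) (tot u - q)
  have := hY j
  linarith

end P8

section P9
set_option linter.unusedSectionVars false
set_option linter.unusedSimpArgs false
set_option linter.unusedVariables false
variable {F : Type} [Field F] [StarRing F]
variable {Q : Type} [Ring Q] [Algebra F Q] [StarRing Q] [StarModule F Q] {N : Q → ℝ}

open Matrix

lemma kron_mul {n p : Type} [Fintype n] [DecidableEq n] [Fintype p] [DecidableEq p] (A B : Matrix n n F) :
    (A ⊗ₖ (1 : Matrix p p F)) * (B ⊗ₖ (1 : Matrix p p F)) = (A * B) ⊗ₖ (1 : Matrix p p F) := by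
  rw [← Matrix.mul_kronecker_mul, Matrix.one_mul]

lemma kron_star {n p : Type} [Fintype n] [DecidableEq n] [Fintype p] [DecidableEq p] (A : Matrix n n F) :
    star (A ⊗ₖ (1 : Matrix p p F)) = (star A) ⊗ₖ (1 : Matrix p p F) := by
  rw [Matrix.star_eq_conjTranspose, Matrix.conjTranspose_kronecker, Matrix.conjTranspose_one]; rfl

section
variable {ι : Type} [Fintype ι] [DecidableEq ι] {n : ι → ℕ} {κ : ℕ}
  {u : ∀ i, Fin (n i) × Fin (2 ^ κ) → Q} {h : ι → Q}

lemma lp_mm (hM : IsMF u h) (Y P : ∀ i, Matrix (Fin (n i)) (Fin (n i)) F)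
    (hP : ∀ i, IsLeftProjOf (Y i) (P i)) :
    IsLeftProjOf (mm u (fun i => Y i ⊗ₖ (1 : Matrix (Fin (2 ^ κ)) (Fin (2 ^ κ)) F)))
      (mm u (fun i => P i ⊗ₖ (1 : Matrix (Fin (2 ^ κ)) (Fin (2 ^ κ)) F))) := by
  choose t ht using fun i => (hP i).2.2
  refine ⟨⟨?_, ?_⟩, ?_, mm u (fun i => t i ⊗ₖ 1), ?_⟩
  · rw [mm_star]; congr 1; funext i
    rw [Pi.star_apply, kron_star, (hP i).1.1]
  · rw [← hM.mul]; congr 1; funext i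
    rw [Pi.mul_apply, kron_mul, (hP i).1.2]
  · rw [← hM.mul]; congr 1; funext i
    rw [Pi.mul_apply, kron_mul, (hP i).2.1]
  · rw [← hM.mul]; congr 1; funext i
    rw [Pi.mul_apply, kron_mul, ← ht]

lemma rp_mm (hM : IsMF u h) (Y P : ∀ i, Matrix (Fin (n i)) (Fin (n i)) F)
    (hP : ∀ i, IsRightProjOf (Y i) (P i)) :
    IsRightProjOf (mm u (fun i => Y i ⊗ₖ (1 : Matrix (Fin (2 ^ κ)) (Fin (2 ^ κ)) F)))
      (mm u (fun i => P i ⊗ₖ (1 : Matrix (Fin (2 ^ κ)) (Fin (2 ^ κ)) F))) := by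
  choose t ht using fun i => (hP i).2.2
  refine ⟨⟨?_, ?_⟩, ?_, mm u (fun i => t i ⊗ₖ 1), ?_⟩
  · rw [mm_star]; congr 1; funext i
    rw [Pi.star_apply, kron_star, (hP i).1.1]
  · rw [← hM.mul]; congr 1; funext i
    rw [Pi.mul_apply, kron_mul, (hP i).1.2]
  · rw [← hM.mul]; congr 1; funext i
    rw [Pi.mul_apply, kron_mul, (hP i).2.1]
  · rw [← hM.mul]; congr 1; funext i
    rw [Pi.mul_apply, kron_mul, ← ht]
end

lemma lp_rk {n : Type} [Fintype n] [DecidableEq n] {Y P : Matrix n n F} (h : IsLeftProjOf Y P) :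
    P.rank = Y.rank := by
  obtain ⟨_, h1, y, h2⟩ := h
  apply le_antisymm
  · rw [h2]; exact Matrix.rank_mul_le_left _ _
  · conv_lhs => rw [← h1]
    exact Matrix.rank_mul_le_left _ _

lemma rp_rk {n : Type} [Fintype n] [DecidableEq n] {Y P : Matrix n n F} (h : IsRightProjOf Y P) :
    P.rank = Y.rank := by
  obtain ⟨_, h1, y, h2⟩ := h
  apply le_antisymm
  · rw [h2]; exact Matrix.rank_mul_le_right _ _
  · conv_lhs => rw [← h1]
    exact Matrix.rank_mul_le_right _ _

/-- equal rank projections are star-equivalent after tensoring -/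
lemma proj_equiv (hF : PosDefStar F) (k : ℕ) {n : Type} [Fintype n] [DecidableEq n]
    (hn : Fintype.card n ≤ 2 ^ k) (P R : Matrix n n F) (hP : IsProjection P) (hR : IsProjection R)
    (hrk : P.rank = R.rank) :
    ∃ A : Matrix (n × Fin (2 ^ k)) (n × Fin (2 ^ k)) F,
      A * star A = P ⊗ₖ (1 : Matrix (Fin (2 ^ k)) (Fin (2 ^ k)) F) ∧
      star A * A = R ⊗ₖ (1 : Matrix (Fin (2 ^ k)) (Fin (2 ^ k)) F) := by
  obtain ⟨W, h1, h2⟩ := proj_split hF k hn P hP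
  obtain ⟨V, h3, h4⟩ := hrk ▸ proj_split hF k hn R hR
  refine ⟨W * Vᴴ, ?_, ?_⟩
  · rw [Matrix.star_eq_conjTranspose, Matrix.conjTranspose_mul, Matrix.conjTranspose_conjTranspose,
      Matrix.mul_assoc, ← Matrix.mul_assoc Vᴴ, h3, Matrix.one_mul, h2]
  · rw [Matrix.star_eq_conjTranspose, Matrix.conjTranspose_mul, Matrix.conjTranspose_conjTranspose,
      Matrix.mul_assoc, ← Matrix.mul_assoc Wᴴ, h1, Matrix.one_mul, h4]

lemma h1_of_dl (hF : PosDefStar F) (hG : Good Q N) (hDL : DL F N) :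
    ∀ p₁ p₂ : Q, IsProjection p₁ → IsProjection p₂ → p₁ ≠ 0 → p₂ ≠ 0 →
      ∃ v, v ≠ 0 ∧ p₁ * v = v ∧ v * p₂ = v ∧ v * star v * v = v := by
  intro p₁ p₂ hp₁ hp₂ h1 h2
  have hr := hG.rk.1
  have : ∃ r, p₁ * r * p₂ ≠ 0 := by
    by_contra h; push Not at h
    rcases simple_prime hG.simple _ _ h with h | h
    · exact h1 h
    · exact h2 h
  obtain ⟨r, hr0⟩ := this
  obtain ⟨z, hz⟩ : ∃ z, z = p₁ * r * p₂ := ⟨_, rfl⟩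
  rw [← hz] at hr0
  have hpz : p₁ * z = z := by rw [hz, ← mul_assoc, ← mul_assoc, hp₁.2]
  have hzp : z * p₂ = z := by rw [hz, mul_assoc, hp₂.2]
  have hNz : 0 < N z := lt_of_le_of_ne (hr.nonneg z) fun h => hr0 (hG.rk.2 z h.symm)
  obtain ⟨k, κ, n, u, h, Y', hM, hn, hY⟩ := hDL (N z / 6) (by linarith) 1 (fun _ => z)
  obtain ⟨Y, hYY⟩ : ∃ Y, Y = Y' 0 := ⟨_, rfl⟩
  have hY0 := hY 0
  rw [← hYY] at hY0
  choose P hP using fun i => lp_exists (matrix_regular _) (matrix_proper hF _) (Y i)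
  choose R hR using fun i => rp_exists (matrix_regular _) (matrix_proper hF _) (Y i)
  choose A hA1 hA2 using fun i => proj_equiv hF κ (n := Fin (n i)) (by simpa using hn i) (P i) (R i)
    (hP i).1 (hR i).1 ((lp_rk (hP i)).trans (rp_rk (hR i)).symm)
  have hL := lp_mm hM Y P hP
  have hRR := rp_mm hM Y R hR
  obtain ⟨y, hy⟩ : ∃ y, y = mm u (fun i => Y i ⊗ₖ (1 : Matrix (Fin (2 ^ κ)) (Fin (2 ^ κ)) F)) := ⟨_, rfl⟩
  obtain ⟨e', he'⟩ : ∃ y, y = mm u (fun i => P i ⊗ₖ (1 : Matrix (Fin (2 ^ κ)) (Fin (2 ^ κ)) F)) := ⟨_, rfl⟩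
  obtain ⟨f', hf'⟩ : ∃ y, y = mm u (fun i => R i ⊗ₖ (1 : Matrix (Fin (2 ^ κ)) (Fin (2 ^ κ)) F)) := ⟨_, rfl⟩
  rw [← hy] at hL hRR hY0
  rw [← he'] at hL
  rw [← hf'] at hRR
  obtain ⟨a, ha⟩ : ∃ a, a = mm u A := ⟨_, rfl⟩
  have haa : a * star a = e' := by
    rw [ha, mm_star, ← hM.mul, he']; congr 1; funext i; exact hA1 i
  have haa' : star a * a = f' := by
    rw [ha, mm_star, ← hM.mul, hf']; congr 1; funext i; exact hA2 i
  have hea : e' * a = a := by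
    rw [← haa]; exact pi_of_proj hG.proper (by rw [haa]; exact hL.1)
  obtain ⟨e, he⟩ := lp_exists hG.reg hG.proper z
  obtain ⟨f, hf⟩ := rp_exists hG.reg hG.proper z
  have hee := lp_close hG he hL
  have hff := rp_close hG hf hRR
  have hpe : p₁ * e = e := by obtain ⟨t, ht⟩ := he.2.2; rw [ht, ← mul_assoc, hpz]
  have hpf : p₂ * f = f := by
    obtain ⟨t, ht⟩ := hf.2.2
    have : f * p₂ = f := by rw [ht, mul_assoc, hzp]
    have := congrArg star this
    rwa [star_mul, hp₂.1, hf.1.1] at this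
  obtain ⟨k', hk, hkf, hk1, hk2⟩ := annihil hG Finset.univ
    (fun b : Bool => if b then (1 - p₁) * a else 1 - p₂) f' hRR.1
  have c1 := hk1 true (Finset.mem_univ _)
  have c2 := hk1 false (Finset.mem_univ _)
  simp only [if_true, Bool.false_eq_true, if_false] at c1 c2
  rw [Fintype.sum_bool] at hk2
  simp only [if_true, Bool.false_eq_true, if_false] at hk2
  have b1 : N ((1 - p₁) * a * f') ≤ 2 * N (z - y) := by
    refine (hr.mul_le_left _ _).trans ?_
    have : (1 - p₁) * a = (1 - p₁) * (e' - e) * a := by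
      have h0 : (1 - p₁) * e = 0 := by rw [sub_mul, one_mul, hpe, sub_self]
      rw [mul_sub, h0, sub_zero, mul_assoc, hea]
    rw [this]
    refine (prf_mul_mul_le hr _ _ _).trans ?_
    rw [prf_sub_comm hr]; exact hee
  have b2 : N ((1 - p₂) * f') ≤ 2 * N (z - y) := by
    have : (1 - p₂) * f' = (1 - p₂) * (f' - f) := by
      have h0 : (1 - p₂) * f = 0 := by rw [sub_mul, one_mul, hpf, sub_self]
      rw [mul_sub, h0, sub_zero]
    rw [this]
    refine (hr.mul_le_right _ _).trans ?_
    rw [prf_sub_comm hr]; exact hff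
  have hv : star (a * k') * (a * k') = k' := by
    rw [star_mul, mul_assoc, ← mul_assoc (star a), haa', hk.1, hkf.1, hk.2]
  refine ⟨a * k', ?_, ?_, ?_, ?_⟩
  · intro h0
    rw [h0, mul_zero] at hv
    rw [← hv, sub_zero] at hk2
    have := rp_rank hr hRR
    have := prf_le_add hr z y
    linarith
  · rw [sub_mul, sub_mul, one_mul, sub_eq_zero] at c1; rw [← mul_assoc]; exact c1.symm
  · rw [sub_mul, one_mul, sub_eq_zero] at c2
    have := congrArg star c2
    rw [star_mul, hk.1, hp₂.1] at this
    rw [mul_assoc, ← this]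
  · rw [mul_assoc (a * k'), hv, mul_assoc, hk.2]

lemma la_of_dl (hF : PosDefStar F) (hG : Good Q N) (hDL : DL F N) (g : Q) (hg : IsProjection g) :
    LA F N g := by
  have hr := hG.rk.1
  intro δ hδ m x hx
  obtain ⟨k, κ, n, u, h, Y, hM, hn, hY⟩ := hDL (δ / 6) (by linarith) (m + 1) (Fin.cons g x)
  have hg0 := hY 0
  rw [Fin.cons_zero] at hg0
  choose P hP using fun i => lp_exists (matrix_regular _) (matrix_proper hF _) (Y 0 i)
  have hL := lp_mm hM (Y 0) P hP
  have hgg : IsLeftProjOf g g := ⟨hg, hg.2, 1, (mul_one g).symm⟩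
  have hc := lp_close hG hgg hL
  obtain ⟨q, hq⟩ : ∃ y, y = mm u (fun i => P i ⊗ₖ (1 : Matrix (Fin (2 ^ κ)) (Fin (2 ^ κ)) F)) := ⟨_, rfl⟩
  rw [← hq] at hc hL
  choose W hW1 hW2 using fun i => proj_split hF κ (n := Fin (n i)) (by simpa using hn i) (P i) (hP i).1
  have hM2 := hM.change W hW1
  refine ⟨Fin k, inferInstance, inferInstance, _, inferInstance, inferInstance, _, _,
    fun j i => (W i)ᴴ * (Y j.succ i ⊗ₖ (1 : Matrix (Fin (2 ^ κ)) (Fin (2 ^ κ)) F)) * W i, hM2, ?_, fun j => ?_⟩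
  · rw [tot_change]
    have : mm u (fun i => W i * (W i)ᴴ) = q := by rw [hq]; congr 1; funext i; exact hW2 i
    rw [this]; linarith
  · rw [mm_change]
    have hYj := hY j.succ
    rw [Fin.cons_succ] at hYj
    obtain ⟨y, hy⟩ : ∃ y, y = mm u (fun i => Y j.succ i ⊗ₖ (1 : Matrix (Fin (2 ^ κ)) (Fin (2 ^ κ)) F)) := ⟨_, rfl⟩
    rw [← hy] at hYj
    have e1 : mm u (fun i => W i * ((W i)ᴴ * (Y j.succ i ⊗ₖ (1 : Matrix (Fin (2 ^ κ)) (Fin (2 ^ κ)) F)) * W i) * (W i)ᴴ) = q * y * q := by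
      rw [hq, hy, ← hM.mul, ← hM.mul]; congr 1; funext i
      rw [Pi.mul_apply, Pi.mul_apply, ← hW2]
      simp only [Matrix.mul_assoc]
    rw [e1]
    have e2 : x j - q * y * q = (g - q) * x j + (q * (x j - y) * 1 * g + q * y * (g - q)) := by
      have := hx j
      calc _ = g * x j * g - q * y * q := by rw [this.1, this.2]
        _ = (g - q) * (x j * g) + (q * (x j - y) * 1 * g + q * y * (g - q)) := by noncomm_ring
        _ = _ := by rw [this.2]
    rw [e2]
    have s1 := hr.subadditive ((g - q) * x j) (q * (x j - y) * 1 * g + q * y * (g - q))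
    have s2 := hr.subadditive (q * (x j - y) * 1 * g) (q * y * (g - q))
    have s3 := hr.mul_le_left (g - q) (x j)
    have s4 := hr.mul_le_right (q * y) (g - q)
    have s5 := prf_mul_mul_le hr q (x j - y) (1 * g)
    rw [← mul_assoc] at s5
    linarith

end P9

section P10
set_option linter.unusedSectionVars false
set_option linter.unusedSimpArgs false
set_option linter.unusedVariables false
variable {F : Type} [Field F] [StarRing F]
variable {Q : Type} [Ring Q] [Algebra F Q] [StarRing Q] [StarModule F Q] {N : Q → ℝ}

open Matrix

/-- star-comparability by rank -/
def Cmp (N : Q → ℝ) : Prop := ∀ e f : Q, IsProjection e → IsProjection f → N e ≤ N f →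
  ∃ w, w * star w = e ∧ w * f = w

lemma chop (hG : Good Q N) (hC : Cmp N) (d : ℕ) : ∀ (r h : Q), IsProjection r → IsProjection h →
    d * N h ≤ N r → ∃ w : Fin d → Q, IsFrame w h ∧ ∀ s, r * w s = w s := by
  induction d with
  | zero => intro r h hr hh _; exact ⟨fun _ => 0, ⟨hh, fun a => a.elim0, fun a => a.elim0⟩, by simp⟩
  | succ d ih =>
    intro r h hr hh hle
    have hn := hG.rk.1.nonneg h
    push_cast at hle
    have hd : (0:ℝ) ≤ d * N h := by positivity
    obtain ⟨w, hw1, hw2⟩ := hC h r hh hr (by linarith)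
    have hpi : w * star w * w = w := pi_of_proj hG.proper (by rw [hw1]; exact hh)
    have hvr : r * star w = star w := by
      have := congrArg star hw2; rwa [star_mul, hr.1] at this
    have hvh : star w * h = star w := by
      rw [hw1] at hpi
      have := congrArg star hpi; rwa [star_mul, hh.1] at this
    have hp := (pi_proj hpi).2
    have hle2 : ProjLE (star w * w) r := projLE_of_left hr hp (by rw [← mul_assoc, hvr])
    obtain ⟨hr', -, h3, h4⟩ := proj_sub hr hp hle2
    have h5 := proj_rank_sub hG hr hp hle2
    have h6 : N (star w * w) = N h := by
      have := pi_rank hG hpi; rw [this.2, ← this.1, hw1]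
    obtain ⟨w', hw', hw3⟩ := ih (r - star w * w) h hr' hh (by rw [h5, h6]; linarith)
    have hwr : w * (r - star w * w) = 0 := by rw [mul_sub, hw2, ← mul_assoc, hpi, sub_self]
    have ho : ∀ s, w * w' s = 0 := fun s => by rw [← hw3 s, ← mul_assoc, hwr, zero_mul]
    have ho' : ∀ s, star (w' s) * star w = 0 := fun s => by rw [← star_mul, ho, star_zero]
    refine ⟨Fin.cons (star w) w', ⟨hh, fun a b => ?_, fun a => ?_⟩, fun a => ?_⟩
    · refine Fin.cases ?_ (fun a => ?_) a <;> refine Fin.cases ?_ (fun b => ?_) b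
      · simp [hw1]
      · rw [Fin.cons_zero, Fin.cons_succ, star_star, ho, if_neg (Fin.succ_ne_zero b).symm]
      · rw [Fin.cons_zero, Fin.cons_succ, ho', if_neg (Fin.succ_ne_zero a)]
      · rw [Fin.cons_succ, Fin.cons_succ, hw'.uu]; simp [Fin.succ_inj]
    · refine Fin.cases ?_ (fun a => ?_) a
      · simp [hvh]
      · simp [hw'.uh]
    · refine Fin.cases ?_ (fun a => ?_) a
      · simp [hvr]
      · rw [Fin.cons_succ]
        conv_lhs => rw [← hw3 a, ← mul_assoc]
        rw [mul_sub, hr.2, hle2.1, hw3]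

lemma sigma_frame {ι : Type} [Fintype ι] [DecidableEq ι] {T : ι → Type} [∀ i, Fintype (T i)]
    [∀ i, DecidableEq (T i)] {u : ∀ i, T i → Q} {b : Q} (hM : IsMF u (fun _ => b)) (hb : IsProjection b) :
    IsFrame (fun p : Σ i, T i => u p.1 p.2) b ∧
    (∀ Z : ∀ i, Matrix (T i) (T i) F, fm (fun p : Σ i, T i => u p.1 p.2) (blockDiagonal' Z) = mm u Z) ∧
    ∑ p : (Σ i, T i), u p.1 p.2 * star (u p.1 p.2) = tot u := by
  refine ⟨⟨hb, ?_, fun p => (hM.fr p.1).uh p.2⟩, fun Z => ?_, ?_⟩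
  · rintro ⟨i, a⟩ ⟨j, c⟩
    by_cases hij : i = j
    · subst hij
      refine ((hM.fr i).uu a c).trans ?_
      simp
    · rw [if_neg (by rintro h; exact hij (congrArg Sigma.fst h))]
      exact hM.ho i j hij _ _
  · simp only [fm, mm, Fintype.sum_sigma]
    refine Finset.sum_congr rfl fun i _ => Finset.sum_congr rfl fun a _ => ?_
    rw [Finset.sum_eq_single i]
    · refine Finset.sum_congr rfl fun c _ => by rw [blockDiagonal'_apply_eq]
    · intro j _ hj
      refine Finset.sum_eq_zero fun c _ => by rw [blockDiagonal'_apply_ne _ _ _ hj.symm, zero_smul]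
    · simp
  · rw [tot, Fintype.sum_sigma]

lemma sum_frame {T S : Type} [Fintype T] [DecidableEq T] [Fintype S] [DecidableEq S] {v : T → Q}
    {w : S → Q} {b : Q} (hv : IsFrame v b) (hw : IsFrame w b) (ho : ∀ t s, star (v t) * w s = 0) :
    IsFrame (Sum.elim v w) b ∧
    (∀ Z : Matrix T T F, fm (Sum.elim v w) (fromBlocks Z 0 0 0) = fm v Z) := by
  have ho' : ∀ t s, star (w s) * v t = 0 := fun t s => by
    have := congrArg star (ho t s); simpa using this
  refine ⟨⟨hv.proj, ?_, ?_⟩, fun Z => ?_⟩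
  · rintro (a | a) (c | c)
    · simp [hv.uu]
    · simp [ho]
    · simp [ho']
    · simp [hw.uu]
  · rintro (a | a)
    · simp [hv.uh]
    · simp [hw.uh]
  · simp [fm, Fintype.sum_sum_type]

lemma frame_rank (hG : Good Q N) {T : Type} [Fintype T] [DecidableEq T] {v : T → Q} {b : Q}
    (hv : IsFrame v b) : N (∑ t, v t * star (v t)) = Fintype.card T * N b := by
  have := hv.toMF.tot_rank hG
  rw [tot_unit] at this
  simpa using this

lemma frame_proj {T : Type} [Fintype T] [DecidableEq T] {v : T → Q} {b : Q}
    (hv : IsFrame v b) : IsProjection (∑ t, v t * star (v t)) := by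
  have := hv.toMF.tot_proj
  rwa [tot_unit] at this

lemma frame_tot_u {T : Type} [Fintype T] [DecidableEq T] {v : T → Q} {b : Q}
    (hv : IsFrame v b) (a : T) : (∑ t, v t * star (v t)) * v a = v a := by
  have := hv.toMF.tot_u () a
  rwa [tot_unit] at this

lemma frame_fill (hG : Good Q N) (hC : Cmp N) {T : Type} [Fintype T] [DecidableEq T] {v : T → Q}
    {b g : Q} (hv : IsFrame v b) (hg : IsProjection g) (hgv : ∀ t, g * v t = v t) (M : ℕ)
    (hM : N g = M * N b) (hb : 0 < N b) :
    ∃ u : Fin M → Q, IsFrame u b ∧ ∑ t, u t * star (u t) = g ∧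
      ∀ Z : Matrix T T F, ∃ Z' : Matrix (Fin M) (Fin M) F, fm u Z' = fm v Z := by
  obtain ⟨q, hq⟩ : ∃ q, q = ∑ t, v t * star (v t) := ⟨_, rfl⟩
  have hqp := frame_proj hv
  have hqr := frame_rank hG hv
  rw [← hq] at hqp hqr
  have hle : ProjLE q g := projLE_of_left hg hqp (by
    rw [hq, Finset.mul_sum]; exact Finset.sum_congr rfl fun t _ => by rw [← mul_assoc, hgv])
  have h1 := proj_rank_le hG hle
  have hcard : Fintype.card T ≤ M := by
    rw [hqr, hM] at h1
    exact_mod_cast le_of_mul_le_mul_right h1 hb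
  obtain ⟨hgq, h3, h4, h5⟩ := proj_sub hg hqp hle
  have h6 := proj_rank_sub hG hg hqp hle
  obtain ⟨w, hw, hgw⟩ := chop hG hC (M - Fintype.card T) (g - q) b hgq hv.proj (by
    rw [h6, hqr, hM, Nat.cast_sub hcard]; linarith)
  have ho : ∀ t s, star (v t) * w s = 0 := fun t s => by
    have e : star (v t) * q = star (v t) := by
      have := congrArg star (frame_tot_u hv t)
      rwa [← hq, star_mul, hqp.1] at this
    rw [← hgw s, ← e, mul_assoc, ← mul_assoc q, h4]; simp
  obtain ⟨hs, hsZ⟩ := sum_frame (F := F) hv hw ho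
  have hc : Fintype.card (Fin M) = Fintype.card (T ⊕ Fin (M - Fintype.card T)) := by
    simp; omega
  obtain ⟨E⟩ := Fintype.card_eq.1 hc
  have hfr := hs.reindex E.toEmbedding
  refine ⟨_, hfr, ?_, fun Z => ?_⟩
  · symm
    refine proj_eq_of_rank hG hg (frame_proj hfr) ?_ ?_
    · refine projLE_of_left hg (frame_proj hfr) ?_
      rw [Finset.mul_sum]
      refine Finset.sum_congr rfl fun t _ => ?_
      rw [← mul_assoc]
      congr 1
      have : ∀ y, g * Sum.elim v w y = Sum.elim v w y := by
        rintro (y | y)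
        · exact hgv y
        · simp only [Sum.elim_inr]
          conv_lhs => rw [← hgw y, ← mul_assoc, h3.1]
          rw [hgw]
      exact this _
    · rw [frame_rank hG hfr, hM]; simp
  · refine ⟨(fromBlocks Z 0 0 0).submatrix E E, ?_⟩
    rw [← hsZ Z]
    exact fm_reindex E _

lemma move_proj (hG : Good Q N) (hC : Cmp N) {q g : Q} (hq : IsProjection q) (hg : IsProjection g)
    (hle : N q ≤ N g) (δ : ℝ) (hδ : N ((1 - g) * q) ≤ δ) :
    ∃ U, star U * U = q ∧ g * U = U ∧ U * q = U ∧ N (U - q) ≤ 2 * δ := by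
  have hr := hG.rk.1
  obtain ⟨c, hc, hcq, h1, h2⟩ := annihil hG Finset.univ (fun _ : Unit => 1 - g) q hq
  have h1' : g * c = c := by
    have := h1 () (Finset.mem_univ _)
    rw [sub_mul, one_mul, sub_eq_zero] at this; exact this.symm
  simp only [Finset.univ_unique, Finset.sum_singleton] at h2
  have hcg : ProjLE c g := projLE_of_left hg hc h1'
  obtain ⟨a1, a2, a3, a4⟩ := proj_sub hq hc hcq
  obtain ⟨b1, b2, b3, b4⟩ := proj_sub hg hc hcg
  have hrk : N (q - c) ≤ N (g - c) := by
    rw [proj_rank_sub hG hq hc hcq, proj_rank_sub hG hg hc hcg]; linarith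
  obtain ⟨w, hw1, hw2⟩ := hC _ _ a1 b1 hrk
  have hpi : w * star w * w = w := pi_of_proj hG.proper (by rw [hw1]; exact a1)
  have hwc : w * c = 0 := by rw [← hw2, mul_assoc, b4, mul_zero]
  have hcw : c * star w = 0 := by
    have := congrArg star hwc; rwa [star_mul, hc.1, star_zero] at this
  have hgw : g * star w = star w := by
    have h0 : w * g = w := by rw [← hw2, mul_assoc, b2.2]
    have := congrArg star h0; rwa [star_mul, hg.1] at this
  have hwq : star w * q = star w := by
    have h0 : q * w = w := by rw [← hpi, hw1, ← mul_assoc, a2.1]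
    have := congrArg star h0; rwa [star_mul, hq.1] at this
  refine ⟨c + star w, ?_, ?_, ?_, ?_⟩
  · rw [star_add, star_star, hc.1, add_mul, mul_add, mul_add, hc.2, hcw, hwc, hw1]; abel
  · rw [mul_add, h1', hgw]
  · rw [add_mul, hcq.2, hwq]
  · have e : c + star w - q = star w - (q - c) := by abel
    rw [e]
    have s1 := prf_sub_le hr (star w) (q - c)
    have s2 : N (star w) ≤ N (q - c) := by
      rw [hG.star_inv, ← hw1, (pi_rank hG hpi).1]
    linarith

end P10

section P11
set_option linter.unusedSectionVars false
set_option linter.unusedSimpArgs false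
set_option linter.unusedVariables false
variable {F : Type} [Field F] [StarRing F]
variable {Q : Type} [Ring Q] [Algebra F Q] [StarRing Q] [StarModule F Q] {N : Q → ℝ}

open Matrix

lemma corner (hG : Good Q N) (hC : Cmp N) {g : Q} (hg : IsProjection g) (hLA : LA F N g) (n : ℕ)
    (hn : N g = (1 / 2) ^ n) (m : ℕ) (x : Fin m → Q) (hx : ∀ j, g * x j = x j ∧ x j * g = x j)
    (ε : ℝ) (hε : 0 < ε) :
    ∃ (l : ℕ) (_ : 0 < l) (u : Fin (2 ^ l) → Q) (b : Q) (Y : Fin m → Matrix (Fin (2 ^ l)) (Fin (2 ^ l)) F),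
      IsFrame u b ∧ ∑ t, u t * star (u t) = g ∧ N b = (1 / 2) ^ (n + l) ∧
      ∀ j, N (x j - fm u (Y j)) < ε := by
  classical
  have hr := hG.rk.1
  have hg0 : 0 < N g := by rw [hn]; positivity
  have hg1 : N g ≤ 1 := hr.le_one _
  obtain ⟨δ, hδ⟩ : ∃ δ : ℝ, δ = ε * N g / 16 := ⟨_, rfl⟩
  have hδ0 : 0 < δ := by rw [hδ]; positivity
  have hδ1 : δ ≤ ε / 16 := by rw [hδ]; nlinarith
  obtain ⟨ι, _, _, T, _, _, u, h, Y, hM, h1, h2⟩ := hLA δ hδ0 m x hx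
  obtain ⟨q, hq⟩ : ∃ q, q = tot u := ⟨_, rfl⟩
  have hqp := hM.tot_proj
  have hqr := hM.tot_rank hG
  rw [← hq] at h1 hqp hqr
  obtain ⟨D, hD⟩ : ∃ D : ℝ, D = ∑ i, (Fintype.card (T i) : ℝ) := ⟨_, rfl⟩
  have hD0 : 0 ≤ D := by rw [hD]; exact Finset.sum_nonneg fun _ _ => by positivity
  obtain ⟨l₀, hl₀⟩ := exists_pow_lt_of_lt_one (y := (1/2 : ℝ)) (show (0:ℝ) < ε / (16 * (D + 1)) by positivity) (by norm_num)
  obtain ⟨l, hll⟩ : ∃ l, l = l₀ + 1 := ⟨_, rfl⟩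
  have hl : ((1:ℝ) / 2) ^ l < ε / (16 * (D + 1)) := by
    refine lt_of_le_of_lt ?_ hl₀
    rw [hll]
    exact pow_le_pow_of_le_one (by norm_num) (by norm_num) (Nat.le_succ _)
  have hl' : ((1:ℝ) / 2) ^ (n + l) ≤ ε / (16 * (D + 1)) := by
    rw [pow_add]
    have : ((1:ℝ) / 2) ^ n ≤ 1 := pow_le_one₀ (by norm_num) (by norm_num)
    have h3 : (0:ℝ) < ((1:ℝ) / 2) ^ l := by positivity
    nlinarith
  obtain ⟨β, hβ⟩ : ∃ β : ℝ, β = (1 / 2) ^ (n + l) := ⟨_, rfl⟩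
  have hβ0 : 0 < β := by rw [hβ]; positivity
  rw [← hβ] at hl'
  obtain ⟨b, hb, -, hbr⟩ := subproj_of_rank hG (f := 1) ⟨star_one _, one_mul _⟩ β hβ0.le (by
    rw [hr.map_one, hβ]; exact pow_le_one₀ (by norm_num) (by norm_num))
  obtain ⟨lam, hlam⟩ : ∃ y : ℝ, y = N g / (N g + δ) := ⟨_, rfl⟩
  have hlam0 : 0 ≤ lam := by rw [hlam]; positivity
  have hlam1 : 1 - lam ≤ ε / 16 := by
    have : 1 - lam = δ / (N g + δ) := by rw [hlam]; field_simp; ring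
    rw [this, div_le_iff₀ (by positivity), hδ]; nlinarith
  have hlam2 : lam ≤ 1 := by rw [hlam, div_le_one (by positivity)]; linarith
  have hNq : N q ≤ N g + δ := by
    have := prf_le_add hr q g
    rw [prf_sub_comm hr] at this; linarith
  have hlq : lam * N q ≤ N g := by
    rw [hlam, div_mul_eq_mul_div, div_le_iff₀ (by positivity)]
    nlinarith
  obtain ⟨d, hd⟩ : ∃ d : ι → ℕ, ∀ i, d i = ⌊lam * N (h i) / β⌋₊ := ⟨_, fun _ => rfl⟩
  have hd1 : ∀ i, d i * β ≤ lam * N (h i) := fun i => by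
    rw [← le_div_iff₀ hβ0, hd]
    exact Nat.floor_le (div_nonneg (mul_nonneg hlam0 (hr.nonneg _)) hβ0.le)
  have hd2 : ∀ i, lam * N (h i) ≤ d i * β + β := fun i => by
    have := (Nat.lt_floor_add_one (lam * N (h i) / β)).le
    rw [← hd, div_le_iff₀ hβ0] at this; linarith
  choose w hw hhw using fun i => chop hG hC (d i) (h i) b (hM.fr i).proj hb (by
    rw [hbr]; refine (hd1 i).trans ?_
    have := hr.nonneg (h i)
    nlinarith)
  have hM' := hM.refine hw hhw
  obtain ⟨hS1, hS2, hS3⟩ := sigma_frame (F := F) hM' hb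
  obtain ⟨u', hu'⟩ : ∃ u' : (Σ i, T i × Fin (d i)) → Q, u' = fun p => u p.1 p.2.1 * w p.1 p.2.2 := ⟨_, rfl⟩
  obtain ⟨q', hq'⟩ : ∃ q', q' = tot (fun i (p : T i × Fin (d i)) => u i p.1 * w i p.2) := ⟨_, rfl⟩
  have hq'p := hM'.tot_proj
  have hq'r := hM'.tot_rank hG
  rw [← hq'] at hS3 hq'p hq'r
  rw [← hu'] at hS1
  have hq'q : ProjLE q' q := by
    refine projLE_of_left hqp hq'p ?_
    rw [hq', tot, Finset.mul_sum]
    refine Finset.sum_congr rfl fun i _ => ?_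
    rw [Finset.mul_sum]
    refine Finset.sum_congr rfl fun p _ => ?_
    rw [← mul_assoc, ← mul_assoc, hq, hM.tot_u]
  have hq'r2 : N q' = ∑ i, (Fintype.card (T i) : ℝ) * (d i * β) := by
    rw [hq'r]; refine Finset.sum_congr rfl fun i _ => ?_
    rw [hbr]; simp; ring
  have hq'g : N q' ≤ N g := by
    refine le_trans ?_ hlq
    rw [hq'r2, hqr, Finset.mul_sum]
    refine Finset.sum_le_sum fun i _ => ?_
    have := mul_le_mul_of_nonneg_left (hd1 i) (Nat.cast_nonneg (α := ℝ) (Fintype.card (T i)))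
    linarith
  have hqq' : N (q - q') ≤ ε / 8 := by
    rw [proj_rank_sub hG hqp hq'p hq'q]
    have e1 : lam * N q ≤ N q' + D * β := by
      rw [hq'r2, hqr, hD, Finset.mul_sum, Finset.sum_mul, ← Finset.sum_add_distrib]
      refine Finset.sum_le_sum fun i _ => ?_
      have := mul_le_mul_of_nonneg_left (hd2 i) (Nat.cast_nonneg (α := ℝ) (Fintype.card (T i)))
      linarith
    have e2 : D * β ≤ ε / 16 := by
      rw [le_div_iff₀ (by positivity)] at hl'
      nlinarith
    have e3 : N q ≤ 1 := hr.le_one q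
    have e4 := hr.nonneg q
    nlinarith
  obtain ⟨U, hU1, hU2, hU3, hU4⟩ := move_proj hG hC hq'p hg hq'g δ (by
    have : (1 - g) * q' = 1 * ((q - g) * q') := by
      rw [sub_mul, sub_mul, hq'q.1, one_mul, one_mul]
    rw [this, one_mul]
    refine (hr.mul_le_left _ _).trans ?_
    rw [prf_sub_comm hr]; exact h1.le)
  have hq'u : ∀ p, q' * u' p = u' p := fun p => by
    rw [hq', hu']; exact hM'.tot_u p.1 p.2
  have hV := hS1.lmul hU1 hq'u
  obtain ⟨v, hv, hvg, hvZ⟩ := frame_fill (F := F) hG hC hV hg (fun t => by rw [← mul_assoc, hU2]) (2 ^ l) (by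
    rw [hn, hbr, hβ, pow_add]; push_cast
    have : (2:ℝ) ^ l * (1 / 2) ^ l = 1 := by rw [← mul_pow]; norm_num
    linear_combination (-(1/2:ℝ) ^ n) * this) (by rw [hbr]; exact hβ0)
  choose Z hZ using fun j => hvZ (blockDiagonal' fun i => Y j i ⊗ₖ (1 : Matrix (Fin (d i)) (Fin (d i)) F))
  refine ⟨l, by omega, v, b, Z, hv, hvg, by rw [hbr, hβ], fun j => ?_⟩
  rw [hZ, fm_lmul]
  have e1 : fm u' (blockDiagonal' fun i => Y j i ⊗ₖ (1 : Matrix (Fin (d i)) (Fin (d i)) F)) = mm u (Y j) * q' := by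
    rw [hq', ← hM.refine_map hw hhw, ← hS2, hu']
  rw [e1]
  obtain ⟨y, hy⟩ : ∃ y, y = mm u (Y j) * q' := ⟨_, rfl⟩
  rw [← hy]
  have e2 : x j - y = (x j - mm u (Y j)) + mm u (Y j) * (q - q') := by
    rw [mul_sub, hq, hM.map_tot, hy]; abel
  have hqy : y * q' = y := by rw [hy, mul_assoc, hq'p.2]
  have hyq : q' * y = y := by
    have : q' = fm u' (1 : Matrix _ _ F) := by rw [fm_one, ← hS3, hu']
    rw [hy, ← e1]
    conv_lhs => rw [this]
    rw [← fm_mul hS1, one_mul]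
  have e3 : x j - U * y * star U = (x j - y) - ((U - q') * (y * star U) + q' * y * star (U - q')) := by
    rw [star_sub, hq'p.1, sub_mul, mul_sub, ← mul_assoc q' y, mul_assoc q' y q', hqy, hyq]
    noncomm_ring
  rw [e3]
  have s1 := prf_sub_le hr (x j - y) ((U - q') * (y * star U) + q' * y * star (U - q'))
  have s2 := hr.subadditive ((U - q') * (y * star U)) (q' * y * star (U - q'))
  have s3 := hr.mul_le_left (U - q') (y * star U)
  have s4 := hr.mul_le_right (q' * y) (star (U - q'))
  rw [hG.star_inv] at s4
  have s5 := hr.subadditive (x j - mm u (Y j)) (mm u (Y j) * (q - q'))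
  rw [← e2] at s5
  have s6 := hr.mul_le_right (mm u (Y j)) (q - q')
  have := h2 j
  linarith

end P11

section P12
set_option linter.unusedSectionVars false
set_option linter.unusedSimpArgs false
set_option linter.unusedVariables false
variable {F : Type} [Field F] [StarRing F]
variable {Q : Type} [Ring Q] [Algebra F Q] [StarRing Q] [StarModule F Q] {N : Q → ℝ}

open Matrix

/-- index equivalence for the canonical embedding -/
def stdE (a b : ℕ) (h : a ≤ b) : Fin (2 ^ a) × Fin (2 ^ (b - a)) ≃ Fin (2 ^ b) :=
  (Equiv.prodComm _ _).trans (finProdFinEquiv.trans (finCongr (by rw [← pow_add, Nat.sub_add_cancel h])))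

/-- canonical embedding -/
def stdm (a b : ℕ) (h : a ≤ b) (z : Matrix (Fin (2 ^ a)) (Fin (2 ^ a)) F) :
    Matrix (Fin (2 ^ b)) (Fin (2 ^ b)) F :=
  Matrix.reindex (stdE a b h) (stdE a b h) (z ⊗ₖ (1 : Matrix (Fin (2 ^ (b - a))) (Fin (2 ^ (b - a))) F))

lemma stdE_symm_fst (a b : ℕ) (h : a ≤ b) (i : Fin (2 ^ b)) :
    (((stdE a b h).symm i).1 : ℕ) = (i : ℕ) % 2 ^ a := rfl

lemma stdE_symm_snd (a b : ℕ) (h : a ≤ b) (i : Fin (2 ^ b)) :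
    (((stdE a b h).symm i).2 : ℕ) = (i : ℕ) / 2 ^ a := rfl

lemma stdm_apply (a b : ℕ) (h : a ≤ b) (z : Matrix (Fin (2 ^ a)) (Fin (2 ^ a)) F) (i j : Fin (2 ^ b)) :
    stdm a b h z i j = if (i : ℕ) / 2 ^ a = (j : ℕ) / 2 ^ a then
      z ⟨(i : ℕ) % 2 ^ a, Nat.mod_lt _ (by positivity)⟩ ⟨(j : ℕ) % 2 ^ a, Nat.mod_lt _ (by positivity)⟩
      else 0 := by
  rw [stdm, Matrix.reindex_apply, Matrix.submatrix_apply, Matrix.kroneckerMap_apply, Matrix.one_apply]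
  simp only [Fin.ext_iff, stdE_symm_snd, mul_ite, mul_one, mul_zero]
  rfl

lemma stdm_comp (a b c : ℕ) (h : a ≤ b) (h' : b ≤ c) (z : Matrix (Fin (2 ^ a)) (Fin (2 ^ a)) F) :
    stdm b c h' (stdm a b h z) = stdm a c (h.trans h') z := by
  ext i j
  rw [stdm_apply, stdm_apply, stdm_apply]
  have hb : 2 ^ b = 2 ^ a * 2 ^ (b - a) := by rw [← pow_add]; congr 1; omega
  have hdvd : 2 ^ a ∣ 2 ^ b := pow_dvd_pow 2 h
  simp only [Nat.mod_mod_of_dvd _ hdvd]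
  have key : ∀ x y k : ℕ, (x / k = y / k ∧ x % k = y % k) ↔ x = y := by
    intro x y k
    constructor
    · rintro ⟨h1, h2⟩
      rw [← Nat.div_add_mod x k, ← Nat.div_add_mod y k, h1, h2]
    · rintro rfl; exact ⟨rfl, rfl⟩
  have := key ((i : ℕ) / 2 ^ a) ((j : ℕ) / 2 ^ a) (2 ^ (b - a))
  rw [Nat.div_div_eq_div_mul, Nat.div_div_eq_div_mul, ← hb, ← Nat.mod_mul_right_div_self,
    ← Nat.mod_mul_right_div_self, ← hb] at this
  by_cases h1 : (i : ℕ) / 2 ^ a = (j : ℕ) / 2 ^ a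
  · rw [if_pos h1, if_pos (this.2 h1).1, if_pos (this.2 h1).2]
  · rw [if_neg h1]
    by_cases h2 : (i : ℕ) / 2 ^ b = (j : ℕ) / 2 ^ b
    · rw [if_pos h2, if_neg (fun h3 => h1 (this.1 ⟨h2, h3⟩))]
    · rw [if_neg h2]

lemma stdm_std (a b : ℕ) (h : a ≤ b) : IsStandardMatrixMap F (stdm (F := F) a b h) := by
  refine ⟨2 ^ (b - a), stdE a b h, fun z => ?_⟩
  rw [stdm]; congr 1
  ext ⟨i, k⟩ ⟨j, k'⟩
  rw [Matrix.kroneckerMap_apply, Matrix.blockDiagonal_apply, Matrix.one_apply]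
  simp

/-- homomorphism of a full frame -/
lemma hom_of_frame {T : Type} [Fintype T] [DecidableEq T] {u : T → Q} {h : Q} (hf : IsFrame u h)
    (h1 : ∑ t, u t * star (u t) = 1) : ∃ Θ : Matrix T T F →⋆ₐ[F] Q, ∀ Z, Θ Z = fm u Z := by
  have e1 : fm u (1 : Matrix T T F) = 1 := by rw [fm_one, h1]
  refine ⟨{ toFun := fm u, map_one' := e1, map_mul' := fm_mul hf, map_zero' := fm_zero,
            map_add' := fm_add, commutes' := fun c => ?_, map_star' := fun Z => (fm_star Z).symm }, fun Z => rfl⟩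
  rw [Algebra.algebraMap_eq_smul_one, Algebra.algebraMap_eq_smul_one]
  exact (fm_smul c 1).trans (by rw [e1])

/-- one step of the tower -/
lemma tower_step (hG : Good Q N) (hC : Cmp N) (hLA : ∀ g : Q, IsProjection g → LA F N g) (n : ℕ)
    (v : Fin (2 ^ n) → Q) (g : Q) (hv : IsFrame v g) (hv1 : ∑ t, v t * star (v t) = 1)
    (hgr : N g = (1 / 2) ^ n) (m : ℕ) (x : Fin m → Q) (ε : ℝ) (hε : 0 < ε) :
    ∃ (n' : ℕ) (hn : n < n') (v' : Fin (2 ^ n') → Q) (g' : Q), IsFrame v' g' ∧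
      ∑ t, v' t * star (v' t) = 1 ∧ N g' = (1 / 2) ^ n' ∧
      (∀ z : Matrix (Fin (2 ^ n)) (Fin (2 ^ n)) F, fm v' (stdm n n' hn.le z) = fm v z) ∧
      ∀ j, ∃ Y : Matrix (Fin (2 ^ n')) (Fin (2 ^ n')) F, N (x j - fm v' Y) < ε := by
  classical
  have hr := hG.rk.1
  let X := Fin m × Fin (2 ^ n) × Fin (2 ^ n)
  let e := Fintype.equivFin X
  obtain ⟨l, hl, u, b, Y, hu, hug, hbr, hY⟩ := corner hG hC hv.proj (hLA g hv.proj) n hgr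
    (Fintype.card X) (fun s => star (v (e.symm s).2.1) * x (e.symm s).1 * v (e.symm s).2.2)
    (fun s => ⟨by rw [← mul_assoc, ← mul_assoc, hv.hu], by rw [mul_assoc, hv.uh]⟩)
    (ε / (2 ^ n * 2 ^ n)) (by positivity)
  have hgu : ∀ s, g * u s = u s := fun s => by rw [← hug]; exact frame_tot_u hu s
  have hfr := hv.comp hu hgu
  obtain ⟨E, hE⟩ : ∃ E : Fin (2 ^ (n + l)) ≃ Fin (2 ^ n) × Fin (2 ^ l),
      E = (stdE n (n + l) (Nat.le_add_right _ _)).symm.trans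
        (Equiv.prodCongr (Equiv.refl _) (finCongr (by rw [Nat.add_sub_cancel_left]))) := ⟨_, rfl⟩
  have hfm1 : fm (fun p : Fin (2 ^ n) × Fin (2 ^ l) => v p.1 * u p.2) (1 : Matrix _ _ F) = 1 := by
    rw [← Matrix.one_kronecker_one, fm_comp, fm_one, hug]
    simp only [hv.uh]
    exact fm_one.trans hv1
  refine ⟨n + l, by omega, fun s => v (E s).1 * u (E s).2, b, hfr.reindex E.toEmbedding, ?_, hbr, ?_, ?_⟩
  · rw [← hfm1, fm_one]
    exact Fintype.sum_equiv E _ _ fun _ => rfl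
  · intro z
    have h1 := fm_reindex (u := fun p : Fin (2 ^ n) × Fin (2 ^ l) => v p.1 * u p.2) E
      (z ⊗ₖ (1 : Matrix (Fin (2 ^ l)) (Fin (2 ^ l)) F))
    rw [hv.comp_one hu hgu, hfm1, mul_one] at h1
    rw [← h1]
    congr 1
    ext i j
    rw [stdm_apply, Matrix.submatrix_apply, Matrix.kroneckerMap_apply, Matrix.one_apply]
    have hfst : ∀ i : Fin (2 ^ (n + l)), ((E i).1 : ℕ) = (i : ℕ) % 2 ^ n := fun i => by rw [hE]; rfl
    have hsnd : ∀ i : Fin (2 ^ (n + l)), ((E i).2 : ℕ) = (i : ℕ) / 2 ^ n := fun i => by rw [hE]; rfl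
    have hc : (E i).2 = (E j).2 ↔ (i : ℕ) / 2 ^ n = (j : ℕ) / 2 ^ n := by
      rw [Fin.ext_iff, hsnd, hsnd]
    simp only [hc, mul_ite, mul_one, mul_zero]
    congr 1
    congr 1 <;> exact Fin.ext (hfst _).symm
  · intro j
    refine ⟨(∑ a, ∑ c, (Matrix.single a c (1:F)) ⊗ₖ Y (e (j, a, c))).submatrix E E, ?_⟩
    have h1 := fm_reindex (u := fun p : Fin (2 ^ n) × Fin (2 ^ l) => v p.1 * u p.2) E
      (∑ a, ∑ c, (Matrix.single a c (1:F)) ⊗ₖ Y (e (j, a, c)))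
    rw [h1]
    have hsum : ∀ {ι : Type} (s : Finset ι) (f : ι → Matrix (Fin (2 ^ n) × Fin (2 ^ l)) (Fin (2 ^ n) × Fin (2 ^ l)) F),
        fm (fun p : Fin (2 ^ n) × Fin (2 ^ l) => v p.1 * u p.2) (∑ i ∈ s, f i) =
        ∑ i ∈ s, fm (fun p : Fin (2 ^ n) × Fin (2 ^ l) => v p.1 * u p.2) (f i) := by
      intro ι s f
      induction s using Finset.induction_on with
      | empty => simp [fm_zero]
      | insert a s ha ih => rw [Finset.sum_insert ha, Finset.sum_insert ha, fm_add, ih]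
    rw [hsum]
    simp only [hsum]
    have hsingle : ∀ a c, fm (fun p : Fin (2 ^ n) × Fin (2 ^ l) => v p.1 * u p.2)
        ((Matrix.single a c (1:F)) ⊗ₖ Y (e (j, a, c))) = v a * fm u (Y (e (j, a, c))) * star (v c) := by
      intro a c
      rw [fm_comp, Finset.sum_eq_single a, Finset.sum_eq_single c]
      · simp
      · intro c' _ hc'; simp [Matrix.single_apply, hc'.symm]
      · simp
      · intro a' _ ha'; simp [Matrix.single_apply, ha'.symm]
      · simp
    simp only [hsingle]
    have hx : x j = ∑ a, ∑ c, v a * (star (v a) * x j * v c) * star (v c) := by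
      calc x j = (∑ a, v a * star (v a)) * x j * (∑ c, v c * star (v c)) := by rw [hv1]; simp
        _ = _ := by
          simp only [Finset.sum_mul, Finset.mul_sum, mul_assoc]
          rw [Finset.sum_comm]
    rw [hx, ← Finset.sum_sub_distrib]
    simp only [← Finset.sum_sub_distrib, ← mul_sub, ← sub_mul]
    have hpos : 0 < 2 ^ n := by positivity
    haveI : Nonempty (Fin (2 ^ n)) := ⟨⟨0, hpos⟩⟩
    calc _ ≤ ∑ a : Fin (2 ^ n), ∑ c : Fin (2 ^ n), N (star (v a) * x j * v c - fm u (Y (e (j, a, c)))) := by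
          refine (prf_sum_le hr _ _).trans (Finset.sum_le_sum fun a _ => ?_)
          refine (prf_sum_le hr _ _).trans (Finset.sum_le_sum fun c _ => ?_)
          exact prf_mul_mul_le hr _ _ _
      _ < ∑ a : Fin (2 ^ n), ∑ c : Fin (2 ^ n), ε / (2 ^ n * 2 ^ n) := by
          refine Finset.sum_lt_sum_of_nonempty Finset.univ_nonempty fun a _ => ?_
          refine Finset.sum_lt_sum_of_nonempty Finset.univ_nonempty fun c _ => ?_
          have := hY (e (j, a, c))
          simp only [Equiv.symm_apply_apply] at this
          exact this
      _ = ε := by simp; field_simp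

end P12

section P13
set_option linter.unusedSectionVars false
set_option linter.unusedSimpArgs false
set_option linter.unusedVariables false
variable {F : Type} [Field F] [StarRing F]
variable {Q : Type} [Ring Q] [Algebra F Q] [StarRing Q] [StarModule F Q] {N : Q → ℝ}

open Matrix

lemma stdm_hom (a b : ℕ) (h : a ≤ b) :
    ∃ Φ : Matrix (Fin (2 ^ a)) (Fin (2 ^ a)) F →⋆ₐ[F] Matrix (Fin (2 ^ b)) (Fin (2 ^ b)) F,
      ∀ z, Φ z = stdm a b h z := by
  have e1 : stdm a b h (1 : Matrix (Fin (2 ^ a)) (Fin (2 ^ a)) F) = 1 := by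
    rw [stdm, Matrix.one_kronecker_one, Matrix.reindex_apply, Matrix.submatrix_one_equiv]
  have esm : ∀ (c : F) (z : Matrix (Fin (2 ^ a)) (Fin (2 ^ a)) F), stdm a b h (c • z) = c • stdm a b h z := by
    intro c z
    rw [stdm, stdm, Matrix.smul_kronecker]
    rfl
  refine ⟨{ toFun := stdm a b h, map_one' := e1, map_mul' := fun x y => ?_, map_zero' := ?_,
            map_add' := fun x y => ?_, commutes' := fun c => ?_, map_star' := fun z => ?_ }, fun z => rfl⟩
  · rw [stdm, stdm, stdm, Matrix.reindex_apply, Matrix.reindex_apply, Matrix.reindex_apply,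
      Matrix.submatrix_mul_equiv, ← Matrix.mul_kronecker_mul, mul_one]
  · ext i j; simp [stdm]
  · ext i j; simp [stdm, add_mul]
  · rw [Algebra.algebraMap_eq_smul_one, Algebra.algebraMap_eq_smul_one]
    exact (esm c 1).trans (by rw [e1])
  · rw [stdm, stdm, Matrix.reindex_apply, Matrix.reindex_apply, Matrix.star_eq_conjTranspose,
      Matrix.star_eq_conjTranspose, Matrix.conjTranspose_submatrix, Matrix.conjTranspose_kronecker,
      Matrix.conjTranspose_one]

lemma mf_of_tower (hG : Good Q N) (Θ : ∀ n, Matrix (Fin (2 ^ n)) (Fin (2 ^ n)) F →⋆ₐ[F] Q)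
    (hΘ : ∀ n z, Θ (n + 1) (stdm n (n + 1) (Nat.le_succ n) z) = Θ n z)
    (hd : ∀ x ε, 0 < ε → ∃ n Z, N (x - Θ n Z) < ε) : IsMFStarCompletion F Q N := by
  have : Nontrivial Q := ⟨⟨1, 0, fun h => by
    have h1 := hG.rk.1.map_one
    rw [h, prf_zero hG.rk.1] at h1
    norm_num at h1⟩⟩
  have : ∀ n, Nonempty (Fin (2 ^ n)) := fun n => ⟨⟨0, by positivity⟩⟩
  have hinj : ∀ n, Function.Injective (Θ n) := fun n =>
    RingHom.injective ((Θ n) : Matrix (Fin (2 ^ n)) (Fin (2 ^ n)) F →+* Q)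
  have hA : ∀ n, (Θ n).range ≤ (Θ (n + 1)).range := by
    rintro n _ ⟨z, rfl⟩
    exact ⟨stdm n (n + 1) (Nat.le_succ n) z, hΘ n z⟩
  refine ⟨hG.rk, hG.star_inv, hG.complete, fun n => (Θ n).range, hA,
    fun n => (StarAlgEquiv.ofInjective (Θ n) (hinj n)).symm, ?_, ?_⟩
  · intro x ε hε
    obtain ⟨n, Z, h⟩ := hd x ε hε
    exact ⟨Θ n Z, Set.mem_iUnion.2 ⟨n, ⟨Z, rfl⟩⟩, h⟩
  · intro n
    obtain ⟨t, E, h⟩ := stdm_std (F := F) n (n + 1) (Nat.le_succ n)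
    refine ⟨t, E, fun z => ?_⟩
    rw [← h]
    rw [StarAlgEquiv.symm_symm, ← StarAlgEquiv.symm_apply_apply (StarAlgEquiv.ofInjective (Θ (n+1)) (hinj (n+1))) (stdm n (n + 1) (Nat.le_succ n) z)]
    refine congrArg (StarAlgEquiv.ofInjective (Θ (n+1)) (hinj (n+1))).symm ?_
    apply Subtype.ext
    exact (hΘ n z).symm

lemma smul_rank_le (hr : IsPseudoRankFunction N) (c : F) (x : Q) : N (c • x) ≤ N x := by
  rw [← one_mul x, ← smul_mul_assoc, one_mul]
  exact hr.mul_le_right _ _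

lemma countable_span (V : Submodule F Q) (h : Module.rank F V ≤ Cardinal.aleph0) :
    ∃ e : ℕ → Q, ∀ W : Submodule F Q, (∀ n, e n ∈ W) → V ≤ W := by
  obtain ⟨b⟩ : Nonempty (Module.Basis (Module.Free.ChooseBasisIndex F V) F V) := ⟨Module.Free.chooseBasis F V⟩
  have hc : Countable (Module.Free.ChooseBasisIndex F V) := by
    rw [← Cardinal.mk_le_aleph0_iff, b.mk_eq_rank'']; exact h
  have key : ∀ W : Submodule F Q, (∀ i, (b i : Q) ∈ W) → V ≤ W := by
    intro W hW x hx
    have : (⊤ : Submodule F V) ≤ W.comap V.subtype := by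
      rw [← b.span_eq, Submodule.span_le]
      rintro _ ⟨i, rfl⟩
      exact hW i
    exact this (Submodule.mem_top : (⟨x, hx⟩ : V) ∈ ⊤)
  rcases isEmpty_or_nonempty (Module.Free.ChooseBasisIndex F V) with hE | hE
  · exact ⟨fun _ => 0, fun W _ => key W fun i => hE.elim i⟩
  · obtain ⟨f, hf⟩ := exists_surjective_nat (Module.Free.ChooseBasisIndex F V)
    refine ⟨fun n => b (f n), fun W hW => key W fun i => ?_⟩
    obtain ⟨n, rfl⟩ := hf i
    exact hW n

/-- state of the tower construction -/
def TSt (N : Q → ℝ) : Type :=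
  Σ n : ℕ, {v : Fin (2 ^ n) → Q // ∃ g, IsFrame v g ∧ ∑ t, v t * star (v t) = 1 ∧ N g = (1 / 2) ^ n}

lemma tower_exists (hG : Good Q N) (hC : Cmp N) (hLA : ∀ g : Q, IsProjection g → LA F N g)
    (e : ℕ → Q) : ∃ S : ℕ → TSt N, ∀ k, ∃ hn : (S k).1 < (S (k + 1)).1,
      (∀ z : Matrix (Fin (2 ^ (S k).1)) (Fin (2 ^ (S k).1)) F,
        fm (S (k + 1)).2.1 (stdm (S k).1 (S (k + 1)).1 hn.le z) = fm (S k).2.1 z) ∧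
      ∀ j, j < k → ∃ Y : Matrix (Fin (2 ^ (S (k + 1)).1)) (Fin (2 ^ (S (k + 1)).1)) F,
        N (e j - fm (S (k + 1)).2.1 Y) < 1 / ((k : ℝ) + 1) := by
  classical
  have step : ∀ (k : ℕ) (s : TSt N), ∃ s' : TSt N, ∃ hn : s.1 < s'.1,
      (∀ z : Matrix (Fin (2 ^ s.1)) (Fin (2 ^ s.1)) F,
        fm s'.2.1 (stdm s.1 s'.1 hn.le z) = fm s.2.1 z) ∧
      ∀ j, j < k → ∃ Y : Matrix (Fin (2 ^ s'.1)) (Fin (2 ^ s'.1)) F,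
        N (e j - fm s'.2.1 Y) < 1 / ((k : ℝ) + 1) := by
    rintro k ⟨n, v, g, hv, hv1, hg⟩
    obtain ⟨n', hn, v', g', h1, h2, h3, h4, h5⟩ := tower_step (F := F) hG hC hLA n v g hv hv1 hg k
      (fun j => e j) (1 / ((k : ℝ) + 1)) (by positivity)
    exact ⟨⟨n', v', g', h1, h2, h3⟩, hn, h4, fun j hj => h5 ⟨j, hj⟩⟩
  choose f hf using step
  have s0 : TSt N := ⟨0, fun _ => 1, 1, ⟨⟨star_one _, mul_one _⟩, fun a b => by
    have : a = b := by
      apply Fin.ext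
      have := a.2; have := b.2
      simp at *
    simp [this], fun a => mul_one _⟩, by simp, by simp [hG.rk.1.map_one]⟩
  exact ⟨fun k => Nat.rec s0 (fun k s => f k s) k, fun k => hf k _⟩

lemma mf_of_dl (hF : PosDefStar F) (hG : Good Q N) (hDL : DL F N)
    (Q₀ : StarSubalgebra F Q) (hdim : Module.rank F Q₀ ≤ Cardinal.aleph0)
    (hdense : RankDense N (Q₀ : Set Q)) : IsMFStarCompletion F Q N := by
  have hr := hG.rk.1
  have hC : Cmp N := star_cmp hG (h1_of_dl hF hG hDL)
  have hLA : ∀ g : Q, IsProjection g → LA F N g := la_of_dl hF hG hDL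
  obtain ⟨e, he⟩ := countable_span (F := F) (Subalgebra.toSubmodule Q₀.toSubalgebra) hdim
  obtain ⟨S, hS⟩ := tower_exists (F := F) hG hC hLA e
  choose hn hz hY using hS
  have hmono : StrictMono fun k => (S k).1 := strictMono_nat_of_lt_succ hn
  have hle : ∀ m, m ≤ (S m).1 := fun m => hmono.le_apply
  have hex : ∀ m, ∃ Θ : Matrix (Fin (2 ^ m)) (Fin (2 ^ m)) F →⋆ₐ[F] Q,
      ∀ z, Θ z = fm (S m).2.1 (stdm m (S m).1 (hle m) z) := by
    intro m
    obtain ⟨g, h1, h2, h3⟩ := (S m).2.2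
    obtain ⟨Θ, hΘ⟩ := hom_of_frame (F := F) h1 h2
    obtain ⟨Φ, hΦ⟩ := stdm_hom (F := F) m (S m).1 (hle m)
    exact ⟨Θ.comp Φ, fun z => by rw [StarAlgHom.comp_apply, hΘ, hΦ]⟩
  choose Θ hΘ using hex
  have hcomp1 : ∀ n z, Θ (n + 1) (stdm n (n + 1) (Nat.le_succ n) z) = Θ n z := by
    intro n z
    rw [hΘ, hΘ, stdm_comp, ← hz n, stdm_comp]
  have hcompd : ∀ n d z, Θ (n + d) (stdm n (n + d) (Nat.le_add_right n d) z) = Θ n z := by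
    intro n d z
    induction d with
    | zero =>
      congr 1
      ext i j
      rw [stdm_apply]
      have hi := i.2
      have hj := j.2
      simp only [Nat.add_zero] at hi hj
      rw [if_pos (by rw [Nat.div_eq_of_lt hi, Nat.div_eq_of_lt hj])]
      congr 1 <;> exact Fin.ext (Nat.mod_eq_of_lt (by assumption))
    | succ d ih =>
      rw [← ih, ← hcomp1 (n + d), stdm_comp]
      rfl
  have hcomp : ∀ m n (h : m ≤ n) z, Θ n (stdm m n h z) = Θ m z := by
    intro m n h z
    obtain ⟨d, rfl⟩ := Nat.exists_eq_add_of_le h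
    exact hcompd m d z
  have hSk : ∀ k z, Θ (S k).1 z = fm (S k).2.1 z := by
    intro k z
    have : ∀ d (h : (S k).1 ≤ (S (k + d)).1), fm (S (k+d)).2.1 (stdm (S k).1 (S (k+d)).1 h z) = fm (S k).2.1 z := by
      intro d
      induction d with
      | zero =>
        intro h
        congr 1
        ext i j
        rw [stdm_apply]
        have hi := i.2
        have hj := j.2
        simp only [Nat.add_zero] at hi hj
        rw [if_pos (by rw [Nat.div_eq_of_lt hi, Nat.div_eq_of_lt hj])]
        congr 1 <;> exact Fin.ext (Nat.mod_eq_of_lt (by assumption))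
      | succ d ih =>
        intro h
        have h' : (S k).1 ≤ (S (k + d)).1 := hmono.monotone (Nat.le_add_right k d)
        rw [← ih h', ← hz (k + d), stdm_comp]
        rfl
    have hkl := hle k
    obtain ⟨d, hd⟩ := Nat.exists_eq_add_of_le hkl
    rw [hΘ]
    have hg : ∀ l (hl : l = k + d) (h : (S k).1 ≤ (S l).1), fm (S l).2.1 (stdm (S k).1 (S l).1 h z) = fm (S k).2.1 z := by
      intro l hl h; subst hl; exact this d h
    exact hg _ hd _
  refine mf_of_tower hG Θ hcomp1 ?_
  let W : Submodule F Q :=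
    { carrier := {x | ∀ ε, 0 < ε → ∃ n Z, N (x - Θ n Z) < ε}
      zero_mem' := fun ε hε => ⟨0, 0, by rw [map_zero, sub_zero, prf_zero hr]; exact hε⟩
      add_mem' := by
        intro x y hx hy ε hε
        obtain ⟨n, Z, h⟩ := hx (ε / 2) (by positivity)
        obtain ⟨n', Z', h'⟩ := hy (ε / 2) (by positivity)
        refine ⟨max n n', stdm n _ (le_max_left _ _) Z + stdm n' _ (le_max_right _ _) Z', ?_⟩
        rw [map_add, hcomp, hcomp, add_sub_add_comm]
        exact (hr.subadditive _ _).trans_lt (by linarith)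
      smul_mem' := by
        intro c x hx ε hε
        obtain ⟨n, Z, h⟩ := hx ε hε
        refine ⟨n, c • Z, ?_⟩
        rw [map_smul, ← smul_sub]
        exact (smul_rank_le hr c _).trans_lt h }
  have hW : ∀ j, e j ∈ W := by
    intro j ε hε
    obtain ⟨k, hk⟩ := exists_nat_one_div_lt hε
    obtain ⟨Y, hY'⟩ := hY (max k (j + 1)) j (lt_of_lt_of_le (Nat.lt_succ_self j) (le_max_right _ _))
    refine ⟨_, Y, ?_⟩
    rw [hSk]
    refine hY'.trans (lt_of_le_of_lt ?_ hk)
    apply one_div_le_one_div_of_le (by positivity)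
    have : (k : ℝ) ≤ ((max k (j + 1) : ℕ) : ℝ) := Nat.cast_le.2 (le_max_left _ _)
    linarith
  have hV := he W hW
  intro x ε hε
  obtain ⟨y, hy, hxy⟩ := hdense x (ε / 2) (by positivity)
  obtain ⟨n, Z, h⟩ := hV hy (ε / 2) (by positivity)
  exact ⟨n, Z, (prf_tri hr x y _).trans_lt (by linarith)⟩

end P13

section P14
set_option linter.unusedSectionVars false
set_option linter.unusedSimpArgs false
set_option linter.unusedVariables false
variable {F : Type} [Field F] [StarRing F]
variable {Q : Type} [Ring Q] [Algebra F Q] [StarRing Q] [StarModule F Q] {N : Q → ℝ}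

open Matrix

lemma e00_proj {k : ℕ} {n : Fin k → ℕ} (hn : ∀ i, 0 < n i) (i : Fin k) :
    IsProjection (Pi.single i (Matrix.single ⟨0, hn i⟩ ⟨0, hn i⟩ 1) :
      ∀ i, Matrix (Fin (n i)) (Fin (n i)) F) := by
  constructor
  · rw [← Pi.single_star, Matrix.star_eq_conjTranspose, Matrix.conjTranspose_single, star_one]
  · rw [← Pi.single_mul, Matrix.single_mul_single_same, mul_one]

lemma map_proj {R S : Type} [Ring R] [Algebra F R] [StarRing R] [Ring S] [Algebra F S] [StarRing S]
    (f : R →⋆ₐ[F] S) {p : R} (hp : IsProjection p) : IsProjection (f p) :=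
  ⟨by rw [← map_star, hp.1], by rw [← map_mul, hp.2]⟩

lemma dl_of_iii (hG : Good Q N)
    (h : ∀ ε : ℝ, 0 < ε → ∀ (n : ℕ) (x : Fin n → Q) (p₁ p₂ : Q),
          IsProjection p₁ → IsProjection p₂ →
            ∃ A : StarSubalgebra F Q, IsStandardMatricialStarAlgebra F A ∧
              (∃ y : Fin n → Q, (∀ i, y i ∈ A) ∧ ∀ i, N (x i - y i) < ε) ∧
              ∃ q₁ q₂ : Q,
                IsHereditarilyQuasiStandard F N A q₁ ∧
                IsHereditarilyQuasiStandard F N A q₂ ∧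
                N (p₁ - q₁) < ε ∧ N (p₂ - q₂) < ε) : DL F N := by
  have hAD : ∀ g : Q, IsProjection g → AD N g := by
    intro g hg
    refine ad_of_la (F := F) hG hg (la_of_h1 hG ?_)
    intro δ hδ m x
    obtain ⟨A, -, ⟨y, hyA, hy⟩, q₁, q₂, hq, -, hgq, -⟩ := h δ hδ m x g g hg hg
    obtain ⟨hqA, ⟨k, n, hn, γ, e, he, hd, w, hw1, hw2⟩, -⟩ := hq
    refine ⟨k + 1, n, hn, A.subtype.comp (γ.symm : _ →⋆ₐ[F] A), fun j => γ ⟨y j, hyA j⟩, γ w, γ e, hd,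
      ⟨by rw [← map_star, he.1], by rw [← map_mul, he.2]⟩, ?_, ?_, ?_⟩
    · rw [← map_star, ← map_mul, ← hw2]
    · rw [← map_star, ← map_mul, ← hw1]
      have : (A.subtype.comp (γ.symm : _ →⋆ₐ[F] A)) (γ ⟨q₁, hqA⟩) = q₁ := by
        simp
      rw [this]; exact hgq
    · intro j
      have : (A.subtype.comp (γ.symm : _ →⋆ₐ[F] A)) (γ ⟨y j, hyA j⟩) = y j := by
        simp
      rw [this]; exact hy j
  refine dl_of_ad hG ?_
  intro δ hδ m x
  obtain ⟨A, ⟨k, n, hn, ⟨γ⟩⟩, ⟨y, hyA, hy⟩, -⟩ := h δ hδ m x 0 0 ⟨star_zero _, mul_zero _⟩ ⟨star_zero _, mul_zero _⟩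
  refine ⟨k + 1, n, hn, A.subtype.comp (γ.symm : _ →⋆ₐ[F] A), fun j => γ ⟨y j, hyA j⟩, ?_, ?_⟩
  · intro j
    have : (A.subtype.comp (γ.symm : _ →⋆ₐ[F] A)) (γ ⟨y j, hyA j⟩) = y j := by
      simp
    rw [this]; exact hy j
  · intro i
    exact hAD _ (map_proj _ (e00_proj hn i))

lemma blockmap_diag {k l : ℕ} {n : Fin (k + 1) → ℕ} {m : Fin (l + 1) → ℕ}
    {Φ : ((i : Fin (k + 1)) → Matrix (Fin (n i)) (Fin (n i)) F) →
      ((j : Fin (l + 1)) → Matrix (Fin (m j)) (Fin (m j)) F)} (h : IsStandardBlockMap F n m Φ)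
    (e : (i : Fin (k + 1)) → Matrix (Fin (n i)) (Fin (n i)) F) (he : ∀ i, (e i).IsDiag) :
    ∀ j, (Φ e j).IsDiag := by
  obtain ⟨t, E, hE⟩ := h
  intro j a b hab
  rw [hE, Matrix.reindex_apply, Matrix.submatrix_apply]
  have hne : (E j).symm a ≠ (E j).symm b := fun h => hab ((E j).symm.injective h)
  generalize (E j).symm a = u at hne ⊢
  generalize (E j).symm b = v at hne ⊢
  obtain ⟨c, x⟩ := u
  obtain ⟨c', y⟩ := v
  by_cases hc : c = c'
  · subst hc
    rw [Matrix.blockDiagonal'_apply_eq]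
    exact he _ (fun hxy => hne (by rw [hxy]))
  · exact Matrix.blockDiagonal'_apply_ne _ _ _ hc

lemma e00_diag {k : ℕ} {n : Fin k → ℕ} (hn : ∀ i, 0 < n i) (i : Fin k) (j : Fin k) :
    ((Pi.single i (Matrix.single ⟨0, hn i⟩ ⟨0, hn i⟩ 1) :
      ∀ i, Matrix (Fin (n i)) (Fin (n i)) F) j).IsDiag := by
  by_cases h : j = i
  · subst h
    rw [Pi.single_eq_same]
    intro a b hab
    rw [Matrix.single_apply_of_ne]
    rintro ⟨rfl, rfl⟩
    exact hab rfl
  · rw [Pi.single_eq_of_ne h]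
    exact Matrix.isDiag_zero

lemma dl_of_ii (hG : Good Q N) (D : StdUltramatricialStarCompletionData F Q N) : DL F N := by
  obtain ⟨B, NB, -, -, ⟨C, hC, hun, k, m, hm, γ, hγ⟩, φ, hrk, hdense, -⟩ := D
  have hmono : Monotone C := monotone_nat_of_le_succ hC
  obtain ⟨Ψ, hΨ⟩ : ∃ Ψ : ∀ n, (∀ i, Matrix (Fin (m n i)) (Fin (m n i)) F) →⋆ₐ[F] Q,
      ∀ n b, Ψ n (γ n b) = φ b :=
    ⟨fun n => φ.comp ((C n).subtype.comp ((γ n).symm : _ →⋆ₐ[F] C n)), fun n b => by simp⟩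
  have hap : ∀ δ : ℝ, 0 < δ → ∀ (r : ℕ) (x : Fin r → Q) (n₀ : ℕ), ∃ n, n₀ ≤ n ∧
      ∃ Y : Fin r → ∀ i, Matrix (Fin (m n i)) (Fin (m n i)) F, ∀ j, N (x j - Ψ n (Y j)) < δ := by
    intro δ hδ r x n₀
    have : ∀ j, ∃ b : B, N (x j - φ b) < δ := fun j => by
      obtain ⟨_, ⟨b, rfl⟩, hb⟩ := hdense (x j) δ hδ
      exact ⟨b, hb⟩
    choose b hb using this
    choose l hl using fun j => hun (b j)
    have hle : ∀ j, l j ≤ n₀ + ∑ j, l j := fun j =>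
      (Finset.single_le_sum (f := l) (fun i _ => Nat.zero_le _) (Finset.mem_univ j)).trans (Nat.le_add_left _ _)
    refine ⟨n₀ + ∑ j, l j, Nat.le_add_right _ _, fun j => γ _ ⟨b j, hmono (hle j) (hl j)⟩, fun j => ?_⟩
    rw [hΨ]; exact hb j
  have hdiag : ∀ n e, IsProjection e → (∀ i, (e i).IsDiag) → ∀ d, ∃ e', IsProjection e' ∧ (∀ i, (e' i).IsDiag) ∧
      Ψ (n + d) e' = Ψ n e := by
    intro n e he hd d
    induction d with
    | zero => exact ⟨e, he, hd, rfl⟩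
    | succ d ih =>
      obtain ⟨e', h1, h2, h3⟩ := ih
      have h4 := blockmap_diag (hγ (n + d)) e' h2
      refine ⟨_, ?_, h4, ?_⟩
      · constructor
        · simp only [← map_star, h1.1]
        · simp only [← map_mul, h1.2]
      · rw [← h3]
        refine (hΨ (n + d + 1) _).trans ?_
        conv_rhs => rw [← (γ (n + d)).apply_symm_apply e', hΨ]
        rfl
  refine dl_of_ad hG ?_
  intro δ hδ r x
  obtain ⟨n, -, Y, hY⟩ := hap δ hδ r x 0
  refine ⟨_, m n, hm n, Ψ n, Y, hY, fun i => ?_⟩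
  refine ad_of_la (F := F) hG (map_proj _ (e00_proj (hm n) i)) (la_of_h1 hG ?_)
  intro δ' hδ' r' x'
  obtain ⟨n', hn', Y', hY'⟩ := hap δ' hδ' r' x' n
  obtain ⟨d, rfl⟩ := Nat.exists_eq_add_of_le hn'
  obtain ⟨e, h1, h2, h3⟩ := hdiag n _ (e00_proj (hm n) i) (e00_diag (hm n) i) d
  refine ⟨_, m (n + d), hm _, Ψ (n + d), Y', e, e, h2, h1, by rw [h1.1, h1.2], ?_, hY'⟩
  rw [h1.1, h1.2, h3, sub_self, prf_zero hG.rk.1]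
  exact hδ'

end P14

section P15
set_option linter.unusedSectionVars false
set_option linter.unusedSimpArgs false
set_option linter.unusedVariables false
variable {F : Type} [Field F] [StarRing F]
variable {Q : Type} [Ring Q] [Algebra F Q] [StarRing Q] [StarModule F Q] {N : Q → ℝ}

open Matrix

/-- a matrix algebra as a product with one factor -/
def oneFactor (F : Type) [Field F] [StarRing F] (a : ℕ) :
    Matrix (Fin a) (Fin a) F ≃⋆ₐ[F] ((i : Fin (0 + 1)) → Matrix (Fin a) (Fin a) F) where
  toFun z := fun _ => z
  invFun z := z 0
  left_inv z := rfl
  right_inv z := by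
    funext i
    exact congrArg z (Fin.ext (by have := i.2; simp only [Fin.val_zero]; omega))
  map_mul' _ _ := rfl
  map_add' _ _ := rfl
  map_star' _ := rfl
  map_smul' _ _ := rfl

lemma oneFactor_apply (a : ℕ) (z : Matrix (Fin a) (Fin a) F) (i) : oneFactor F a z i = z := rfl

lemma oneFactor_symm_apply (a : ℕ) (z) : (oneFactor F a).symm z = z 0 := rfl

/-- a diagonal projection of given rank -/
lemma diag_proj {T : Type} [Fintype T] [DecidableEq T] (r : ℕ) (hr : r ≤ Fintype.card T) :
    ∃ R : Matrix T T F, IsProjection R ∧ R.IsDiag ∧ R.rank = r := by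
  classical
  obtain ⟨s, hs, hsc⟩ := Finset.exists_subset_card_eq (s := (Finset.univ : Finset T)) hr
  refine ⟨diagonal fun i => if i ∈ s then 1 else 0, ⟨?_, ?_⟩, Matrix.isDiag_diagonal _, ?_⟩
  · rw [Matrix.star_eq_conjTranspose, Matrix.diagonal_conjTranspose]
    congr 1; funext i
    simp only [Pi.star_apply]
    split_ifs <;> simp
  · rw [Matrix.diagonal_mul_diagonal]
    congr 1; funext i
    split_ifs <;> simp
  · rw [Matrix.rank_diagonal, ← hsc]
    simp

/-- the tower, bundled -/
lemma tower_of_mf {A : ℕ → StarSubalgebra F Q} {hA : ∀ n, A n ≤ A (n + 1)}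
    {γ : (n : ℕ) → ((A n) ≃⋆ₐ[F] Matrix (Fin (2 ^ n)) (Fin (2 ^ n)) F)}
    (h : ∀ n, IsStandardMatrixMap F
              (fun z => γ (n + 1) (StarSubalgebra.inclusion (hA n) ((γ n).symm z)))) :
    ∀ n d, ∃ E : Fin (2 ^ n) × Fin (2 ^ d) ≃ Fin (2 ^ (n + d)), ∀ z,
      ((γ (n + d)).symm (Matrix.reindex E E (z ⊗ₖ (1 : Matrix (Fin (2 ^ d)) (Fin (2 ^ d)) F))) : Q) =
        (γ n).symm z := by
  intro n d
  induction d with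
  | zero =>
    haveI : Unique (Fin (2 ^ 0)) := inferInstanceAs (Unique (Fin 1))
    refine ⟨(Equiv.prodUnique (Fin (2 ^ n)) (Fin (2 ^ 0))), fun z => ?_⟩
    congr 2
    ext i j
    rw [Matrix.reindex_apply, Matrix.submatrix_apply, Matrix.kroneckerMap_apply, Matrix.one_apply,
      if_pos (Subsingleton.elim _ _), mul_one]
    rfl
  | succ d ih =>
    obtain ⟨E, hE⟩ := ih
    obtain ⟨t, E', hE'⟩ := h (n + d)
    have ht : t = 2 := by
      have := Fintype.card_congr E'
      simp only [Fintype.card_prod, Fintype.card_fin] at this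
      have h2 : 2 ^ (n + d) * t = 2 ^ (n + d) * 2 := by rw [this, pow_succ]
      exact Nat.eq_of_mul_eq_mul_left (by positivity) h2
    subst ht
    obtain ⟨G, hG⟩ : ∃ G : Fin (2 ^ d) × Fin 2 ≃ Fin (2 ^ (d + 1)), True :=
      ⟨finProdFinEquiv.trans (finCongr (by rw [pow_succ])), trivial⟩
    refine ⟨((Equiv.prodCongr (Equiv.refl _) G.symm).trans (Equiv.prodAssoc _ _ _).symm).trans
      ((Equiv.prodCongr E (Equiv.refl _)).trans E'), fun z => ?_⟩
    rw [← hE]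
    have h1 := hE' (Matrix.reindex E E (z ⊗ₖ (1 : Matrix (Fin (2 ^ d)) (Fin (2 ^ d)) F)))
    have h2 := congrArg (γ (n + d + 1)).symm h1
    simp only [StarAlgEquiv.symm_apply_apply] at h2
    have h3 := congrArg (Subtype.val) h2
    refine Eq.trans ?_ h3.symm
    refine congrArg (fun w => ((γ (n + d + 1)).symm w : Q)) ?_
    ext i j
    simp only [Matrix.reindex_apply, Matrix.submatrix_apply, Matrix.kroneckerMap_apply, Matrix.one_apply,
      Matrix.blockDiagonal_apply, Equiv.symm_trans_apply, Equiv.prodCongr_symm, Equiv.prodCongr_apply, Prod.map,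
      Equiv.symm_symm, Equiv.prodAssoc_apply, Equiv.refl_symm, Equiv.refl_apply]
    simp only [G.injective.eq_iff, Prod.mk.injEq, mul_ite, mul_one, mul_zero]
    by_cases ha : (E'.symm i).2 = (E'.symm j).2 <;> by_cases hb : (E.symm (E'.symm i).1).2 = (E.symm (E'.symm j).1).2 <;> simp [ha, hb]

lemma iii_of_mf (hF : PosDefStar F) (hG : Good Q N) (h : IsMFStarCompletion F Q N) :
    ∀ ε : ℝ, 0 < ε → ∀ (n : ℕ) (x : Fin n → Q) (p₁ p₂ : Q),
          IsProjection p₁ → IsProjection p₂ →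
            ∃ A : StarSubalgebra F Q, IsStandardMatricialStarAlgebra F A ∧
              (∃ y : Fin n → Q, (∀ i, y i ∈ A) ∧ ∀ i, N (x i - y i) < ε) ∧
              ∃ q₁ q₂ : Q,
                IsHereditarilyQuasiStandard F N A q₁ ∧
                IsHereditarilyQuasiStandard F N A q₂ ∧
                N (p₁ - q₁) < ε ∧ N (p₂ - q₂) < ε := by
  obtain ⟨-, -, -, A, hA, γ, hd, hγ⟩ := h
  have hr := hG.rk.1
  have hT := tower_of_mf hγ
  have hmono : Monotone A := monotone_nat_of_le_succ hA
  have hsm : ∀ n, IsStandardMatricialStarAlgebra F (A n) := fun n =>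
    ⟨0, fun _ => 2 ^ n, fun _ => by positivity, ⟨(γ n).trans (oneFactor F (2 ^ n))⟩⟩
  have hqs : ∀ n (p : Q) (hp : p ∈ A n), IsProjection p → ∃ hp' : p ∈ A (n + n),
      IsQuasiStandardProjection F (A (n + n)) ⟨p, hp'⟩ := by
    intro n p hp hpp
    obtain ⟨E, hE⟩ := hT n n
    have hp' : p ∈ A (n + n) := hmono (Nat.le_add_left _ _) hp
    refine ⟨hp', 0, fun _ => 2 ^ (n + n), fun _ => by positivity, (γ (n + n)).trans (oneFactor F _), ?_⟩
    obtain ⟨P, hP⟩ : ∃ P, P = γ n ⟨p, hp⟩ := ⟨_, rfl⟩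
    have hpp' : IsProjection (⟨p, hp⟩ : A n) := ⟨Subtype.ext hpp.1, Subtype.ext hpp.2⟩
    have hPP : IsProjection P := by
      rw [hP]; exact ⟨by rw [← map_star, hpp'.1], by rw [← map_mul, hpp'.2]⟩
    obtain ⟨R, hR, hRd, hRr⟩ := diag_proj (F := F) (T := Fin (2 ^ n)) P.rank (Matrix.rank_le_card_width P)
    obtain ⟨W, hW1, hW2⟩ := proj_equiv hF n (by simp) P R hPP hR hRr.symm
    have hRR : IsProjection (R ⊗ₖ (1 : Matrix (Fin (2 ^ n)) (Fin (2 ^ n)) F)) := by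
      rw [← hW2]
      have hq : R ⊗ₖ (1 : Matrix (Fin (2 ^ n)) (Fin (2 ^ n)) F) * R ⊗ₖ (1 : Matrix (Fin (2 ^ n)) (Fin (2 ^ n)) F) =
        R ⊗ₖ (1 : Matrix (Fin (2 ^ n)) (Fin (2 ^ n)) F) := by
        rw [← Matrix.mul_kronecker_mul, hR.2, mul_one]
      exact ⟨by rw [star_mul, star_star], by rw [hW2, hq]⟩
    have hst : ∀ X : Matrix (Fin (2 ^ n) × Fin (2 ^ n)) (Fin (2 ^ n) × Fin (2 ^ n)) F,
        star (Matrix.reindex E E X) = Matrix.reindex E E (star X) := fun X => by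
      rw [Matrix.star_eq_conjTranspose, Matrix.conjTranspose_reindex]; rfl
    have hml : ∀ X Y : Matrix (Fin (2 ^ n) × Fin (2 ^ n)) (Fin (2 ^ n) × Fin (2 ^ n)) F,
        Matrix.reindex E E X * Matrix.reindex E E Y = Matrix.reindex E E (X * Y) := fun X Y => by
      rw [Matrix.reindex_apply, Matrix.reindex_apply, Matrix.submatrix_mul_equiv]; rfl
    refine ⟨(γ (n + n)).symm (Matrix.reindex E E (R ⊗ₖ (1 : Matrix (Fin (2 ^ n)) (Fin (2 ^ n)) F))), ⟨?_, ?_⟩, ?_,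
      (γ (n + n)).symm (Matrix.reindex E E W), ?_, ?_⟩
    · rw [← map_star, hst, hRR.1]
    · rw [← map_mul, hml, hRR.2]
    · intro i
      rw [StarAlgEquiv.trans_apply, StarAlgEquiv.apply_symm_apply, oneFactor_apply]
      intro a b hab
      rw [Matrix.reindex_apply, Matrix.submatrix_apply, Matrix.kroneckerMap_apply, Matrix.one_apply]
      split_ifs with h2
      · rw [hRd, zero_mul]
        intro h1
        exact hab (E.symm.injective (Prod.ext h1 h2))
      · rw [mul_zero]
    · rw [← map_star, ← map_mul, hst, hml, hW1]
      apply Subtype.ext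
      rw [hE, hP, StarAlgEquiv.symm_apply_apply]
    · rw [← map_star, ← map_mul, hst, hml, hW2]
  have hHQ : ∀ n (p : Q), p ∈ A n → IsProjection p → IsHereditarilyQuasiStandard F N (A (n + n)) p := by
    intro n p hp hpp
    obtain ⟨hp', hq⟩ := hqs n p hp hpp
    refine ⟨hp', hq, ?_⟩
    intro p' hp'A hp'p hle ε hε
    obtain ⟨hp'', hq'⟩ := hqs (n + n) p' hp'A hp'p
    exact ⟨A (n + n + (n + n)), hmono (Nat.le_add_left _ _), hsm _, p', hp'', hp'p, ⟨hp'p.2, hp'p.2⟩,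
      by rw [sub_self, prf_zero hr]; exact hε, hq'⟩
  intro ε hε r x p₁ p₂ hp₁ hp₂
  have hap : ∀ x : Q, ∃ n, ∃ y ∈ A n, N (x - y) < ε / 2 := by
    intro x
    obtain ⟨y, hy, hxy⟩ := hd x (ε / 2) (by positivity)
    obtain ⟨n, hn⟩ := Set.mem_iUnion.1 hy
    exact ⟨n, y, hn, hxy⟩
  choose l y hy hxy using hap
  obtain ⟨n, hn⟩ : ∃ n, n = (∑ i, l (x i)) + l p₁ + l p₂ := ⟨_, rfl⟩
  have hx : ∀ i, l (x i) ≤ n := fun i => by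
    have := (Finset.single_le_sum (f := fun i => l (x i)) (fun i _ => Nat.zero_le _) (Finset.mem_univ i))
    omega
  have hproj : ∀ p : Q, l p ≤ n → IsProjection p → ∃ q ∈ A n, IsProjection q ∧ N (p - q) < ε := by
    intro p hl hp
    obtain ⟨e, he, he1, z, he2⟩ := lp_exists (matrix_regular (F := F) (Fin (2 ^ n))) (matrix_proper hF (Fin (2 ^ n)))
      (γ n ⟨y p, hmono hl (hy p)⟩)
    obtain ⟨Ψ, hΨ⟩ : ∃ Ψ : Matrix (Fin (2 ^ n)) (Fin (2 ^ n)) F →⋆ₐ[F] Q, ∀ z, Ψ z = (γ n).symm z :=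
      ⟨(A n).subtype.comp ((γ n).symm : _ →⋆ₐ[F] A n), fun z => rfl⟩
    have hy' : Ψ (γ n ⟨y p, hmono hl (hy p)⟩) = y p := by rw [hΨ, StarAlgEquiv.symm_apply_apply]
    refine ⟨Ψ e, by rw [hΨ]; exact Subtype.property _, map_proj Ψ he, ?_⟩
    have h1 : IsLeftProjOf (y p) (Ψ e) :=
      ⟨map_proj Ψ he, by rw [← hy', ← map_mul, he1], Ψ z, by rw [← hy', ← map_mul, he2]⟩
    have h2 : IsLeftProjOf p p := ⟨hp, hp.2, p, hp.2.symm⟩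
    have := lp_close hG h2 h1
    have := hxy p
    linarith
  obtain ⟨q₁, hq₁, hq₁', h1⟩ := hproj p₁ (by omega) hp₁
  obtain ⟨q₂, hq₂, hq₂', h2⟩ := hproj p₂ (by omega) hp₂
  refine ⟨A (n + n), hsm _, ⟨fun i => y (x i), fun i => hmono ((hx i).trans (Nat.le_add_left _ _)) (hy _),
    fun i => (hxy (x i)).trans (by linarith)⟩, q₁, q₂, hHQ n _ hq₁ hq₁', hHQ n _ hq₂ hq₂', h1, h2⟩

end P15

section P16
set_option linter.unusedSectionVars false
set_option linter.unusedSimpArgs false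
set_option linter.unusedVariables false
variable {F : Type} [Field F] [StarRing F]
variable {Q : Type} [Ring Q] [Algebra F Q] [StarRing Q] [StarModule F Q] {N : Q → ℝ}

open Matrix

/-- uniqueness of pseudo-rank functions on matrix algebras -/
lemma matrix_prf_unique {T : Type} [Fintype T] [DecidableEq T] [Nonempty T] {S S' : Matrix T T F → ℝ}
    (h : IsPseudoRankFunction S) (h' : IsPseudoRankFunction S') (M : Matrix T T F) : S M = S' M := by
  classical
  obtain ⟨L, L', A, A', D, hM, h1, h2, h3, h4⟩ := matrix_pivot M
  have key : ∀ {S : Matrix T T F → ℝ}, IsPseudoRankFunction S →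
      S M = ((Finset.univ.filter fun i => D i ≠ 0).card : ℝ) / (Fintype.card T : ℝ) := by
    intro S h
    have hdiag : ∀ c : T → F, diagonal c = ∑ i, Matrix.single i i (c i) := fun c => by
      ext a b
      rw [Matrix.sum_apply, Finset.sum_eq_single a]
      · by_cases hab : a = b
        · subst hab; simp
        · rw [Matrix.diagonal_apply_ne _ hab, Matrix.single_apply_of_ne]
          rintro ⟨-, h⟩; exact hab h
      · intro i _ hi
        rw [Matrix.single_apply_of_ne]
        rintro ⟨h, -⟩; exact hi h
      · simp
    have e1 : S M = S (diagonal D) := by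
      apply le_antisymm
      · rw [hM]; exact prf_mul_mul_le h _ _ _
      · have : diagonal D = A * M * A' := by
          rw [hM]
          calc diagonal D = (A * L) * diagonal D * (L' * A') := by rw [h1, h3, one_mul, mul_one]
            _ = _ := by simp only [mul_assoc]
        rw [this]; exact prf_mul_mul_le h _ _ _
    have e2 : S (diagonal D) = S (diagonal fun i => if D i ≠ 0 then (1 : F) else 0) := by
      apply le_antisymm
      · have : diagonal D = (diagonal fun i => if D i ≠ 0 then (1 : F) else 0) * diagonal D := by
          rw [diagonal_mul_diagonal]; congr 1; funext i
          by_cases hd : D i = 0 <;> simp [hd]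
        rw [this]; exact h.mul_le_left _ _
      · have : (diagonal fun i => if D i ≠ 0 then (1 : F) else 0) = diagonal D * diagonal fun i => (D i)⁻¹ := by
          rw [diagonal_mul_diagonal]; congr 1; funext i
          by_cases hd : D i = 0 <;> simp [hd]
        rw [this]; exact h.mul_le_left _ _
    have e3 : ∀ i j : T, S (Matrix.single i i 1) ≤ S (Matrix.single j j 1) := by
      intro i j
      have : Matrix.single i i (1 : F) = Matrix.single i j 1 * Matrix.single j j 1 * Matrix.single j i 1 := by
        simp
      rw [this]; exact prf_mul_mul_le h _ _ _
    have e4 : ∀ s : Finset T, S (∑ i ∈ s, Matrix.single i i 1) = ∑ i ∈ s, S (Matrix.single i i 1) := by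
      intro s
      refine prf_sum_orth h s _ (fun i _ => by simp) (fun i _ j _ hij => ?_)
      rw [Matrix.single_mul_single_of_ne _ _ _ _ hij]
    obtain ⟨i₀⟩ := ‹Nonempty T›
    have e5 : ∀ s : Finset T, S (∑ i ∈ s, Matrix.single i i 1) = s.card * S (Matrix.single i₀ i₀ 1) := by
      intro s
      rw [e4, Finset.sum_congr rfl (fun i _ => le_antisymm (e3 i i₀) (e3 i₀ i)), Finset.sum_const, nsmul_eq_mul]
    have e6 := e5 Finset.univ
    rw [← hdiag (fun _ => 1), diagonal_one, h.map_one, Finset.card_univ] at e6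
    have hpos : (0 : ℝ) < Fintype.card T := by
      rw [Nat.cast_pos]; exact Fintype.card_pos_iff.2 ⟨i₀⟩
    have e7 : (diagonal fun i => if D i ≠ 0 then (1 : F) else 0) =
        ∑ i ∈ Finset.univ.filter (fun i => D i ≠ 0), Matrix.single i i 1 := by
      rw [hdiag, Finset.sum_filter]
      refine Finset.sum_congr rfl fun i _ => ?_
      split_ifs <;> simp
    rw [e1, e2, e7, e5, eq_div_iff hpos.ne', mul_assoc, mul_comm (S _), ← e6, mul_one]
  rw [key h, key h']

lemma prf_comap {R S : Type} [Ring R] [Ring S] (f : R →+* S) {M : S → ℝ} (h : IsPseudoRankFunction M) :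
    IsPseudoRankFunction fun x => M (f x) where
  nonneg x := h.nonneg _
  le_one x := h.le_one _
  map_one := by rw [map_one, h.map_one]
  subadditive a b := by rw [map_add]; exact h.subadditive _ _
  mul_le_left a b := by rw [map_mul]; exact h.mul_le_left _ _
  mul_le_right a b := by rw [map_mul]; exact h.mul_le_right _ _
  add_of_orthogonal e e' he he' h1 h2 := by
    rw [map_add]
    refine h.add_of_orthogonal _ _ (he.map f) (he'.map f) ?_ ?_
    · rw [← map_mul, h1, map_zero]
    · rw [← map_mul, h2, map_zero]

lemma block_of_matrix {a b : ℕ} {Φ : Matrix (Fin a) (Fin a) F → Matrix (Fin b) (Fin b) F}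
    (h : IsStandardMatrixMap F Φ) :
    IsStandardBlockMap F (k := 0) (l := 0) (fun _ => a) (fun _ => b)
      (fun z => oneFactor F b (Φ ((oneFactor F a).symm z))) := by
  obtain ⟨t, E, hE⟩ := h
  obtain ⟨G, hG⟩ : ∃ G : (Σ c : (Σ i : Fin (0 + 1), Fin t), Fin a) ≃ Fin a × Fin t,
      ∀ c, G c = (c.2, c.1.2) :=
    ⟨{ toFun := fun c => (c.2, c.1.2)
       invFun := fun p => ⟨⟨0, p.2⟩, p.1⟩
       left_inv := by
        rintro ⟨⟨i, c⟩, x⟩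
        have : i = 0 := Fin.ext (by have := i.2; simp only [Fin.val_zero]; omega)
        subst this
        rfl
       right_inv := fun p => rfl }, fun c => rfl⟩
  refine ⟨fun _ _ => t, fun _ => G.trans E, fun z j => ?_⟩
  refine Eq.trans (hE (z 0)) ?_
  change _ = Matrix.reindex (G.trans E) (G.trans E) _
  ext x y
  rw [Matrix.reindex_apply, Matrix.reindex_apply, Matrix.submatrix_apply, Matrix.submatrix_apply,
    Equiv.symm_trans_apply, Equiv.symm_trans_apply]
  generalize E.symm x = u
  generalize E.symm y = v
  obtain ⟨u, rfl⟩ := G.surjective u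
  obtain ⟨v, rfl⟩ := G.surjective v
  rw [Equiv.symm_apply_apply, Equiv.symm_apply_apply, hG, hG, Matrix.blockDiagonal_apply]
  obtain ⟨⟨i, c⟩, x⟩ := u
  obtain ⟨⟨i', c'⟩, y⟩ := v
  have hi : i = 0 := Fin.ext (by have := i.2; simp only [Fin.val_zero]; omega)
  have hi' : i' = 0 := Fin.ext (by have := i'.2; simp only [Fin.val_zero]; omega)
  subst hi; subst hi'
  by_cases hc : c = c'
  · subst hc
    rw [Matrix.blockDiagonal'_apply_eq]
    simp
  · rw [Matrix.blockDiagonal'_apply_ne _ _ _ (fun h => hc (by cases h; rfl))]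
    simp [hc]

lemma ii_of_mf (hG : Good Q N) (h : IsMFStarCompletion F Q N) :
    Nonempty (StdUltramatricialStarCompletionData F Q N) := by
  obtain ⟨-, -, hcomplete, A, hA, γ, hd, hγ⟩ := h
  have hr := hG.rk.1
  have hmono : Monotone A := monotone_nat_of_le_succ hA
  have hdir : ∀ {x y : Q}, (∃ n, x ∈ A n) → (∃ n, y ∈ A n) → ∃ n, x ∈ A n ∧ y ∈ A n := by
    rintro x y ⟨n, hn⟩ ⟨m, hm⟩
    exact ⟨max n m, hmono (le_max_left _ _) hn, hmono (le_max_right _ _) hm⟩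
  obtain ⟨B, hB⟩ : ∃ B : StarSubalgebra F Q, ∀ x, x ∈ B ↔ ∃ n, x ∈ A n :=
    ⟨{ carrier := {x | ∃ n, x ∈ A n}
       mul_mem' := fun hx hy => by
        obtain ⟨n, h1, h2⟩ := hdir hx hy
        exact ⟨n, mul_mem h1 h2⟩
       add_mem' := fun hx hy => by
        obtain ⟨n, h1, h2⟩ := hdir hx hy
        exact ⟨n, add_mem h1 h2⟩
       algebraMap_mem' := fun c => ⟨0, algebraMap_mem (A 0) c⟩
       star_mem' := fun hx => by
        obtain ⟨n, h1⟩ := hx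
        exact ⟨n, star_mem h1⟩ }, fun x => Iff.rfl⟩
  have hAB : ∀ n, A n ≤ B := fun n x hx => (hB x).2 ⟨n, hx⟩
  have hNB : IsPseudoRankFunction fun b : B => N b := prf_comap (B.subtype : B →+* Q) hr
  have huniq : ∀ S : B → ℝ, IsPseudoRankFunction S → S = fun b : B => N b := by
    intro S hS
    funext b
    obtain ⟨n, hn⟩ := (hB b).1 b.2
    have : Nonempty (Fin (2 ^ n)) := ⟨⟨0, by positivity⟩⟩
    obtain ⟨Ψ, hΨ⟩ : ∃ Ψ : Matrix (Fin (2 ^ n)) (Fin (2 ^ n)) F →⋆ₐ[F] B, ∀ z, Ψ (γ n z) = StarSubalgebra.inclusion (hAB n) z :=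
      ⟨(StarSubalgebra.inclusion (hAB n)).comp ((γ n).symm : _ →⋆ₐ[F] A n), fun z => by simp⟩
    have h1 := matrix_prf_unique (prf_comap (Ψ : _ →+* B) hS) (prf_comap (Ψ : _ →+* B) hNB) (γ n ⟨b, hn⟩)
    have h2 : Ψ (γ n ⟨b, hn⟩) = b := by rw [hΨ]; rfl
    simp only [RingHom.coe_coe, h2] at h1
    exact h1
  obtain ⟨ι, hι⟩ : ∃ ι : ∀ n, (A n).comap B.subtype ≃⋆ₐ[F] A n, ∀ n x, ((ι n x : A n) : Q) = ((x : B) : Q) :=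
    ⟨fun n =>
      { toFun := fun x => ⟨(x : B), x.2⟩
        invFun := fun x => ⟨⟨x, hAB n x.2⟩, x.2⟩
        left_inv := fun x => rfl
        right_inv := fun x => rfl
        map_mul' := fun _ _ => rfl
        map_add' := fun _ _ => rfl
        map_star' := fun _ => rfl
        map_smul' := fun _ _ => rfl }, fun n x => rfl⟩
  have hC : ∀ n, (A n).comap B.subtype ≤ (A (n + 1)).comap B.subtype := fun n x hx => hA n hx
  refine ⟨{ B := B, NB := fun b => N b, pseudoRank := hNB, extremal := ?_, stdUltramatricial := ?_,
            φ := B.subtype, rank_eq := fun b => rfl, dense := ?_, complete := hcomplete }⟩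
  · rw [IsExtremalPseudoRankFunction, mem_extremePoints]
    exact ⟨hNB, fun S₁ h₁ S₂ h₂ _ => ⟨huniq S₁ h₁, huniq S₂ h₂⟩⟩
  · refine ⟨fun n => (A n).comap B.subtype, hC, fun b => (hB b).1 b.2, fun _ => 0, fun n _ => 2 ^ n,
      fun n i => by positivity, fun n => ((ι n).trans (γ n)).trans (oneFactor F (2 ^ n)), fun n => ?_⟩
    have := block_of_matrix (hγ n)
    convert this using 2 with z
    simp only [StarAlgEquiv.trans_apply]
    refine congrArg (oneFactor F (2 ^ (n + 1))) (congrArg (γ (n + 1)) (Subtype.ext ?_))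
    rw [hι]
    obtain ⟨w, hw⟩ : ∃ w, (((ι n).trans (γ n)).trans (oneFactor F (2 ^ n))) w = z :=
      ⟨(((ι n).trans (γ n)).trans (oneFactor F (2 ^ n))).symm z, StarAlgEquiv.apply_symm_apply _ _⟩
    rw [← hw, StarAlgEquiv.symm_apply_apply]
    simp only [StarAlgEquiv.trans_apply, StarAlgEquiv.symm_apply_apply]
    exact (hι n w).symm
  · intro x ε hε
    obtain ⟨y, hy, h⟩ := hd x ε hε
    exact ⟨y, ⟨⟨y, (hB y).2 (Set.mem_iUnion.1 hy)⟩, rfl⟩, h⟩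

end P16

/-- **Theorem 4.7** (Ara–Claramunt). Let `(F, *)` be a field with positive definite involution
and let `Q` be a continuous `*`-factor over `F` with a dense `*`-subalgebra of countable
`F`-dimension. The following are equivalent: (i) `Q ≅ M_F` as `*`-algebras; (ii) `Q` is the
completion of a standard ultramatricial `*`-algebra with respect to an extremal pseudo-rank
function; (iii) `Q` is locally approximated by standard matricial `*`-subalgebras, with
projections approximated by hereditarily quasi-standard ones. -/
theorem statement14 (F : Type) [Field F] [StarRing F] (hF : PosDefStar F)
    (Q : Type) [Ring Q] [Algebra F Q] [StarRing Q] [StarModule F Q]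
    (hQ : IsContinuousFactor Q) (hQproper : ProperStar Q)
    (NQ : Q → ℝ) (hNQ : IsRankFunction NQ)
    (Q₀ : StarSubalgebra F Q) (hdim : Module.rank F Q₀ ≤ Cardinal.aleph0)
    (hdense : RankDense NQ (Q₀ : Set Q)) :
    List.TFAE
      [ IsMFStarCompletion F Q NQ,
        Nonempty (StdUltramatricialStarCompletionData F Q NQ),
        ∀ ε : ℝ, 0 < ε → ∀ (n : ℕ) (x : Fin n → Q) (p₁ p₂ : Q),
          IsProjection p₁ → IsProjection p₂ →
            ∃ A : StarSubalgebra F Q, IsStandardMatricialStarAlgebra F A ∧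
              (∃ y : Fin n → Q, (∀ i, y i ∈ A) ∧ ∀ i, NQ (x i - y i) < ε) ∧
              ∃ q₁ q₂ : Q,
                IsHereditarilyQuasiStandard F NQ A q₁ ∧
                IsHereditarilyQuasiStandard F NQ A q₂ ∧
                NQ (p₁ - q₁) < ε ∧ NQ (p₂ - q₂) < ε ] := by
  have hG : Good Q NQ := good_of hQ hQproper hNQ
  tfae_have 1 → 2 := fun h => ii_of_mf hG h
  tfae_have 1 → 3 := fun h => iii_of_mf hF hG h
  tfae_have 2 → 1 := fun ⟨D⟩ => mf_of_dl hF hG (dl_of_ii hG D) Q₀ hdim hdense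
  tfae_have 3 → 1 := fun h => mf_of_dl hF hG (dl_of_iii hG h) Q₀ hdim hdense
  tfae_finish

end AraClaramunt
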